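/- Fix B ≥ 1 and c ∈ {6, 7}. There exists a constant C > 0 such that for every sufficiently large integer n, every pair of integers a, q with 0 ≤ a ≤ q, gcd(a,q) = 1 and 1 ≤ q ≤ L^B, and every real α with |α − a/q| ≤ L^B / n, one has |f_{5,c}(α) − (S_5(q,a)/φ(q)) · P_5^{θ_c}| ≤ C · P_5^{θ_c} · L^{−4B}. -/

import Mathlib

open MeasureTheory Finset

noncomputable section

/-- `e(x) = exp(2πix)`. -/
def e (x : ℝ) : ℂ := Complex.exp (2 * Real.pi * Complex.I * x)

/-- `P_k = n^(1/k)`. -/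
def P (n k : ℕ) : ℝ := (n : ℝ) ^ ((k : ℝ))⁻¹

/-- `θ_6 = 5/6`, `θ_7 = 87/98`. -/
def θ (c : ℕ) : ℝ := if c = 6 then 5 / 6 else 87 / 98

/-- `Θ_c = 2/3 + θ_c/5 + 1/6 + 1/c`. -/
def Θ (c : ℕ) : ℝ := 2 / 3 + θ c / 5 + 1 / 6 + ((c : ℝ))⁻¹

/-- `f_k(α) = Σ_{P_k/2 < p ≤ P_k, p prime} e(α p^k) log p`. -/
def f (n k : ℕ) (α : ℝ) : ℂ :=
  ∑ p ∈ (Finset.range (n + 1)).filter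
      (fun p : ℕ => p.Prime ∧ P n k / 2 < (p : ℝ) ∧ (p : ℝ) ≤ P n k),
    e (α * (p : ℝ) ^ k) * (Real.log p)

/-- `f_{5,c}(α) = Σ_{1 < p ≤ P_5^{θ_c}, p prime} e(α p^5) log p`. -/
def f5 (n c : ℕ) (α : ℝ) : ℂ :=
  ∑ p ∈ (Finset.range (n + 1)).filter
      (fun p : ℕ => p.Prime ∧ 1 < (p : ℝ) ∧ (p : ℝ) ≤ P n 5 ^ θ c),
    e (α * (p : ℝ) ^ 5) * (Real.log p)

/-- `F_c(α) = f_2(α)^2 f_3(α)^2 f_{5,c}(α) f_6(α) f_c(α)`. -/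
def F (n c : ℕ) (α : ℝ) : ℂ :=
  f n 2 α ^ 2 * f n 3 α ^ 2 * f5 n c α * f n 6 α * f n c α

/-- `S_k(q,a) = Σ_{x=1,(x,q)=1}^{q} e(a x^k / q)`. -/
def S (k q a : ℕ) : ℂ :=
  ∑ x ∈ (Finset.Icc 1 q).filter (fun x => Nat.gcd x q = 1),
    e ((a : ℝ) * (x : ℝ) ^ k / q)

/-- `v_k(β) = (1/k) Σ_{2^{-k} n < m ≤ n} m^{1/k-1} e(β m)`. -/
def v (n k : ℕ) (β : ℝ) : ℂ :=
  ((k : ℂ))⁻¹ *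
    ∑ m ∈ (Finset.Icc 1 n).filter (fun m : ℕ => (n : ℝ) / 2 ^ k < (m : ℝ)),
      ((m : ℝ) ^ ((k : ℝ)⁻¹ - 1) : ℝ) * e (β * m)

/-- `w_c(β) = v_2(β)^2 v_3(β)^2 v_6(β) v_c(β)`. -/
def w (n c : ℕ) (β : ℝ) : ℂ := v n 2 β ^ 2 * v n 3 β ^ 2 * v n 6 β * v n c β

/-- `U_c(q,a) = S_2(q,a)^2 S_3(q,a)^2 S_5(q,a) S_6(q,a) S_c(q,a)`. -/
def U (c q a : ℕ) : ℂ := S 2 q a ^ 2 * S 3 q a ^ 2 * S 5 q a * S 6 q a * S c q a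

/-- `A_{n,c}(q) = Σ_{a=1,(a,q)=1}^{q} U_c(q,a) e(-a n / q)`. -/
def A (n : ℤ) (c q : ℕ) : ℂ :=
  ∑ a ∈ (Finset.Icc 1 q).filter (fun a => Nat.gcd a q = 1),
    U c q a * e (-((a : ℝ) * (n : ℝ)) / q)

/-- The major arcs `𝔐`. -/
def Maj (n : ℕ) (B : ℝ) : Set ℝ :=
  {α | α ∈ Set.Icc (0 : ℝ) 1 ∧ ∃ a q : ℕ, a ≤ q ∧ 1 ≤ q ∧
    (q : ℝ) ≤ Real.log n ^ B ∧ Nat.gcd a q = 1 ∧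
    |α - (a : ℝ) / q| ≤ Real.log n ^ B / n}

/-- `Q_c = n^{2/(3c²(c-1))}`. -/
def Q (n c : ℕ) : ℝ := (n : ℝ) ^ (2 / (3 * (c : ℝ) ^ 2 * ((c : ℝ) - 1)))

/-- The arcs `𝕽_c`. -/
def R (n c : ℕ) : Set ℝ :=
  {α | α ∈ Set.Icc (0 : ℝ) 1 ∧ ∃ a q : ℕ, a ≤ q ∧ 1 ≤ q ∧
    (q : ℝ) ≤ Q n c ∧ Nat.gcd a q = 1 ∧ |(q : ℝ) * α - a| ≤ Q n c / n}

/-- `τ = 2^{-20}`. -/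
def τ : ℝ := ((2 : ℝ) ^ (20 : ℕ))⁻¹

/-- The sets `𝓔_c`. -/
def E (n c : ℕ) : Set ℝ :=
  {α | α ∈ Set.Icc (0 : ℝ) 1 ∧
    ‖f n c α‖ ≤ P n c ^ (if c = 6 then 1 - 24 * τ else 139 / 140 - 24 * τ)}

end

namespace SW
open Complex Filter Asymptotics Topology

lemma tail_differentiableAt {E : ℝ → ℂ} (hE : Measurable E) {K : ℝ} (hK : ∀ t, ‖E t‖ ≤ K)
    {N : ℝ} (hN : 1 ≤ N) (h0 : ∀ t ≤ N, E t = 0) {s : ℂ} (hs : 0 < s.re) :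
    DifferentiableAt ℂ (fun z => mellin E (-z)) s := by
  have hloc : LocallyIntegrableOn E (Set.Ioi 0) := by
    apply LocallyIntegrable.locallyIntegrableOn
    refine (locallyIntegrable_const K).mono hE.aestronglyMeasurable ?_
    filter_upwards with t
    exact (hK t).trans (le_abs_self K)
  have h1 : E =O[atTop] fun x : ℝ => x ^ (-(0:ℝ)) := by
    simp only [neg_zero, Real.rpow_zero]
    exact IsBigO.of_bound K (by filter_upwards with t; simpa using hK t)
  have h2 : E =O[𝓝[>] 0] fun x : ℝ => x ^ (-(-s.re - 1)) := by
    have : E =ᶠ[𝓝[>] 0] fun _ => (0:ℂ) := by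
      have : ∀ᶠ t : ℝ in 𝓝[>] 0, t ≤ N := by
        apply eventually_nhdsWithin_of_eventually_nhds
        exact eventually_le_nhds (by linarith)
      filter_upwards [this] with t ht using h0 t ht
    exact this.trans_isBigO (isBigO_zero _ _)
  have := mellin_differentiableAt_of_isBigO_rpow (s := -s) hloc h1 (by simpa using hs) h2 (by simp)
  exact DifferentiableAt.comp s (f := fun z => -z) this differentiableAt_id.neg

lemma tail_eq {E : ℝ → ℂ} {N : ℝ} (hN : 1 ≤ N) (h0 : ∀ t ≤ N, E t = 0) (s : ℂ) :
    mellin E (-s) = ∫ t in Set.Ioi N, E t * (t:ℂ) ^ (-(s + 1)) := by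
  rw [mellin]
  have : Set.Ioi (0:ℝ) = Set.Ioc 0 N ∪ Set.Ioi N := by
    rw [Set.Ioc_union_Ioi_eq_Ioi (by linarith)]
  have h3 : ∫ t in Set.Ioi (0:ℝ), (t:ℂ) ^ (-s - 1) • E t
      = ∫ t in Set.Ioi N, (t:ℂ) ^ (-s - 1) • E t := by
    apply setIntegral_eq_of_subset_of_forall_sdiff_eq_zero measurableSet_Ioi
    · intro t ht; simp only [Set.mem_Ioi] at *; linarith
    · intro t ht
      simp only [Set.mem_sdiff, Set.mem_Ioi, not_lt] at ht
      rw [h0 t ht.2]; simp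
  rw [h3]
  congr 1; ext t
  rw [smul_eq_mul, mul_comm]; congr 2; ring

lemma tail_bound {E : ℝ → ℂ} {K : ℝ} (hK : ∀ t, ‖E t‖ ≤ K)
    {N : ℝ} (hN : 1 ≤ N) (h0 : ∀ t ≤ N, E t = 0) {s : ℂ} (hs : 0 < s.re) :
    ‖mellin E (-s)‖ ≤ K * (N ^ (-s.re) / s.re) := by
  rw [tail_eq hN h0]
  have hN0 : 0 < N := by linarith
  have hIntg : ∫ t in Set.Ioi N, K * t ^ (-s.re - 1) = K * (N ^ (-s.re) / s.re) := by
    rw [integral_const_mul, integral_Ioi_rpow_of_lt (by linarith) hN0]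
    congr 1
    rw [show -s.re - 1 + 1 = -s.re by ring, neg_div_neg_eq]
  rw [← hIntg]
  apply norm_integral_le_of_norm_le
  · exact (integrableOn_Ioi_rpow_of_lt (by linarith) hN0).const_mul K
  · filter_upwards [ae_restrict_mem measurableSet_Ioi] with t ht
    have ht0 : 0 < t := hN0.trans ht
    rw [norm_mul, norm_cpow_eq_rpow_re_of_pos ht0]
    have : (-(s + 1)).re = -s.re - 1 := by simp; ring
    rw [this]
    exact mul_le_mul_of_nonneg_right (hK t) (by positivity)

/-- L-series with bounded partial sums, vanishing up to `N`. -/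
lemma LSeries_eq_tail {g : ℕ → ℂ} {K : ℝ} (hK : ∀ n, ‖∑ k ∈ Icc 1 n, g k‖ ≤ K)
    {s : ℂ} (hs : 0 < s.re) (hS : LSeriesSummable g s) :
    LSeries g s = s * mellin (fun t : ℝ => ∑ k ∈ Icc 1 ⌊t⌋₊, g k) (-s) := by
  have hO : (fun n ↦ ∑ k ∈ Icc 1 n, g k) =O[atTop] fun n ↦ (n : ℝ) ^ (0:ℝ) := by
    simp only [Real.rpow_zero]
    exact IsBigO.of_bound K (by filter_upwards with t; simpa using hK t)
  rw [LSeries_eq_mul_integral g le_rfl hs hS hO]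
  congr 1
  rw [mellin]
  have h3 : ∫ t in Set.Ioi (0:ℝ), (t:ℂ) ^ (-s - 1) • (∑ k ∈ Icc 1 ⌊t⌋₊, g k)
      = ∫ t in Set.Ioi (1:ℝ), (t:ℂ) ^ (-s - 1) • (∑ k ∈ Icc 1 ⌊t⌋₊, g k) := by
    have : ∀ᵐ t : ℝ, t ≠ 1 := by
      simp [ae_iff]
    apply setIntegral_eq_of_subset_of_ae_sdiff_eq_zero measurableSet_Ioi.nullMeasurableSet
    · intro t ht; simp only [Set.mem_Ioi] at *; linarith
    · filter_upwards [this] with t ht1 ht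
      simp only [Set.mem_sdiff, Set.mem_Ioi, not_lt] at ht
      have : t < 1 := lt_of_le_of_ne ht.2 ht1
      have : ⌊t⌋₊ = 0 := Nat.floor_eq_zero.mpr this
      simp [this]
  rw [h3]
  congr 1; ext t
  rw [smul_eq_mul, mul_comm]; congr 2; ring

lemma measurable_floor_sum (g : ℕ → ℂ) :
    Measurable (fun t : ℝ => ∑ k ∈ Icc 1 ⌊t⌋₊, g k) :=
  (measurable_from_nat (f := fun n : ℕ => ∑ k ∈ Icc 1 n, g k)).comp Nat.measurable_floor

/-- Character sums are bounded by the modulus. -/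
lemma char_sum_bound {q : ℕ} [NeZero q] (χ : DirichletCharacter ℂ q) (hχ : χ ≠ 1) (n : ℕ) :
    ‖∑ k ∈ range n, χ (k : ZMod q)‖ ≤ q := by
  have hper : ∀ a : ℕ, ∑ k ∈ range q, χ ((a + k : ℕ) : ZMod q) = 0 := by
    intro a
    have h1 : ∑ x : ZMod q, χ x = 0 := MulChar.sum_eq_zero_of_ne_one hχ
    have h2 : ∑ x : ZMod q, χ ((a : ZMod q) + x) = 0 := by
      rw [← h1]
      exact Fintype.sum_equiv (Equiv.addLeft (a : ZMod q)) _ _ (fun x => rfl)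
    rw [← h2]
    refine Finset.sum_bij' (fun k _ => (k : ZMod q)) (fun x _ => x.val) ?_ ?_ ?_ ?_ ?_
    · simp
    · intro x _; simpa using ZMod.val_lt x
    · intro k hk; simpa using ZMod.val_cast_of_lt (by simpa using hk)
    · intro x _; simp
    · intro k _; simp
  have hm : ∀ m : ℕ, ∑ k ∈ range (q * m), χ (k : ZMod q) = 0 := by
    intro m
    induction m with
    | zero => simp
    | succ m ih => rw [mul_add, mul_one, sum_range_add, ih, hper, zero_add]
  have hn : n = q * (n / q) + n % q := (Nat.div_add_mod n q).symm
  rw [hn, sum_range_add, hm, zero_add]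
  calc ‖∑ x ∈ range (n % q), χ ((q * (n / q) + x : ℕ) : ZMod q)‖
      ≤ ∑ x ∈ range (n % q), (1:ℝ) := norm_sum_le_of_le _ (fun _ _ => χ.norm_le_one _)
    _ = (n % q : ℕ) := by simp
    _ ≤ q := by exact_mod_cast (Nat.mod_lt n (NeZero.pos q)).le

end SW

namespace SW
open Complex Filter Asymptotics Topology

lemma eq_of_eq_re_gt_one {U : Set ℂ} (hU : IsOpen U) (hc : IsPreconnected U) {f g : ℂ → ℂ}
    (hf : DifferentiableOn ℂ f U) (hg : DifferentiableOn ℂ g U) {z : ℂ} (hz : z ∈ U)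
    (hz1 : 1 < z.re) (h : ∀ s, 1 < s.re → f s = g s) {s : ℂ} (hs : s ∈ U) : f s = g s := by
  refine (hf.analyticOnNhd hU).eqOn_of_preconnected_of_eventuallyEq (hg.analyticOnNhd hU) hc hz
    ?_ hs
  filter_upwards [(isOpen_lt continuous_const continuous_re).mem_nhds hz1] with w hw using h w hw

lemma LSeries_trunc (f : ℕ → ℂ) (N : ℕ) {s : ℂ} (hs : LSeriesSummable f s) :
    LSeriesSummable (fun n => if n ≤ N then 0 else f n) s ∧
    LSeries f s = ∑ n ∈ Icc 1 N, f n * (n:ℂ) ^ (-s) +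
      LSeries (fun n => if n ≤ N then 0 else f n) s := by
  have h1 : LSeriesHasSum (fun n => if n ≤ N then f n else 0) s
      (∑ n ∈ Icc 1 N, f n * (n:ℂ) ^ (-s)) := by
    have : ∑ n ∈ Icc 1 N, f n * (n:ℂ) ^ (-s)
        = ∑ n ∈ Icc 1 N, LSeries.term (fun n => if n ≤ N then f n else 0) s n := by
      apply sum_congr rfl
      intro n hn
      simp only [mem_Icc] at hn
      rw [LSeries.term_of_ne_zero (by omega), if_pos hn.2, cpow_neg, div_eq_mul_inv]
    rw [this]
    apply hasSum_sum_of_ne_finset_zero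
    intro n hn
    simp only [mem_Icc, not_and, not_le] at hn
    rcases Nat.eq_zero_or_pos n with h | h
    · simp [h]
    · rw [LSeries.term_of_ne_zero (by omega), if_neg (by have := hn h; omega), zero_div]
  have h2 : (fun n => if n ≤ N then 0 else f n) = f - (fun n => if n ≤ N then f n else 0) := by
    ext n; simp only [Pi.sub_apply]; split_ifs <;> simp
  constructor
  · rw [h2]; exact hs.sub h1.LSeriesSummable
  · rw [h2, LSeries_sub hs h1.LSeriesSummable, h1.LSeries_eq]; ring

lemma char_tail_bound {q : ℕ} [NeZero q] (χ : DirichletCharacter ℂ q) (hχ : χ ≠ 1) (N n : ℕ) :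
    ‖∑ k ∈ Icc 1 n, (if k ≤ N then 0 else χ (k : ZMod q))‖ ≤ 2 * q := by
  have hq : (0:ℝ) ≤ q := by positivity
  rcases le_or_gt n N with h | h
  · rw [sum_eq_zero]
    · simp
    · intro k hk; simp only [mem_Icc] at hk; rw [if_pos (by omega)]
  · have : ∑ k ∈ Icc 1 n, (if k ≤ N then 0 else χ (k : ZMod q))
        = ∑ k ∈ range (n+1), χ (k : ZMod q) - ∑ k ∈ range (N+1), χ (k : ZMod q) := by
      rw [eq_sub_iff_add_eq]
      have h1 : ∑ k ∈ range (N+1), χ (k : ZMod q)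
        = ∑ k ∈ range (n+1), (if k ≤ N then χ (k : ZMod q) else 0) := by
        rw [← sum_filter]
        apply sum_congr _ (fun _ _ => rfl)
        ext k; simp only [mem_range, mem_filter]; omega
      have h2 : ∑ k ∈ Icc 1 n, (if k ≤ N then 0 else χ (k : ZMod q))
        = ∑ k ∈ range (n+1), (if k ≤ N then 0 else χ (k : ZMod q)) := by
        apply sum_subset
        · intro k; simp only [mem_Icc, mem_range]; omega
        · intro k; simp only [mem_Icc, mem_range]; intro h3 h4
          rw [if_pos (by omega)]
      rw [h1, h2, ← sum_add_distrib]
      apply sum_congr rfl; intro k _; split_ifs <;> simp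
    rw [this]
    refine (norm_sub_le _ _).trans ?_
    linarith [char_sum_bound χ hχ (n+1), char_sum_bound χ hχ (N+1)]

/-- the truncated representation for nonprincipal characters -/
lemma LFunction_trunc {q : ℕ} [NeZero q] (χ : DirichletCharacter ℂ q) (hχ : χ ≠ 1) (N : ℕ)
    (hN : 1 ≤ N) {s : ℂ} (hs : 0 < s.re) :
    χ.LFunction s = ∑ n ∈ Icc 1 N, χ n * (n:ℂ) ^ (-s) + s * mellin
      (fun t : ℝ => ∑ k ∈ Icc 1 ⌊t⌋₊, (if k ≤ N then 0 else χ (k : ZMod q))) (-s) := by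
  have hN' : (1:ℝ) ≤ N := by exact_mod_cast hN
  have hz : ∀ t : ℝ, t ≤ N → ∑ k ∈ Icc 1 ⌊t⌋₊, (if k ≤ N then 0 else χ (k : ZMod q)) = 0 := by
    intro t ht
    apply sum_eq_zero
    intro k hk; simp only [mem_Icc] at hk
    rw [if_pos (hk.2.trans (Nat.floor_le_of_le ht))]
  refine eq_of_eq_re_gt_one (U := {s | 0 < s.re}) (z := 2)
    (isOpen_lt continuous_const continuous_re) (convex_halfSpace_re_gt 0).isPreconnected
    (f := χ.LFunction) (g := fun s => ∑ n ∈ Icc 1 N, χ n * (n:ℂ) ^ (-s) + s * mellin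
      (fun t : ℝ => ∑ k ∈ Icc 1 ⌊t⌋₊, (if k ≤ N then 0 else χ (k : ZMod q))) (-s))
    ?_ ?_ (by simp) (by simp) ?_ hs
  · exact (DirichletCharacter.differentiable_LFunction hχ).differentiableOn
  · intro z hz0
    apply DifferentiableAt.differentiableWithinAt
    apply DifferentiableAt.add
    · apply DifferentiableAt.fun_sum
      intro n hn
      simp only [mem_Icc] at hn
      apply DifferentiableAt.const_mul
      apply DifferentiableAt.const_cpow differentiableAt_id.neg
      left; exact_mod_cast (by omega : n ≠ 0)
    · apply differentiableAt_id.mul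
      exact tail_differentiableAt (measurable_floor_sum _) (fun t => char_tail_bound χ hχ N _)
        hN' hz hz0
  · intro z hz1
    have hS := ZMod.LSeriesSummable_of_one_lt_re χ hz1
    rw [χ.LFunction_eq_LSeries hz1, (LSeries_trunc _ N hS).2]
    congr 1
    exact LSeries_eq_tail (fun n => char_tail_bound χ hχ N n) (by linarith) (LSeries_trunc _ N hS).1

/-- Crude bound. -/
lemma LFunction_crude {q : ℕ} [NeZero q] (χ : DirichletCharacter ℂ q) (hχ : χ ≠ 1) (N : ℕ)
    (hN : 1 ≤ N) {s : ℂ} (hs : 0 < s.re) :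
    ‖χ.LFunction s‖ ≤ ∑ n ∈ Icc 1 N, (n:ℝ) ^ (-s.re) + ‖s‖ * (2 * q * ((N:ℝ) ^ (-s.re) / s.re)) := by
  have hN' : (1:ℝ) ≤ N := by exact_mod_cast hN
  have hz : ∀ t : ℝ, t ≤ N → ∑ k ∈ Icc 1 ⌊t⌋₊, (if k ≤ N then 0 else χ (k : ZMod q)) = 0 := by
    intro t ht
    apply sum_eq_zero
    intro k hk; simp only [mem_Icc] at hk
    rw [if_pos (hk.2.trans (Nat.floor_le_of_le ht))]
  rw [LFunction_trunc χ hχ N hN hs]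
  refine (norm_add_le _ _).trans (add_le_add ?_ ?_)
  · apply norm_sum_le_of_le
    intro n hn
    simp only [mem_Icc] at hn
    rw [norm_mul, ← ofReal_natCast, norm_cpow_eq_rpow_re_of_pos (by exact_mod_cast (by omega : 0 < n)), neg_re]
    exact mul_le_of_le_one_left (by positivity) (χ.norm_le_one _)
  · rw [norm_mul]
    exact mul_le_mul_of_nonneg_left (tail_bound (fun t => char_tail_bound χ hχ N _) hN' hz hs)
      (norm_nonneg _)

lemma sum_rpow_bound {ε : ℝ} (h0 : 0 < ε) (h1 : ε ≤ 1) {V σ : ℝ} (hV : 1 ≤ V)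
    (hσ : 1 - ε / 2 ≤ σ) :
    ∑ n ∈ Icc 1 ⌈V⌉₊, (n:ℝ) ^ (-σ) ≤ (2 + 4 / ε) * V ^ ε := by
  set N := ⌈V⌉₊ with hN
  have hNV : V ≤ N := Nat.le_ceil V
  have hN1 : (1:ℝ) ≤ N := hV.trans hNV
  have hN2 : (N:ℝ) ≤ 2 * V := by
    have := (Nat.ceil_lt_add_one (by linarith : 0 ≤ V)).le
    linarith
  have s1 : ∑ n ∈ Icc 1 N, (n:ℝ) ^ (-σ) ≤ ∑ n ∈ Icc 1 N, (N:ℝ) ^ (ε/2) * ((n:ℝ))⁻¹ := by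
    apply sum_le_sum
    intro n hn
    simp only [mem_Icc] at hn
    have hn1 : (1:ℝ) ≤ n := by exact_mod_cast hn.1
    have hn2 : (n:ℝ) ≤ N := by exact_mod_cast hn.2
    calc (n:ℝ) ^ (-σ) ≤ (n:ℝ) ^ (ε/2 + -1) := Real.rpow_le_rpow_of_exponent_le hn1 (by linarith)
      _ = (n:ℝ) ^ (ε/2) * ((n:ℝ))⁻¹ := by
          rw [Real.rpow_add (by linarith), Real.rpow_neg_one]
      _ ≤ _ := by gcongr
  have s2 : ∑ n ∈ Icc 1 N, ((n:ℝ))⁻¹ ≤ 1 + Real.log N := by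
    have := harmonic_le_one_add_log N
    rw [harmonic_eq_sum_Icc] at this
    push_cast at this
    exact this
  have s3 : Real.log N ≤ (N:ℝ) ^ (ε/2) / (ε/2) := Real.log_le_rpow_div (by linarith) (by linarith)
  have s4 : (1:ℝ) ≤ (N:ℝ) ^ (ε/2) := Real.one_le_rpow hN1 (by linarith)
  have s5 : (N:ℝ) ^ ε ≤ 2 * V ^ ε := by
    calc (N:ℝ) ^ ε ≤ (2 * V) ^ ε := Real.rpow_le_rpow (by linarith) hN2 h0.le
      _ = 2 ^ ε * V ^ ε := Real.mul_rpow (by norm_num) (by linarith)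
      _ ≤ 2 ^ (1:ℝ) * V ^ ε := by gcongr; norm_num
      _ = _ := by simp
  calc _ ≤ _ := s1
    _ = (N:ℝ) ^ (ε/2) * ∑ n ∈ Icc 1 N, ((n:ℝ))⁻¹ := by rw [mul_sum]
    _ ≤ (N:ℝ) ^ (ε/2) * ((N:ℝ) ^ (ε/2) + (N:ℝ) ^ (ε/2) / (ε/2)) := by
        gcongr; linarith
    _ = (1 + 2/ε) * ((N:ℝ) ^ (ε/2) * (N:ℝ) ^ (ε/2)) := by field_simp
    _ = (1 + 2/ε) * (N:ℝ) ^ ε := by rw [← Real.rpow_add (by linarith)]; ring_nf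
    _ ≤ (1 + 2/ε) * (2 * V ^ ε) := by gcongr
    _ = _ := by ring

lemma tail_term_bound {ε : ℝ} (h0 : 0 < ε) (h1 : ε ≤ 1) {q V : ℝ} {s : ℂ} (hq : 1 ≤ q)
    (hV : V = q * (|s.im| + 2)) (hσ : 1 - ε / 2 ≤ s.re) :
    ‖s‖ * (2 * q * ((⌈V⌉₊:ℝ) ^ (-s.re) / s.re)) ≤ 4 * V ^ ε := by
  have ht := abs_nonneg s.im
  have hV2 : 2 ≤ V := by rw [hV]; nlinarith
  have hre : 1/2 ≤ s.re := by linarith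
  have hNV : V ≤ ⌈V⌉₊ := Nat.le_ceil V
  have a1 : ‖s‖ ≤ 2 * (|s.im| + 2) * s.re := by
    refine (norm_le_abs_re_add_abs_im s).trans ?_
    rw [abs_of_pos (by linarith : 0 < s.re)]
    nlinarith
  have a2 : (⌈V⌉₊:ℝ) ^ (-s.re) ≤ V ^ (-s.re) :=
    Real.rpow_le_rpow_of_nonpos (by linarith) hNV (by linarith)
  have a3 : V * V ^ (-s.re) ≤ V ^ ε := by
    have : V * V ^ (-s.re) = V ^ (1 + -s.re) := by
      rw [Real.rpow_add (by linarith), Real.rpow_one]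
    rw [this]
    exact Real.rpow_le_rpow_of_exponent_le (by linarith) (by linarith)
  calc _ ≤ (2 * (|s.im| + 2) * s.re) * (2 * q * (V ^ (-s.re) / s.re)) := by gcongr
    _ = 4 * (V * V ^ (-s.re)) := by rw [hV]; field_simp; ring
    _ ≤ _ := by gcongr

lemma LFunction_bound {ε : ℝ} (h0 : 0 < ε) (h1 : ε ≤ 1) {q : ℕ} [NeZero q]
    (χ : DirichletCharacter ℂ q) (hχ : χ ≠ 1) {s : ℂ} (hσ : 1 - ε / 2 ≤ s.re) :
    ‖χ.LFunction s‖ ≤ (6 + 4 / ε) * (q * (|s.im| + 2)) ^ ε := by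
  have hq : (1:ℝ) ≤ q := by exact_mod_cast NeZero.one_le
  have ht := abs_nonneg s.im
  have hV : 1 ≤ q * (|s.im| + 2) := by nlinarith
  refine (LFunction_crude χ hχ ⌈q * (|s.im| + 2)⌉₊ (Nat.one_le_ceil_iff.mpr (by linarith))
    (by linarith)).trans ?_
  linarith [sum_rpow_bound h0 h1 hV hσ, tail_term_bound h0 h1 hq rfl hσ]

end SW

namespace SW
open Complex Filter Asymptotics Topology

/-- the fractional part tail -/
noncomputable def fracTail (N : ℕ) (t : ℝ) : ℂ := if t ≤ N then 0 else ((⌊t⌋₊ : ℝ) - t : ℝ)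

lemma fracTail_measurable (N : ℕ) : Measurable (fracTail N) := by
  unfold fracTail
  apply Measurable.ite measurableSet_Iic measurable_const
  apply measurable_ofReal.comp
  exact (measurable_from_nat (f := fun n : ℕ => (n:ℝ))).comp Nat.measurable_floor |>.sub measurable_id

lemma fracTail_bound (N : ℕ) (t : ℝ) : ‖fracTail N t‖ ≤ 1 := by
  unfold fracTail
  split_ifs with h
  · simp
  · push Not at h
    have h0 : 0 ≤ t := (Nat.cast_nonneg N).trans h.le
    rw [norm_real, Real.norm_eq_abs, abs_le]
    constructor <;> linarith [Nat.floor_le h0, Nat.lt_floor_add_one t]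

lemma fracTail_zero (N : ℕ) (t : ℝ) (h : t ≤ N) : fracTail N t = 0 := by
  unfold fracTail; rw [if_pos h]

lemma zeta_trunc_gt_one (N : ℕ) (hN : 1 ≤ N) {s : ℂ} (hs : 1 < s.re) :
    riemannZeta s = ∑ n ∈ Icc 1 N, (n:ℂ) ^ (-s) + (N:ℂ) ^ (1 - s) / (s - 1)
      + s * mellin (fracTail N) (-s) := by
  have hN' : (1:ℝ) ≤ N := by exact_mod_cast hN
  have hN0 : (0:ℝ) < N := by linarith
  have hS : LSeriesSummable 1 s := LSeriesSummable_one_iff.mpr hs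
  obtain ⟨hS2, hE⟩ := LSeries_trunc 1 N hS
  rw [← LSeries_one_eq_riemannZeta hs, hE]
  simp only [Pi.one_apply, one_mul]
  rw [add_assoc]; congr 1
  set g : ℕ → ℂ := fun n => if n ≤ N then 0 else 1 with hg
  have hgs : ∀ n, ∑ k ∈ Icc 1 n, g k = ((n - N : ℕ) : ℂ) := by
    intro n
    have : ∑ k ∈ Icc 1 n, g k = ∑ k ∈ (Icc 1 n).filter (fun k => ¬ k ≤ N), (1:ℂ) := by
      rw [sum_filter]; apply sum_congr rfl; intro k _; simp only [hg]; split_ifs <;> simp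
    rw [this, sum_const, nsmul_eq_mul, mul_one]
    congr 1
    have : (Icc 1 n).filter (fun k => ¬ k ≤ N) = Ioc N n := by
      ext k; simp only [mem_filter, mem_Icc, mem_Ioc]; omega
    rw [this]; simp
  have hO : (fun n ↦ ∑ k ∈ Icc 1 n, g k) =O[atTop] fun n ↦ (n : ℝ) ^ (1:ℝ) := by
    refine IsBigO.of_bound 1 ?_
    filter_upwards with n
    rw [hgs]; simp
  rw [LSeries_eq_mul_integral g zero_le_one hs hS2 hO]
  have hs0 : s ≠ 0 := by rintro rfl; simp at hs; linarith
  have hs1 : s - 1 ≠ 0 := by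
    intro h; have := congrArg re h; simp at this; linarith
  have h1 : ∫ t in Set.Ioi (1:ℝ), (∑ k ∈ Icc 1 ⌊t⌋₊, g k) * (t:ℂ) ^ (-(s + 1))
      = ∫ t in Set.Ioi (N:ℝ), (∑ k ∈ Icc 1 ⌊t⌋₊, g k) * (t:ℂ) ^ (-(s + 1)) := by
    apply setIntegral_eq_of_subset_of_forall_sdiff_eq_zero measurableSet_Ioi
    · intro t ht; simp only [Set.mem_Ioi] at *; linarith
    · intro t ht
      simp only [Set.mem_sdiff, Set.mem_Ioi, not_lt] at ht
      rw [hgs, Nat.sub_eq_zero_of_le (Nat.floor_le_of_le ht.2)]; simp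
  have h2 : ∫ t in Set.Ioi (N:ℝ), (∑ k ∈ Icc 1 ⌊t⌋₊, g k) * (t:ℂ) ^ (-(s + 1))
      = ∫ t in Set.Ioi (N:ℝ), (((t:ℂ) ^ (-s) - N * (t:ℂ) ^ (-(s+1)))
         + fracTail N t * (t:ℂ) ^ (-(s + 1))) := by
    apply setIntegral_congr_fun measurableSet_Ioi
    intro t ht
    simp only [Set.mem_Ioi] at ht
    have ht0 : (0:ℝ) < t := hN0.trans ht
    have ht0' : (t:ℂ) ≠ 0 := by exact_mod_cast ht0.ne'
    simp only
    rw [hgs, fracTail, if_neg (by linarith), Nat.cast_sub (Nat.le_floor ht.le)]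
    have : (t:ℂ) ^ (-s) = t * (t:ℂ) ^ (-(s+1)) := by
      rw [show -s = 1 + -(s+1) by ring, cpow_add _ _ ht0', cpow_one]
    rw [this]; push_cast; ring
  have i1 : IntegrableOn (fun t : ℝ => (t:ℂ) ^ (-s)) (Set.Ioi (N:ℝ)) :=
    integrableOn_Ioi_cpow_of_lt (by simpa using hs) hN0
  have i2 : IntegrableOn (fun t : ℝ => (N:ℂ) * (t:ℂ) ^ (-(s+1))) (Set.Ioi (N:ℝ)) :=
    (integrableOn_Ioi_cpow_of_lt (by simp; linarith) hN0).const_mul _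
  have i3 : IntegrableOn (fun t : ℝ => fracTail N t * (t:ℂ) ^ (-(s+1))) (Set.Ioi (N:ℝ)) := by
    apply Integrable.bdd_mul (c := 1) (integrableOn_Ioi_cpow_of_lt (by simp; linarith) hN0)
    · exact (fracTail_measurable N).aestronglyMeasurable
    · filter_upwards with t using fracTail_bound N t
  have i12 : IntegrableOn (fun t : ℝ => (t:ℂ) ^ (-s) - (N:ℂ) * (t:ℂ) ^ (-(s+1)))
      (Set.Ioi (N:ℝ)) := i1.sub i2
  rw [h1, h2, integral_add i12 i3, integral_sub i1 i2, integral_const_mul,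
    integral_Ioi_cpow_of_lt (by simpa using hs) hN0,
    integral_Ioi_cpow_of_lt (by simp; linarith) hN0, tail_eq hN' (fracTail_zero N) s, mul_add]
  congr 1
  have hNc : (N:ℂ) ≠ 0 := by exact_mod_cast hN0.ne'
  have e1 : ((N:ℝ):ℂ) ^ (-s + 1) = N * (N:ℂ) ^ (-s) := by
    rw [add_comm, cpow_add _ _ (by exact_mod_cast hN0.ne')]; simp
  have e2 : (N:ℂ) ^ (1 - s) = N * (N:ℂ) ^ (-s) := by
    rw [sub_eq_add_neg, cpow_add _ _ hNc]; simp
  have e3 : ((N:ℝ):ℂ) ^ (-(s+1) + 1) = (N:ℂ) ^ (-s) := by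
    rw [show -(s+1)+1 = -s by ring]; simp
  rw [e1, e2, e3]
  have hs2 : -s + 1 ≠ 0 := by intro h; apply hs1; linear_combination -h
  have hs3 : -(s+1) + 1 ≠ 0 := by intro h; apply hs0; linear_combination -h
  rw [show -s + 1 = -(s-1) by ring, show -(s+1)+1 = -s by ring]
  field_simp
  ring

lemma zeta_trunc (N : ℕ) (hN : 1 ≤ N) {s : ℂ} (hs : 0 < s.re) (hs' : s.im ≠ 0) :
    riemannZeta s = ∑ n ∈ Icc 1 N, (n:ℂ) ^ (-s) + (N:ℂ) ^ (1 - s) / (s - 1)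
      + s * mellin (fracTail N) (-s) := by
  have hN' : (1:ℝ) ≤ N := by exact_mod_cast hN
  have key : ∀ U : Set ℂ, IsOpen U → IsPreconnected U → (∀ z ∈ U, 0 < z.re ∧ z ≠ 1) →
      (∃ z ∈ U, 1 < z.re) → s ∈ U → riemannZeta s = ∑ n ∈ Icc 1 N, (n:ℂ) ^ (-s)
        + (N:ℂ) ^ (1 - s) / (s - 1) + s * mellin (fracTail N) (-s) := by
    rintro U hU hc h1 ⟨z, hz, hz1⟩ hsU
    refine eq_of_eq_re_gt_one (U := U) hU hc (f := riemannZeta)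
      (g := fun s => ∑ n ∈ Icc 1 N, (n:ℂ) ^ (-s)
        + (N:ℂ) ^ (1 - s) / (s - 1) + s * mellin (fracTail N) (-s)) ?_ ?_ hz hz1 ?_ hsU
    · intro w hw; exact (differentiableAt_riemannZeta (h1 w hw).2).differentiableWithinAt
    · intro w hw
      apply DifferentiableAt.differentiableWithinAt
      apply DifferentiableAt.add
      · apply DifferentiableAt.add
        · apply DifferentiableAt.fun_sum
          intro n hn
          simp only [mem_Icc] at hn
          apply DifferentiableAt.const_cpow differentiableAt_id.neg
          left; exact_mod_cast (by omega : n ≠ 0)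
        · refine DifferentiableAt.fun_div ?_ ?_ (sub_ne_zero.mpr (h1 w hw).2)
          · apply DifferentiableAt.const_cpow (differentiableAt_id.const_sub 1)
            left; exact_mod_cast (by omega : N ≠ 0)
          · exact differentiableAt_id.sub_const 1
      · apply differentiableAt_id.mul
        exact tail_differentiableAt (fracTail_measurable N) (fracTail_bound N) hN'
          (fracTail_zero N) (h1 w hw).1
    · intro w hw; exact zeta_trunc_gt_one N hN hw
  rcases lt_or_gt_of_ne hs' with h | h
  · apply key ({z | 0 < z.re} ∩ {z | z.im < 0})
    · exact (isOpen_lt continuous_const continuous_re).inter (isOpen_lt continuous_im continuous_const)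
    · exact ((convex_halfSpace_re_gt 0).inter (convex_halfSpace_im_lt 0)).isPreconnected
    · rintro z ⟨h1, h2⟩; exact ⟨h1, by rintro rfl; simp at h2⟩
    · exact ⟨⟨2, -1⟩, ⟨by simp, by simp⟩, by simp⟩
    · exact ⟨hs, h⟩
  · apply key ({z | 0 < z.re} ∩ {z | 0 < z.im})
    · exact (isOpen_lt continuous_const continuous_re).inter (isOpen_lt continuous_const continuous_im)
    · exact ((convex_halfSpace_re_gt 0).inter (convex_halfSpace_im_gt 0)).isPreconnected
    · rintro z ⟨h1, h2⟩; exact ⟨h1, by rintro rfl; simp at h2⟩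
    · exact ⟨⟨2, 1⟩, ⟨by simp, by simp⟩, by simp⟩
    · exact ⟨hs, h⟩

lemma zeta_bound {ε : ℝ} (h0 : 0 < ε) (h1 : ε ≤ 1) {s : ℂ} (hσ : 1 - ε / 2 ≤ s.re)
    (ht1 : 1 ≤ |s.im|) :
    ‖riemannZeta s‖ ≤ (8 + 4 / ε) * (|s.im| + 2) ^ ε := by
  set V := |s.im| + 2 with hV
  have hV1 : 1 ≤ V := by linarith
  set N := ⌈V⌉₊ with hN
  have hN1 : 1 ≤ N := Nat.one_le_ceil_iff.mpr (by linarith)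
  have hN' : (1:ℝ) ≤ N := by exact_mod_cast hN1
  have him : s.im ≠ 0 := by intro h; rw [h] at ht1; simp at ht1; linarith
  have hre : 0 < s.re := by linarith
  have b1 := sum_rpow_bound h0 h1 hV1 hσ
  have b2 := tail_term_bound h0 h1 (q := 1) (V := V) le_rfl (by rw [one_mul]) hσ
  rw [← hN] at b1 b2
  have b3 : ‖(N:ℂ) ^ (1 - s) / (s - 1)‖ ≤ 2 * V ^ ε := by
    have c1 : 1 ≤ ‖s - 1‖ := by
      refine ht1.trans ?_
      have := abs_im_le_norm (s - 1)
      simpa using this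
    rw [norm_div, ← ofReal_natCast, norm_cpow_eq_rpow_re_of_pos (by linarith)]
    have hN2 : (N:ℝ) ≤ 2 * V := by
      have := (Nat.ceil_lt_add_one (by linarith : 0 ≤ V)).le
      linarith
    calc (N:ℝ) ^ (1 - s).re / ‖s - 1‖ ≤ (N:ℝ) ^ (1 - s).re := div_le_self (by positivity) c1
      _ ≤ (N:ℝ) ^ ε := Real.rpow_le_rpow_of_exponent_le hN' (by simp; linarith)
      _ ≤ (2 * V) ^ ε := Real.rpow_le_rpow (by linarith) hN2 h0.le
      _ = 2 ^ ε * V ^ ε := Real.mul_rpow (by norm_num) (by linarith)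
      _ ≤ 2 ^ (1:ℝ) * V ^ ε := by gcongr; norm_num
      _ = _ := by simp
  rw [zeta_trunc N hN1 hre him]
  have b4 : ‖∑ n ∈ Icc 1 N, (n:ℂ) ^ (-s)‖ ≤ ∑ n ∈ Icc 1 N, (n:ℝ) ^ (-s.re) := by
    apply norm_sum_le_of_le
    intro n hn
    simp only [mem_Icc] at hn
    rw [← ofReal_natCast, norm_cpow_eq_rpow_re_of_pos (by exact_mod_cast (by omega : 0 < n)), neg_re]
  have b5 : ‖s * mellin (fracTail N) (-s)‖ ≤ ‖s‖ * (2 * 1 * ((N:ℝ) ^ (-s.re) / s.re)) := by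
    rw [norm_mul]
    gcongr
    refine (tail_bound (fracTail_bound N) hN' (fracTail_zero N) hre).trans ?_
    have : 0 ≤ (N:ℝ) ^ (-s.re) / s.re := by positivity
    linarith
  calc _ ≤ _ := norm_add₃_le
    _ ≤ (2 + 4 / ε) * V ^ ε + 2 * V ^ ε + 4 * V ^ ε := by
        gcongr
        · exact b4.trans b1
        · exact b5.trans b2
    _ = _ := by ring

end SW

namespace SW
open Complex Filter Asymptotics Topology

lemma prod_one_sub_lower (T : Finset ℕ) (h : ∀ n ∈ T, 2 ≤ n) :
    1 / ((T.card : ℝ) + 1) ≤ ∏ n ∈ T, (1 - 1 / (n:ℝ)) := by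
  induction T using Finset.induction_on_max with
  | empty => simp
  | insert m T hm ih =>
    have hmT : m ∉ T := fun hh => lt_irrefl _ (hm m hh)
    rw [prod_insert hmT, card_insert_of_notMem hmT]
    have ih' := ih (fun n hn => h n (mem_insert_of_mem hn))
    have hc : T.card + 2 ≤ m := by
      have : T ⊆ Ico 2 m := fun n hn => by
        simp only [mem_Ico]; exact ⟨h n (mem_insert_of_mem hn), hm n hn⟩
      have h3 := card_le_card this
      have h2 := h m (mem_insert_self _ _)
      simp at h3; omega
    have hc' : (T.card:ℝ) + 2 ≤ m := by exact_mod_cast hc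
    have h1 : ((T.card:ℝ)+1) / (T.card + 2) ≤ 1 - 1 / (m:ℝ) := by
      have : 1 / (m:ℝ) ≤ 1 / (T.card + 2) := one_div_le_one_div_of_le (by positivity) hc'
      have h4 : ((T.card:ℝ)+1) / (T.card + 2) = 1 - 1 / (T.card + 2) := by field_simp; ring
      linarith
    calc 1 / (((T.card + 1 : ℕ):ℝ) + 1) = ((T.card:ℝ)+1) / (T.card + 2) * (1 / ((T.card : ℝ) + 1)) := by
          push_cast; field_simp; ring
      _ ≤ _ := mul_le_mul h1 ih' (by positivity) (le_trans (by positivity) h1)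

lemma prod_one_add_upper (T : Finset ℕ) (h : ∀ n ∈ T, 2 ≤ n) :
    ∏ n ∈ T, (1 + 1 / (n:ℝ)) ≤ (T.card : ℝ) + 1 := by
  have h1 := prod_one_sub_lower T h
  have h2 : (∏ n ∈ T, (1 + 1 / (n:ℝ))) * ∏ n ∈ T, (1 - 1 / (n:ℝ)) ≤ 1 := by
    rw [← prod_mul_distrib]
    apply prod_le_one
    · intro n hn
      have : (2:ℝ) ≤ n := by exact_mod_cast h n hn
      have : 1 / (n:ℝ) ≤ 1 / 2 := one_div_le_one_div_of_le (by positivity) this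
      have h5 : 0 ≤ 1 / (n:ℝ) := by positivity
      apply mul_nonneg <;> linarith
    · intro n hn
      nlinarith [sq_nonneg (1 / (n:ℝ))]
  have h3 : 0 ≤ ∏ n ∈ T, (1 + 1 / (n:ℝ)) := prod_nonneg (fun n _ => by positivity)
  have h4 : (∏ n ∈ T, (1 + 1 / (n:ℝ))) * (1 / ((T.card : ℝ) + 1)) ≤ 1 :=
    (mul_le_mul_of_nonneg_left h1 h3).trans h2
  rw [mul_one_div, div_le_one (by positivity)] at h4
  exact h4

lemma card_primeFactors_bound {ε : ℝ} (hε : 0 < ε) {q : ℕ} (hq : q ≠ 0) :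
    (q.primeFactors.card : ℝ) + 1 ≤ (2 / ε + 1) * (q:ℝ) ^ ε := by
  have hq1 : (1:ℝ) ≤ q := by exact_mod_cast Nat.one_le_iff_ne_zero.mpr hq
  have h1 : 2 ^ q.primeFactors.card ≤ q := by
    calc 2 ^ q.primeFactors.card = ∏ p ∈ q.primeFactors, 2 := by simp
      _ ≤ ∏ p ∈ q.primeFactors, p := prod_le_prod' (fun p hp => (Nat.prime_of_mem_primeFactors hp).two_le)
      _ ≤ q := Nat.le_of_dvd (Nat.pos_of_ne_zero hq) (Nat.prod_primeFactors_dvd q)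
  have h2 : (2:ℝ) ^ q.primeFactors.card ≤ q := by exact_mod_cast h1
  have h3 : q.primeFactors.card * Real.log 2 ≤ Real.log q := by
    rw [← Real.log_pow]; exact Real.log_le_log (by positivity) h2
  have h4 := Real.log_le_rpow_div (x := (q:ℝ)) (by positivity) hε
  have h5 : (1:ℝ) ≤ (q:ℝ) ^ ε := Real.one_le_rpow hq1 hε.le
  have h6 := Real.log_two_gt_d9
  have h7 : (q.primeFactors.card : ℝ) ≤ 2 * (q.primeFactors.card * Real.log 2) := by
    nlinarith [(Nat.cast_nonneg q.primeFactors.card : (0:ℝ) ≤ _)]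
  have h8 : (2 / ε + 1) * (q:ℝ) ^ ε = 2 * ((q:ℝ)^ε / ε) + (q:ℝ)^ε := by ring
  rw [h8]; linarith

/-- comparison of `L(1,χ)` with its lifted version -/
lemma changeLevel_compare {N M : ℕ} [NeZero N] [NeZero M] (h : N ∣ M) (χ : DirichletCharacter ℂ N)
    (hχ : χ ≠ 1) :
    ‖(DirichletCharacter.changeLevel h χ).LFunction 1‖ ≤ (M.primeFactors.card + 1) * ‖χ.LFunction 1‖
    ∧ ‖χ.LFunction 1‖ ≤ (M.primeFactors.card + 1) * ‖(DirichletCharacter.changeLevel h χ).LFunction 1‖ := by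
  rw [DirichletCharacter.LFunction_changeLevel h χ (Or.inl hχ), norm_mul, norm_prod]
  have hpr : ∀ p ∈ M.primeFactors, 2 ≤ p := fun p hp => (Nat.prime_of_mem_primeFactors hp).two_le
  have e1 : ∀ p ∈ M.primeFactors, ‖χ p * (p:ℂ) ^ (-(1:ℂ))‖ ≤ 1 / (p:ℝ) := by
    intro p hp
    rw [norm_mul, cpow_neg_one, norm_inv, norm_natCast, one_div]
    exact mul_le_of_le_one_left (by positivity) (χ.norm_le_one _)
  have hu : ∏ p ∈ M.primeFactors, ‖1 - χ p * (p:ℂ) ^ (-(1:ℂ))‖ ≤ M.primeFactors.card + 1 := by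
    refine le_trans (prod_le_prod (fun _ _ => norm_nonneg _) (fun p hp => ?_)) (prod_one_add_upper _ hpr)
    refine (norm_sub_le _ _).trans ?_
    rw [norm_one]; linarith [e1 p hp]
  have hl : 1 / ((M.primeFactors.card : ℝ) + 1) ≤ ∏ p ∈ M.primeFactors, ‖1 - χ p * (p:ℂ) ^ (-(1:ℂ))‖ := by
    refine le_trans (prod_one_sub_lower _ hpr) (prod_le_prod (fun p hp => ?_) (fun p hp => ?_))
    · have : (2:ℝ) ≤ p := by exact_mod_cast hpr p hp
      have : 1 / (p:ℝ) ≤ 1 / 2 := one_div_le_one_div_of_le (by positivity) this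
      linarith
    · have := norm_sub_norm_le (1:ℂ) (χ p * (p:ℂ) ^ (-(1:ℂ)))
      rw [norm_one] at this; linarith [e1 p hp]
  constructor
  · rw [mul_comm]; exact mul_le_mul_of_nonneg_right hu (norm_nonneg _)
  · rw [div_le_iff₀ (by positivity)] at hl
    nlinarith [norm_nonneg (χ.LFunction 1)]

/-- Uniform bound for `L` and `L'` near the line `σ = 1`. -/
lemma LFunction_deriv_bound {ε : ℝ} (h0 : 0 < ε) (h1 : ε ≤ 1) :
    ∃ C : ℝ, 1 ≤ C ∧ ∀ (q : ℕ) [NeZero q] (χ : DirichletCharacter ℂ q), χ ≠ 1 → ∀ s : ℂ,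
      1 - ε / 4 ≤ s.re → ‖χ.LFunction s‖ ≤ C * (q * (|s.im| + 2)) ^ ε ∧
        ‖deriv χ.LFunction s‖ ≤ C * (q * (|s.im| + 2)) ^ ε := by
  refine ⟨(6 + 4 / ε) * 2 * (4 / ε), ?_, ?_⟩
  · have : 1 ≤ 1 / ε := by rw [le_div_iff₀ h0]; linarith
    have h4 : 4 / ε = 4 * (1 / ε) := by ring
    rw [h4]; nlinarith
  · intro q _ χ hχ s hs
    have hq : (1:ℝ) ≤ q := by exact_mod_cast NeZero.one_le
    have hV : 0 < (q * (|s.im| + 2) : ℝ) := by positivity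
    have h4 : 1 ≤ 4 / ε := by rw [le_div_iff₀ h0]; linarith
    have hb : ∀ z : ℂ, ‖z - s‖ ≤ ε / 4 → ‖χ.LFunction z‖ ≤ (6 + 4 / ε) * 2 * (q * (|s.im| + 2)) ^ ε := by
      intro z hz
      have hre := (abs_re_le_norm (z - s)).trans hz
      have him := (abs_im_le_norm (z - s)).trans hz
      simp only [sub_re, sub_im] at hre him
      have := LFunction_bound h0 h1 χ hχ (s := z) (by linarith [(abs_le.mp hre).1])
      refine this.trans ?_
      rw [mul_assoc]
      apply mul_le_mul_of_nonneg_left _ (by positivity)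
      have him2 : |z.im| ≤ |s.im| + ε / 4 := by
        have := abs_sub_abs_le_abs_sub z.im s.im; linarith
      calc (q * (|z.im| + 2) : ℝ) ^ ε ≤ (2 * (q * (|s.im| + 2))) ^ ε := by
            apply Real.rpow_le_rpow (by positivity) _ h0.le
            nlinarith [abs_nonneg s.im]
        _ = 2 ^ ε * (q * (|s.im| + 2)) ^ ε := Real.mul_rpow (by norm_num) hV.le
        _ ≤ 2 * (q * (|s.im| + 2)) ^ ε := by
            gcongr
            calc (2:ℝ) ^ ε ≤ 2 ^ (1:ℝ) := Real.rpow_le_rpow_of_exponent_le (by norm_num) h1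
              _ = 2 := by simp
    constructor
    · refine (hb s (by simp; positivity)).trans ?_
      apply mul_le_mul_of_nonneg_right _ (by positivity)
      exact le_mul_of_one_le_right (by positivity) h4
    · have := norm_deriv_le_of_forall_mem_sphere_norm_le (c := s) (R := ε / 4) (by positivity)
        (χ.differentiable_LFunction hχ).diffContOnCl
        (C := (6 + 4 / ε) * 2 * (q * (|s.im| + 2)) ^ ε)
        (fun z hz => hb z (by rw [mem_sphere_iff_norm] at hz; exact hz.le))
      refine this.trans (le_of_eq ?_)
      field_simp

end SW

namespace SW
open Complex Filter Asymptotics Topology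

/-- The entire function `(s-1) ζ(s)`. -/
noncomputable def Zf : ℂ → ℂ := DirichletCharacter.LFunctionTrivChar₁ 1

lemma Zf_differentiable : Differentiable ℂ Zf :=
  DirichletCharacter.differentiable_LFunctionTrivChar₁ 1

lemma Zf_one : Zf 1 = 1 := by
  simp [Zf, DirichletCharacter.LFunctionTrivChar₁]

lemma Zf_of_ne {s : ℂ} (hs : s ≠ 1) : Zf s = (s - 1) * riemannZeta s := by
  simp [Zf, DirichletCharacter.LFunctionTrivChar₁, Function.update_of_ne hs,
    DirichletCharacter.LFunctionTrivChar, DirichletCharacter.LFunction_modOne_eq]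

lemma Zf_ne_zero {s : ℂ} (hs : 1 ≤ s.re) : Zf s ≠ 0 := by
  by_cases h : s = 1
  · rw [h, Zf_one]; exact one_ne_zero
  · rw [Zf_of_ne h]
    exact mul_ne_zero (sub_ne_zero.mpr h) (riemannZeta_ne_zero_of_one_le_re hs)

/-- A continuous function is bounded on a compact rectangle. -/
lemma exists_bound_rect {g : ℂ → ℂ} (a b c d : ℝ)
    (hg : ContinuousOn g {s : ℂ | s.re ∈ Set.Icc a b ∧ s.im ∈ Set.Icc c d}) :
    ∃ C : ℝ, 1 ≤ C ∧ ∀ s : ℂ, s.re ∈ Set.Icc a b → s.im ∈ Set.Icc c d → ‖g s‖ ≤ C := by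
  have hc : IsCompact {s : ℂ | s.re ∈ Set.Icc a b ∧ s.im ∈ Set.Icc c d} :=
    (isCompact_Icc.reProdIm isCompact_Icc : IsCompact (Set.Icc a b ×ℂ Set.Icc c d))
  obtain ⟨C, hC⟩ := hc.exists_bound_of_continuousOn hg
  exact ⟨max C 1, le_max_right _ _, fun s h1 h2 => (hC s ⟨h1, h2⟩).trans (le_max_left _ _)⟩

lemma zeta_bound' {ε : ℝ} (h0 : 0 < ε) (h1 : ε ≤ 1) :
    ∃ C : ℝ, 1 ≤ C ∧ ∀ s : ℂ, 1 ≤ s.re → s.re ≤ 2 → s ≠ 1 →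
      ‖riemannZeta s‖ ≤ C * ((|s.im| + 2) ^ ε + 1 / ‖s - 1‖) := by
  obtain ⟨C, hC, hb⟩ := exists_bound_rect (g := Zf) 1 2 (-1) 1 Zf_differentiable.continuous.continuousOn
  refine ⟨C + (8 + 4 / ε), by have : 0 < 4 / ε := by positivity
                              linarith, ?_⟩
  intro s hs hs2 hne
  have hn : 0 < ‖s - 1‖ := norm_pos_iff.mpr (sub_ne_zero.mpr hne)
  have hp : 0 < (|s.im| + 2) ^ ε := by positivity
  have he : 0 < 4 / ε := by positivity
  have hn' : 0 < 1 / ‖s - 1‖ := by positivity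
  rcases le_total |s.im| 1 with h | h
  · have := hb s ⟨hs, hs2⟩ (by simpa using abs_le.mp h)
    rw [Zf_of_ne hne, norm_mul] at this
    have h3 : ‖riemannZeta s‖ ≤ C * (1 / ‖s - 1‖) := by
      rw [mul_one_div, le_div_iff₀ hn]; linarith
    nlinarith [mul_pos he hp, mul_pos he hn']
  · have := zeta_bound h0 h1 (s := s) (by linarith) h
    nlinarith [mul_pos he hp, mul_pos he hn']

lemma zeta_deriv_bound {ε : ℝ} (h0 : 0 < ε) (h1 : ε ≤ 1) :
    ∃ C : ℝ, 1 ≤ C ∧ ∀ s : ℂ, 1 - ε / 4 ≤ s.re → 3 / 2 ≤ |s.im| →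
      ‖riemannZeta s‖ ≤ C * (|s.im| + 2) ^ ε ∧
        ‖deriv riemannZeta s‖ ≤ C * (|s.im| + 2) ^ ε := by
  refine ⟨(8 + 4 / ε) * 2 * (4 / ε), ?_, ?_⟩
  · have : 1 ≤ 1 / ε := by rw [le_div_iff₀ h0]; linarith
    have h4 : 4 / ε = 4 * (1 / ε) := by ring
    rw [h4]; nlinarith
  · intro s hs hs3
    have hV : 0 < (|s.im| + 2 : ℝ) := by positivity
    have h4 : 1 ≤ 4 / ε := by rw [le_div_iff₀ h0]; linarith
    have him' : ∀ z : ℂ, ‖z - s‖ ≤ ε / 4 → 1 ≤ |z.im| := by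
      intro z hz
      have him := (abs_im_le_norm (z - s)).trans hz
      have := abs_sub_abs_le_abs_sub s.im z.im
      rw [abs_sub_comm] at this
      simp only [sub_im] at him
      linarith
    have hb : ∀ z : ℂ, ‖z - s‖ ≤ ε / 4 → ‖riemannZeta z‖ ≤ (8 + 4 / ε) * 2 * (|s.im| + 2) ^ ε := by
      intro z hz
      have hre := (abs_re_le_norm (z - s)).trans hz
      have him := (abs_im_le_norm (z - s)).trans hz
      simp only [sub_re, sub_im] at hre him
      have := zeta_bound h0 h1 (s := z) (by linarith [(abs_le.mp hre).1]) (him' z hz)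
      refine this.trans ?_
      rw [mul_assoc]
      apply mul_le_mul_of_nonneg_left _ (by positivity)
      have him2 : |z.im| ≤ |s.im| + ε / 4 := by
        have := abs_sub_abs_le_abs_sub z.im s.im; linarith
      calc (|z.im| + 2 : ℝ) ^ ε ≤ (2 * (|s.im| + 2)) ^ ε := by
            apply Real.rpow_le_rpow (by positivity) _ h0.le
            nlinarith [abs_nonneg s.im]
        _ = 2 ^ ε * (|s.im| + 2) ^ ε := Real.mul_rpow (by norm_num) hV.le
        _ ≤ 2 * (|s.im| + 2) ^ ε := by
            gcongr
            calc (2:ℝ) ^ ε ≤ 2 ^ (1:ℝ) := Real.rpow_le_rpow_of_exponent_le (by norm_num) h1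
              _ = 2 := by simp
    constructor
    · refine (hb s (by simp; positivity)).trans ?_
      apply mul_le_mul_of_nonneg_right _ (by positivity)
      exact le_mul_of_one_le_right (by positivity) h4
    · have hd : DiffContOnCl ℂ riemannZeta (Metric.ball s (ε/4)) := by
        apply DifferentiableOn.diffContOnCl
        intro z hz
        have hz' : ‖z - s‖ ≤ ε / 4 := by
          have := Metric.closure_ball_subset_closedBall hz
          simpa [dist_eq_norm] using this
        apply (differentiableAt_riemannZeta _).differentiableWithinAt
        rintro rfl
        have := him' 1 hz'; norm_num at this
      have := norm_deriv_le_of_forall_mem_sphere_norm_le (c := s) (R := ε / 4) (by positivity) hd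
        (C := (8 + 4 / ε) * 2 * (|s.im| + 2) ^ ε)
        (fun z hz => hb z (by rw [mem_sphere_iff_norm] at hz; exact hz.le))
      refine this.trans (le_of_eq ?_)
      field_simp

/-- Extracting a lower bound from a `3-4-1` inequality and a derivative bound. -/
lemma lower_of_341 {h h' : ℝ → ℂ} {D K η₁ : ℝ} (hD : 1 ≤ D) (hK : 1 ≤ K)
    (hd : ∀ x ∈ Set.Icc (1:ℝ) 2, HasDerivAt h (h' x) x) (hb : ∀ x ∈ Set.Icc (1:ℝ) 2, ‖h' x‖ ≤ D)
    (h1 : 0 ≤ η₁)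
    (h3 : ∀ η, 0 < η → η₁ ≤ η → η ≤ 1 → η ^ 3 ≤ K * ‖h (1 + η)‖ ^ 4) :
    ∀ η, η₁ ≤ η → η ≤ 1 → 1 / (16 * D ^ 3 * K) ≤ ‖h (1 + η)‖ := by
  set η₀ : ℝ := 1 / (16 * D ^ 4 * K) with hη₀
  have hD0 : 0 < D := by linarith
  have hK0 : 0 < K := by linarith
  have hη₀p : 0 < η₀ := by positivity
  have hη₀1 : η₀ ≤ 1 := by
    rw [hη₀, div_le_one (by positivity)]
    have : 1 ≤ D ^ 4 := one_le_pow₀ hD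
    nlinarith
  have hη : 16 * D ^ 4 * K * η₀ = 1 := by rw [hη₀]; field_simp
  have key : ∀ η, η₀ ≤ η → η₁ ≤ η → η ≤ 1 → 2 * D * η₀ ≤ ‖h (1 + η)‖ := by
    intro η h5 h6 h7
    have := h3 η (by linarith) h6 h7
    have h8 : η₀ ^ 3 ≤ η ^ 3 := pow_le_pow_left₀ hη₀p.le h5 3
    have h9 : K * (2 * D * η₀) ^ 4 = η₀ ^ 3 := by
      calc K * (2 * D * η₀) ^ 4 = (16 * D ^ 4 * K * η₀) * η₀ ^ 3 := by ring
        _ = _ := by rw [hη, one_mul]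
    have h10 : (2 * D * η₀) ^ 4 ≤ ‖h (1 + η)‖ ^ 4 := by
      have : K * (2 * D * η₀) ^ 4 ≤ K * ‖h (1 + η)‖ ^ 4 := by linarith
      exact le_of_mul_le_mul_left this hK0
    exact le_of_pow_le_pow_left₀ (by norm_num) (norm_nonneg _) h10
  have hc : 1 / (16 * D ^ 3 * K) = D * η₀ := by rw [hη₀]; field_simp
  rw [hc]
  intro η h5 h6
  have hp : 0 < D * η₀ := by positivity
  rcases le_total η₀ η with h7 | h7
  · have := key η h7 h5 h6
    linarith
  · have h8 := key η₀ le_rfl (h5.trans h7) hη₀1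
    have h9 : ‖h (1 + η₀) - h (1 + η)‖ ≤ D * ‖(1 + η₀) - (1 + η)‖ := by
      apply (convex_Icc (1:ℝ) 2).norm_image_sub_le_of_norm_hasDerivWithin_le
        (f' := h') (fun x hx => (hd x hx).hasDerivWithinAt) hb
      · constructor <;> linarith
      · constructor <;> linarith
    have h10 : ‖(1 + η₀) - (1 + η)‖ ≤ η₀ := by
      rw [Real.norm_eq_abs, abs_of_nonneg (by linarith)]; linarith
    have h11 := norm_sub_norm_le (h (1 + η₀)) (h (1 + η))
    have h12 : D * ‖(1 + η₀) - (1 + η)‖ ≤ D * η₀ := mul_le_mul_of_nonneg_left h10 hD0.le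
    linarith

end SW

namespace SW
open Complex Filter Asymptotics Topology

lemma quad_apply {q : ℕ} {χ : DirichletCharacter ℂ q} (h : χ ^ 2 = 1) (a : ZMod q) :
    χ a = 0 ∨ χ a = 1 ∨ χ a = -1 :=
  (MulChar.isQuadratic_iff_sq_eq_one.mpr h) a

lemma quad_conj {q : ℕ} {χ : DirichletCharacter ℂ q} (h : χ ^ 2 = 1) (a : ZMod q) :
    (starRingEnd ℂ) (χ a) = χ a := by
  rcases quad_apply h a with h | h | h <;> simp [h]

lemma quad_LFunction_conj {q : ℕ} [NeZero q] {χ : DirichletCharacter ℂ q} (h : χ ^ 2 = 1)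
    (hχ : χ ≠ 1) (s : ℂ) :
    (starRingEnd ℂ) (χ.LFunction ((starRingEnd ℂ) s)) = χ.LFunction s := by
  have hd := χ.differentiable_LFunction hχ
  refine eq_of_eq_re_gt_one (U := Set.univ) isOpen_univ isPreconnected_univ
    (f := fun s => (starRingEnd ℂ) (χ.LFunction ((starRingEnd ℂ) s))) (g := χ.LFunction)
    ?_ hd.differentiableOn (z := 2) (Set.mem_univ _) (by norm_num) ?_ (Set.mem_univ _)
  · intro z _
    apply DifferentiableAt.differentiableWithinAt
    have := (hd ((starRingEnd ℂ) z)).conj_conj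
    rw [Complex.conj_conj] at this
    exact this
  · intro z hz
    rw [χ.LFunction_eq_LSeries hz, χ.LFunction_eq_LSeries (by simpa using hz), LSeries, LSeries,
      conj_tsum]
    congr 1; ext n
    rw [LSeries.term_def, LSeries.term_def]
    split_ifs with hn
    · simp
    · rw [map_div₀, quad_conj h]
      congr 1
      rw [cpow_conj _ _ (by rw [natCast_arg]; exact Real.pi_pos.ne), Complex.conj_conj, conj_natCast]

lemma quad_LFunction_im {q : ℕ} [NeZero q] {χ : DirichletCharacter ℂ q} (h : χ ^ 2 = 1)
    (hχ : χ ≠ 1) (x : ℝ) : (χ.LFunction x).im = 0 := by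
  have := quad_LFunction_conj h hχ x
  rw [conj_ofReal] at this
  exact conj_eq_iff_im.mp this

lemma norm_LFunction_two_sub_one {q : ℕ} [NeZero q] (χ : DirichletCharacter ℂ q) :
    ‖χ.LFunction 2 - 1‖ ≤ 13 / 20 := by
  have h2 : (1:ℝ) < (2:ℂ).re := by norm_num
  have hs := χ.LSeriesSummable_of_one_lt_re h2
  rw [χ.LFunction_eq_LSeries h2, LSeries]
  have h1 := hs.hasSum
  have e1 : LSeries.term (fun n => χ n) 2 1 = 1 := by simp [LSeries.term_def]
  have h3 := hasSum_ite_sub_hasSum h1 1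
  rw [e1] at h3
  have hz : HasSum (fun n : ℕ => 1 / (n:ℝ) ^ 2) (Real.pi ^ 2 / 6) := hasSum_zeta_two
  have h4 := hasSum_ite_sub_hasSum hz 1
  have h5 := h3.norm_le_of_bounded h4 ?_
  · refine h5.trans ?_
    norm_num
    have := Real.pi_lt_d4
    have := Real.pi_pos
    nlinarith
  · intro n
    split_ifs with hn
    · simp
    · rw [LSeries.term_def]
      split_ifs with h0
      · simp [h0]
      · rw [norm_div]
        have : ‖(n:ℂ) ^ (2:ℂ)‖ = (n:ℝ) ^ 2 := by
          rw [show (2:ℂ) = ((2:ℕ):ℂ) by norm_num, cpow_natCast, norm_pow, Complex.norm_natCast]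
        rw [this]
        gcongr
        exact χ.norm_le_one _

lemma LFunction_two_re {q : ℕ} [NeZero q] (χ : DirichletCharacter ℂ q) :
    7 / 20 ≤ (χ.LFunction 2).re := by
  have := (abs_re_le_norm _).trans (norm_LFunction_two_sub_one χ)
  simp only [sub_re, one_re] at this
  linarith [(abs_le.mp this).1]

/-- positivity to the right of the last zero -/
lemma quad_LFunction_pos {q : ℕ} [NeZero q] {χ : DirichletCharacter ℂ q} (h : χ ^ 2 = 1)
    (hχ : χ ≠ 1) {β : ℝ} (hβ : β < 1) (hz : ∀ x : ℝ, β ≤ x → x < 1 → χ.LFunction x ≠ 0) :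
    0 < (χ.LFunction β).re := by
  by_contra hneg
  push Not at hneg
  have hc : ContinuousOn (fun x : ℝ => (χ.LFunction x).re) (Set.Icc β 2) := by
    apply Continuous.continuousOn
    exact continuous_re.comp ((χ.differentiable_LFunction hχ).continuous.comp continuous_ofReal)
  have h2 := LFunction_two_re χ
  obtain ⟨x, hx, hx0⟩ := intermediate_value_Icc (by linarith : β ≤ 2) hc
    (show (0:ℝ) ∈ Set.Icc _ _ from ⟨hneg, by simp only [ofReal_ofNat]; linarith⟩)
  have hx1 : χ.LFunction x = 0 := Complex.ext hx0 (quad_LFunction_im h hχ x)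
  rcases lt_or_ge x 1 with h1 | h1
  · exact hz x hx.1 h1 hx1
  · exact DirichletCharacter.LFunction_ne_zero_of_one_le_re χ (Or.inl hχ) (by simpa using h1) hx1

end SW

namespace SW
open Complex Filter Asymptotics Topology

lemma twist_eq {q : ℕ} [NeZero q] (χ : DirichletCharacter ℂ q) {s : ℂ} (hs : 1 < s.re) :
    LSeries ((fun n : ℕ => χ n) * fun n => (ArithmeticFunction.vonMangoldt n : ℂ)) s =
      -(deriv χ.LFunction s / χ.LFunction s) := by
  rw [χ.LSeries_twist_vonMangoldt_eq hs, ← χ.LFunction_eq_LSeries hs,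
    ← DirichletCharacter.deriv_LFunction_eq_deriv_LSeries χ hs, neg_div]

/-- `ζ(s) L(s,ψ₁) L(s,ψ₂) L(s,ψ₁ψ₂)` -/
noncomputable def Gs {q : ℕ} [NeZero q] (ψ₁ ψ₂ : DirichletCharacter ℂ q) (s : ℂ) : ℂ :=
  riemannZeta s * (ψ₁.LFunction s * (ψ₂.LFunction s * (ψ₁ * ψ₂).LFunction s))

/-- coefficients of `-G'/G` -/
noncomputable def Ga {q : ℕ} (ψ₁ ψ₂ : DirichletCharacter ℂ q) : ℕ → ℂ :=
  (fun n => (ArithmeticFunction.vonMangoldt n : ℂ)) +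
  (((fun n : ℕ => ψ₁ n) * fun n => (ArithmeticFunction.vonMangoldt n : ℂ)) +
  (((fun n : ℕ => ψ₂ n) * fun n => (ArithmeticFunction.vonMangoldt n : ℂ)) +
  ((fun n : ℕ => (ψ₁ * ψ₂) n) * fun n => (ArithmeticFunction.vonMangoldt n : ℂ))))

lemma Ga_summable {q : ℕ} (ψ₁ ψ₂ : DirichletCharacter ℂ q) {s : ℂ}
    (hs : 1 < s.re) : LSeriesSummable (Ga ψ₁ ψ₂) s :=
  (ArithmeticFunction.LSeriesSummable_vonMangoldt hs).add
    ((ψ₁.LSeriesSummable_twist_vonMangoldt hs).add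
      ((ψ₂.LSeriesSummable_twist_vonMangoldt hs).add
        ((ψ₁ * ψ₂).LSeriesSummable_twist_vonMangoldt hs)))

open scoped ComplexOrder in
lemma Ga_nonneg {q : ℕ} {ψ₁ ψ₂ : DirichletCharacter ℂ q} (h1 : ψ₁ ^ 2 = 1) (h2 : ψ₂ ^ 2 = 1) :
    0 ≤ Ga ψ₁ ψ₂ := by
  intro n
  have hL : 0 ≤ (ArithmeticFunction.vonMangoldt n : ℂ) := by
    exact_mod_cast ArithmeticFunction.vonMangoldt_nonneg
  have : Ga ψ₁ ψ₂ n = (1 + ψ₁ n) * (1 + ψ₂ n) * (ArithmeticFunction.vonMangoldt n : ℂ) := by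
    simp only [Ga, Pi.add_apply, Pi.mul_apply, MulChar.mul_apply]; ring
  rw [this]
  apply mul_nonneg _ hL
  rcases quad_apply h1 n with h | h | h <;> rcases quad_apply h2 n with h' | h' | h' <;>
    rw [h, h'] <;> norm_num

lemma Ga_abscissa {q : ℕ} (ψ₁ ψ₂ : DirichletCharacter ℂ q) :
    LSeries.abscissaOfAbsConv (Ga ψ₁ ψ₂) ≤ ((1:ℝ):EReal) :=
  LSeries.abscissaOfAbsConv_le_of_forall_lt_LSeriesSummable
    (fun y hy => Ga_summable ψ₁ ψ₂ (by simpa using hy))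

section
variable {q : ℕ} [NeZero q] {ψ₁ ψ₂ : DirichletCharacter ℂ q}

lemma diffAt_L (χ : DirichletCharacter ℂ q) {s : ℂ} (hs : 1 < s.re) :
    DifferentiableAt ℂ χ.LFunction s :=
  χ.differentiableAt_LFunction s (Or.inl (by rintro rfl; simp at hs))

lemma diffAt_zeta {s : ℂ} (hs : 1 < s.re) : DifferentiableAt ℂ riemannZeta s :=
  differentiableAt_riemannZeta (by rintro rfl; simp at hs)

lemma Gs_diffAt (ψ₁ ψ₂ : DirichletCharacter ℂ q) {s : ℂ} (hs : 1 < s.re) :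
    DifferentiableAt ℂ (Gs ψ₁ ψ₂) s :=
  (diffAt_zeta hs).mul ((diffAt_L ψ₁ hs).mul ((diffAt_L ψ₂ hs).mul (diffAt_L (ψ₁ * ψ₂) hs)))

lemma Gs_deriv (ψ₁ ψ₂ : DirichletCharacter ℂ q) {s : ℂ} (hs : 1 < s.re) :
    deriv (Gs ψ₁ ψ₂) s = -(LSeries (Ga ψ₁ ψ₂) s * Gs ψ₁ ψ₂ s) := by
  have hz := ArithmeticFunction.LSeriesSummable_vonMangoldt hs
  have s1 := ψ₁.LSeriesSummable_twist_vonMangoldt hs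
  have s2 := ψ₂.LSeriesSummable_twist_vonMangoldt hs
  have s3 := (ψ₁ * ψ₂).LSeriesSummable_twist_vonMangoldt hs
  rw [Ga, LSeries_add hz (s1.add (s2.add s3)), LSeries_add s1 (s2.add s3), LSeries_add s2 s3,
    twist_eq ψ₁ hs, twist_eq ψ₂ hs, twist_eq (ψ₁ * ψ₂) hs,
    ArithmeticFunction.LSeries_vonMangoldt_eq_deriv_riemannZeta_div hs]
  have hn : s ≠ 1 := by rintro rfl; simp at hs
  have n0 := riemannZeta_ne_zero_of_one_le_re hs.le
  have n1 := DirichletCharacter.LFunction_ne_zero_of_one_le_re ψ₁ (.inr hn) hs.le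
  have n2 := DirichletCharacter.LFunction_ne_zero_of_one_le_re ψ₂ (.inr hn) hs.le
  have n3 := DirichletCharacter.LFunction_ne_zero_of_one_le_re (ψ₁ * ψ₂) (.inr hn) hs.le
  have d := ((diffAt_zeta hs).hasDerivAt.mul ((diffAt_L ψ₁ hs).hasDerivAt.mul
    ((diffAt_L ψ₂ hs).hasDerivAt.mul (diffAt_L (ψ₁ * ψ₂) hs).hasDerivAt))).deriv
  have e1 : deriv (Gs ψ₁ ψ₂) s = _ := d
  rw [e1, Gs]
  simp only [Pi.mul_apply]
  field_simp
  ring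

open scoped ComplexOrder in
lemma Gs_alternating (h1 : ψ₁ ^ 2 = 1) (h2 : ψ₂ ^ 2 = 1) (h0 : 0 ≤ Gs ψ₁ ψ₂ 2) (m : ℕ) :
    0 ≤ (-1) ^ m * iteratedDeriv m (Gs ψ₁ ψ₂) 2 := by
  have ho : {s : ℂ | 1 < s.re} ∈ 𝓝 (2:ℂ) :=
    (isOpen_lt continuous_const continuous_re).mem_nhds (by simp)
  have hGan : AnalyticAt ℂ (Gs ψ₁ ψ₂) 2 := by
    apply DifferentiableOn.analyticAt (s := {s : ℂ | 1 < s.re}) _ ho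
    exact fun z hz => (Gs_diffAt ψ₁ ψ₂ hz).differentiableWithinAt
  have habs : LSeries.abscissaOfAbsConv (Ga ψ₁ ψ₂) < ((2:ℝ):EReal) :=
    (Ga_abscissa ψ₁ ψ₂).trans_lt (by exact_mod_cast (by norm_num : (1:ℝ) < 2))
  have hLan : AnalyticAt ℂ (LSeries (Ga ψ₁ ψ₂)) 2 := by
    apply LSeries_analyticOnNhd
    simpa using habs
  induction m using Nat.strong_induction_on with
  | _ m ih =>
    rcases m with _ | m
    · simpa using h0
    · rw [iteratedDeriv_succ']
      have hee : deriv (Gs ψ₁ ψ₂) =ᶠ[𝓝 2] -(LSeries (Ga ψ₁ ψ₂) * Gs ψ₁ ψ₂) := by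
        filter_upwards [ho] with s hs using Gs_deriv ψ₁ ψ₂ hs
      rw [hee.iteratedDeriv_eq, iteratedDeriv_neg, iteratedDeriv_mul hLan.contDiffAt hGan.contDiffAt,
        pow_succ]
      have : (-1:ℂ) ^ m * -1 * -∑ i ∈ Finset.range (m + 1), (m.choose i : ℂ) *
          iteratedDeriv i (LSeries (Ga ψ₁ ψ₂)) 2 * iteratedDeriv (m - i) (Gs ψ₁ ψ₂) 2
          = ∑ i ∈ Finset.range (m + 1), (m.choose i : ℂ) *
          (((-1) ^ i * iteratedDeriv i (LSeries (Ga ψ₁ ψ₂)) 2) *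
          ((-1) ^ (m - i) * iteratedDeriv (m - i) (Gs ψ₁ ψ₂) 2)) := by
        rw [mul_neg, mul_assoc, neg_one_mul, mul_neg, neg_neg, mul_sum]
        apply sum_congr rfl
        intro i hi
        have him : i ≤ m := by simp at hi; omega
        have : (-1:ℂ) ^ m = (-1) ^ i * (-1) ^ (m - i) := by
          rw [← pow_add, Nat.add_sub_of_le him]
        rw [this]; ring
      rw [this]
      apply sum_nonneg
      intro i hi
      have hA := LSeries.iteratedDeriv_alternating (Ga_nonneg h1 h2) (x := 2) habs i
      have hB := ih (m - i) (by omega)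
      exact mul_nonneg (by exact_mod_cast Nat.zero_le _) (mul_nonneg (by simpa using hA) hB)

lemma quad_mul (h1 : ψ₁ ^ 2 = 1) (h2 : ψ₂ ^ 2 = 1) : (ψ₁ * ψ₂) ^ 2 = 1 := by
  rw [mul_pow, h1, h2, one_mul]

lemma ofReal_re_of_im {z : ℂ} (h : z.im = 0) : z = (z.re : ℂ) :=
  Complex.ext (by simp) (by simpa using h)

lemma Gs_two (h1 : ψ₁ ^ 2 = 1) (h2 : ψ₂ ^ 2 = 1) (hn1 : ψ₁ ≠ 1) (hn2 : ψ₂ ≠ 1)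
    (hn3 : ψ₁ * ψ₂ ≠ 1) : ∃ x : ℝ, 1 / 50 ≤ x ∧ Gs ψ₁ ψ₂ 2 = x := by
  have e1 := ofReal_re_of_im (quad_LFunction_im h1 hn1 2)
  have e2 := ofReal_re_of_im (quad_LFunction_im h2 hn2 2)
  have e3 := ofReal_re_of_im (quad_LFunction_im (quad_mul h1 h2) hn3 2)
  have r1 := LFunction_two_re ψ₁
  have r2 := LFunction_two_re ψ₂
  have r3 := LFunction_two_re (ψ₁ * ψ₂)
  simp only [ofReal_ofNat] at e1 e2 e3
  refine ⟨Real.pi ^ 2 / 6 * ((ψ₁.LFunction 2).re * ((ψ₂.LFunction 2).re *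
    ((ψ₁ * ψ₂).LFunction 2).re)), ?_, ?_⟩
  · have hpi : 1 ≤ Real.pi ^ 2 / 6 := by nlinarith [Real.pi_gt_three]
    generalize (ψ₁.LFunction 2).re = a at *
    generalize (ψ₂.LFunction 2).re = b at *
    generalize ((ψ₁ * ψ₂).LFunction 2).re = c at *
    have hbc : (7/20:ℝ) * (7/20) ≤ b * c := mul_le_mul r2 r3 (by norm_num) (by linarith)
    have habc : (7/20:ℝ) * (7/20 * (7/20)) ≤ a * (b * c) :=
      mul_le_mul r1 hbc (by norm_num) (by linarith)
    nlinarith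
  · rw [Gs, riemannZeta_two, e1, e2, e3]; push_cast
    simp only [ofReal_re]

end

end SW

namespace SW
open Complex Filter Asymptotics Topology

section
variable {q : ℕ} [NeZero q] {ψ₁ ψ₂ : DirichletCharacter ℂ q}

/-- `L(1,ψ₁) L(1,ψ₂) L(1,ψ₁ψ₂)` as a function of `s` -/
noncomputable def Hs (ψ₁ ψ₂ : DirichletCharacter ℂ q) (s : ℂ) : ℂ :=
  ψ₁.LFunction s * (ψ₂.LFunction s * (ψ₁ * ψ₂).LFunction s)

noncomputable def G1 (ψ₁ ψ₂ : DirichletCharacter ℂ q) : ℂ → ℂ :=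
  dslope (fun s => Zf s * Hs ψ₁ ψ₂ s) 1

lemma Hs_diff (hn1 : ψ₁ ≠ 1) (hn2 : ψ₂ ≠ 1) (hn3 : ψ₁ * ψ₂ ≠ 1) : Differentiable ℂ (Hs ψ₁ ψ₂) :=
  (ψ₁.differentiable_LFunction hn1).mul ((ψ₂.differentiable_LFunction hn2).mul
    ((ψ₁ * ψ₂).differentiable_LFunction hn3))

lemma G1_diff (hn1 : ψ₁ ≠ 1) (hn2 : ψ₂ ≠ 1) (hn3 : ψ₁ * ψ₂ ≠ 1) : Differentiable ℂ (G1 ψ₁ ψ₂) := by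
  have : Differentiable ℂ (fun s => Zf s * Hs ψ₁ ψ₂ s) := Zf_differentiable.mul (Hs_diff hn1 hn2 hn3)
  have h2 := (differentiableOn_dslope (f := fun s => Zf s * Hs ψ₁ ψ₂ s) (c := 1) (s := Set.univ)
    Filter.univ_mem).mpr this.differentiableOn
  exact fun z => (h2 z (Set.mem_univ z)).differentiableAt Filter.univ_mem

lemma G1_of_ne {s : ℂ} (hs : s ≠ 1) : G1 ψ₁ ψ₂ s = Gs ψ₁ ψ₂ s - Hs ψ₁ ψ₂ 1 * (s - 1)⁻¹ := by
  have : s - 1 ≠ 0 := sub_ne_zero.mpr hs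
  rw [G1, dslope_of_ne _ hs, slope_def_field, Zf_one, Zf_of_ne hs, Gs, Hs]
  field_simp

lemma L_bound_sphere (χ : DirichletCharacter ℂ q) (hχ : χ ≠ 1) {z : ℂ} (h : 1 / 2 ≤ z.re)
    (h' : |z.im| ≤ 3 / 2) : ‖χ.LFunction z‖ ≤ 35 * q := by
  have := LFunction_bound (ε := 1) one_pos le_rfl χ hχ (s := z) (by linarith)
  rw [Real.rpow_one] at this
  have hq : (0:ℝ) ≤ q := by positivity
  nlinarith

lemma iter_inv (m : ℕ) : iteratedDeriv m (fun s : ℂ => (s - 1)⁻¹) 2 = (-1) ^ m * m.factorial := by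
  have := iteratedDeriv_comp_sub_const m (fun z : ℂ => z⁻¹) 1
  rw [this]
  simp only
  rw [iteratedDeriv_eq_iterate]
  have h2 := iter_deriv_inv m ((2:ℂ) - 1)
  have e : (fun z : ℂ => z⁻¹) = Inv.inv := rfl
  rw [e, h2]
  norm_num

end

lemma siegel_main : ∃ C : ℝ, 1 ≤ C ∧ ∀ (q : ℕ) [NeZero q] (ψ₁ ψ₂ : DirichletCharacter ℂ q),
    ψ₁ ^ 2 = 1 → ψ₂ ^ 2 = 1 → ψ₁ ≠ 1 → ψ₂ ≠ 1 → ψ₁ * ψ₂ ≠ 1 → ∀ β : ℝ, 9 / 10 ≤ β → β < 1 →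
    (Gs ψ₁ ψ₂ β).re ≤ 0 → ∀ M : ℕ, 1 ≤ M →
    1 / 50 ≤ ‖Hs ψ₁ ψ₂ 1‖ * (2 - β) ^ M / (1 - β) + C * q ^ 3 * (3 / 4) ^ M := by
  obtain ⟨CZ, hCZ, hZb⟩ := exists_bound_rect (g := Zf) (1/2) (7/2) (-(3/2)) (3/2)
    Zf_differentiable.continuous.continuousOn
  refine ⟨4 * (4 * (CZ * 35 ^ 3)), by nlinarith, ?_⟩
  intro q _ ψ₁ ψ₂ h1 h2 hn1 hn2 hn3 β hβ hβ1 hG M hM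
  set x : ℝ := 2 - β with hx
  set l : ℂ := Hs ψ₁ ψ₂ 1 with hl
  have hq0 : (0:ℝ) ≤ q := by positivity
  set D : ℝ := 4 * (CZ * 35 ^ 3) * q ^ 3 with hD
  have hWb : ∀ z : ℂ, z.re ∈ Set.Icc (1/2 : ℝ) (7/2) → z.im ∈ Set.Icc (-(3/2) : ℝ) (3/2) →
      ‖Zf z * Hs ψ₁ ψ₂ z‖ ≤ CZ * (35 * q) ^ 3 := by
    intro z hr hi
    have him : |z.im| ≤ 3 / 2 := abs_le.mpr hi
    have b1 := L_bound_sphere ψ₁ hn1 hr.1 him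
    have b2 := L_bound_sphere ψ₂ hn2 hr.1 him
    have b3 := L_bound_sphere (ψ₁ * ψ₂) hn3 hr.1 him
    rw [Hs, norm_mul, norm_mul, norm_mul]
    calc ‖Zf z‖ * (‖ψ₁.LFunction z‖ * (‖ψ₂.LFunction z‖ * ‖(ψ₁ * ψ₂).LFunction z‖))
        ≤ CZ * ((35 * q) * ((35 * q) * (35 * q))) := by
          have := hZb z hr hi
          gcongr
      _ = _ := by ring
  have hG1b : ∀ z ∈ Metric.sphere (2:ℂ) (3/2), ‖G1 ψ₁ ψ₂ z‖ ≤ D := by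
    intro z hz
    rw [mem_sphere_iff_norm] at hz
    have hre := (abs_re_le_norm (z - 2)).trans hz.le
    have him := (abs_im_le_norm (z - 2)).trans hz.le
    simp only [sub_re, sub_im, re_ofNat, im_ofNat, sub_zero] at hre him
    have hre' := abs_le.mp hre
    have h3 : 1 / 2 ≤ ‖z - 1‖ := by
      have : ‖z - 2‖ ≤ ‖z - 1‖ + ‖(1:ℂ)‖ := by
        rw [show z - 2 = (z - 1) - 1 by ring]; exact norm_sub_le _ _
      rw [norm_one, hz] at this; linarith
    have hne : z ≠ 1 := by rintro rfl; norm_num at h3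
    have w1 := hWb z ⟨by linarith, by linarith⟩ (abs_le.mp him)
    have w2 := hWb 1 (by norm_num) (by norm_num)
    rw [G1, dslope_of_ne _ hne, slope_def_field, norm_div, div_le_iff₀ (by linarith)]
    refine (norm_sub_le _ _).trans ?_
    have hDp : 0 ≤ D := by positivity
    have : CZ * (35 * (q:ℝ)) ^ 3 = D / 4 := by rw [hD]; ring
    nlinarith
  have hcoef : ∀ m : ℕ, iteratedDeriv m (G1 ψ₁ ψ₂) 2 =
      iteratedDeriv m (Gs ψ₁ ψ₂) 2 - l * ((-1) ^ m * m.factorial) := by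
    intro m
    have ho : {s : ℂ | 1 < s.re} ∈ 𝓝 (2:ℂ) :=
      (isOpen_lt continuous_const continuous_re).mem_nhds (by simp)
    have hGan : AnalyticAt ℂ (Gs ψ₁ ψ₂) 2 := by
      apply DifferentiableOn.analyticAt (s := {s : ℂ | 1 < s.re}) _ ho
      exact fun z hz => (Gs_diffAt ψ₁ ψ₂ hz).differentiableWithinAt
    have hIan : AnalyticAt ℂ (fun s : ℂ => (s - 1)⁻¹) 2 := by
      apply AnalyticAt.inv (by fun_prop) (by norm_num)
    have hee : G1 ψ₁ ψ₂ =ᶠ[𝓝 2] (Gs ψ₁ ψ₂ - fun s => l * (s - 1)⁻¹) := by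
      filter_upwards [ho] with s hs
      exact G1_of_ne (by rintro rfl; simp at hs)
    have hIl : AnalyticAt ℂ (fun s : ℂ => l * (s - 1)⁻¹) 2 := analyticAt_const.mul hIan
    rw [hee.iteratedDeriv_eq, iteratedDeriv_sub hGan.contDiffAt hIl.contDiffAt, iteratedDeriv_const_mul_field, iter_inv]
  obtain ⟨g, hg, hg2⟩ := Gs_two h1 h2 hn1 hn2 hn3
  have halt := fun m => Gs_alternating h1 h2 (by
    rw [hg2]; exact_mod_cast (by linarith : (0:ℝ) ≤ g)) m
  set b : ℕ → ℝ := fun m => ((-1) ^ m * iteratedDeriv m (Gs ψ₁ ψ₂) 2).re / m.factorial with hb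
  have hb0 : ∀ m, 0 ≤ b m := fun m => div_nonneg (Complex.nonneg_iff.mp (halt m)).1 (by positivity)
  have hb00 : b 0 = g := by simp [hb, hg2]
  have hs := hasSum_taylorSeries_of_entire (G1_diff hn1 hn2 hn3) 2 (β:ℂ)
  set t : ℕ → ℂ := fun m => ((m.factorial:ℂ))⁻¹ • ((β:ℂ) - 2) ^ m • iteratedDeriv m (G1 ψ₁ ψ₂) 2 with ht
  have hfac : ∀ m : ℕ, (m.factorial:ℂ) ≠ 0 := fun m => by exact_mod_cast m.factorial_ne_zero
  have htre : ∀ m, (t m).re = (b m - l.re) * x ^ m := by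
    intro m
    have : t m = ((x ^ m / m.factorial : ℝ) : ℂ) * ((-1) ^ m * iteratedDeriv m (Gs ψ₁ ψ₂) 2)
        - ((x ^ m : ℝ) : ℂ) * l := by
      simp only [ht, hcoef, smul_eq_mul]
      rw [show (β:ℂ) - 2 = (-1) * (x:ℂ) by rw [hx]; push_cast; ring, mul_pow]
      push_cast
      have := hfac m
      field_simp
      have e : (-1:ℂ) ^ m * (-1) ^ m = 1 := by rw [← mul_pow]; simp
      linear_combination (-((x:ℂ)^m * l * (m.factorial:ℂ))) * e
    rw [this, sub_re, re_ofReal_mul, re_ofReal_mul, hb]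
    simp only
    ring
  have hxp : 0 < x := by rw [hx]; linarith
  have hx1 : x ≤ 11 / 10 := by rw [hx]; linarith
  have hDp : 0 ≤ D := by positivity
  have htn : ∀ m, ‖t m‖ ≤ D * (3 / 4) ^ m := by
    intro m
    have hc := norm_iteratedDeriv_le_of_forall_mem_sphere_norm_le m (by norm_num : (0:ℝ) < 3/2)
      (G1_diff hn1 hn2 hn3).diffContOnCl hG1b
    simp only [ht, norm_smul, norm_inv, norm_pow]
    have e1 : ‖(m.factorial:ℂ)‖ = m.factorial := by simp
    have e2 : ‖(β:ℂ) - 2‖ = x := by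
      rw [← ofReal_ofNat, ← ofReal_sub, norm_real, Real.norm_eq_abs, abs_of_neg (by linarith)]
      simp [hx]
    rw [e1, e2]
    have hf : (0:ℝ) < m.factorial := by positivity
    calc (m.factorial:ℝ)⁻¹ * (x ^ m * ‖iteratedDeriv m (G1 ψ₁ ψ₂) 2‖)
        ≤ (m.factorial:ℝ)⁻¹ * (x ^ m * (m.factorial * D / (3 / 2) ^ m)) := by gcongr
      _ = D * (x / (3 / 2)) ^ m := by rw [div_pow x]; field_simp
      _ ≤ D * (3 / 4) ^ m := by
          apply mul_le_mul_of_nonneg_left _ hDp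
          apply pow_le_pow_left₀ (by positivity)
          rw [div_le_iff₀ (by norm_num)]; linarith
  have hre : HasSum (fun m => (t m).re) (G1 ψ₁ ψ₂ β).re := hasSum_re hs
  have htail : -(D * (3/4) ^ M * 4) ≤ ∑' m, (t (m + M)).re := by
    have hgeo : HasSum (fun m : ℕ => D * (3/4) ^ M * (3/4 : ℝ) ^ m) (D * (3/4) ^ M * 4) := by
      have := (hasSum_geometric_of_lt_one (by norm_num : (0:ℝ) ≤ 3/4) (by norm_num)).mul_left
        (D * (3/4) ^ M)
      norm_num at this; exact this
    have hs2 : Summable (fun m => (t (m + M)).re) := (summable_nat_add_iff M).mpr hre.summable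
    have : ‖∑' m, (t (m + M)).re‖ ≤ D * (3/4) ^ M * 4 := by
      apply hs2.hasSum.norm_le_of_bounded hgeo
      intro m
      refine (abs_re_le_norm _).trans ((htn _).trans (le_of_eq ?_))
      rw [pow_add]; ring
    exact (abs_le.mp this).1
  have hsplit := hre.summable.sum_add_tsum_nat_add M
  rw [hre.tsum_eq] at hsplit
  have hfin : g - l.re * ((x ^ M - 1) / (x - 1)) ≤ ∑ m ∈ Finset.range M, (t m).re := by
    simp only [htre, sub_mul, sum_sub_distrib]
    rw [← mul_sum, geom_sum_eq (by rw [hx]; intro h; linarith)]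
    have : g ≤ ∑ m ∈ Finset.range M, b m * x ^ m := by
      have := single_le_sum (f := fun m => b m * x ^ m) (s := Finset.range M)
        (fun m _ => mul_nonneg (hb0 m) (by positivity)) (Finset.mem_range.mpr (by omega : 0 < M))
      simpa [hb00] using this
    linarith
  have hβne : (β:ℂ) ≠ 1 := by exact_mod_cast hβ1.ne
  have hG1re : (G1 ψ₁ ψ₂ β).re ≤ l.re / (1 - β) := by
    rw [G1_of_ne hβne, sub_re]
    have : (l * ((β:ℂ) - 1)⁻¹).re = - (l.re / (1 - β)) := by
      rw [show ((β:ℂ) - 1)⁻¹ = (((β - 1)⁻¹ : ℝ) : ℂ) by push_cast; ring, mul_comm, re_ofReal_mul]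
      rw [← neg_sub 1 β, inv_neg]; ring
    rw [this]; linarith
  have hx1' : x - 1 = 1 - β := by rw [hx]; ring
  rw [hx1'] at hfin
  have hβp : 0 < 1 - β := by linarith
  have h5 : g ≤ l.re * x ^ M / (1 - β) + D * (3/4) ^ M * 4 := by
    have e : l.re * ((x ^ M - 1) / (1 - β)) + l.re / (1 - β) = l.re * x ^ M / (1 - β) := by
      field_simp; ring
    linarith
  have h6 : l.re * x ^ M / (1 - β) ≤ ‖l‖ * x ^ M / (1 - β) := by
    have := re_le_norm l
    gcongr
  have h7 : D * (3/4) ^ M * 4 = 4 * (4 * (CZ * 35 ^ 3)) * q ^ 3 * (3/4) ^ M := by rw [hD]; ring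
  linarith

end SW

namespace SW
open Complex Filter Asymptotics Topology

lemma siegel_main2 : ∃ c : ℝ, 0 < c ∧ ∀ (q : ℕ) [NeZero q] (ψ₁ ψ₂ : DirichletCharacter ℂ q),
    ψ₁ ^ 2 = 1 → ψ₂ ^ 2 = 1 → ψ₁ ≠ 1 → ψ₂ ≠ 1 → ψ₁ * ψ₂ ≠ 1 → ∀ β : ℝ, 9 / 10 ≤ β → β < 1 →
    (Gs ψ₁ ψ₂ β).re ≤ 0 → c * (1 - β) ≤ ‖Hs ψ₁ ψ₂ 1‖ * (q:ℝ) ^ (12 * (1 - β)) := by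
  obtain ⟨C, hC, hm⟩ := siegel_main
  set E := Real.exp (4 * Real.log (100 * C) + 2) with hE
  have hEp : 0 < E := Real.exp_pos _
  refine ⟨1 / (100 * E), by positivity, ?_⟩
  intro q _ ψ₁ ψ₂ h1 h2 hn1 hn2 hn3 β hβ hβ1 hG
  have hq : (1:ℝ) ≤ q := by exact_mod_cast NeZero.one_le
  have hq0 : (0:ℝ) < q := by linarith
  have hC0 : 0 < C := by linarith
  have hlq := Real.log_nonneg hq
  have hlC : 0 ≤ Real.log (100 * C) := Real.log_nonneg (by linarith)
  set M : ℕ := ⌈4 * (Real.log (100 * C) + 3 * Real.log q)⌉₊ + 1 with hM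
  have hM1 : 4 * (Real.log (100 * C) + 3 * Real.log q) ≤ M := by
    have := Nat.le_ceil (4 * (Real.log (100 * C) + 3 * Real.log q))
    rw [hM]; push_cast; linarith
  have hM2 : (M:ℝ) ≤ 4 * (Real.log (100 * C) + 3 * Real.log q) + 2 := by
    have := Nat.ceil_lt_add_one (a := 4 * (Real.log (100 * C) + 3 * Real.log q)) (by positivity)
    rw [hM]; push_cast; linarith
  have key := hm q ψ₁ ψ₂ h1 h2 hn1 hn2 hn3 β hβ hβ1 hG M (by omega)
  have ht : C * q ^ 3 * (3/4 : ℝ) ^ M ≤ 1 / 100 := by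
    have a1 : (3/4:ℝ) ≤ Real.exp (-(1/4)) := by
      have := Real.add_one_le_exp (-(1/4:ℝ)); linarith
    have a2 : (3/4:ℝ) ^ M ≤ Real.exp (-(Real.log (100 * C) + 3 * Real.log q)) := by
      calc (3/4:ℝ) ^ M ≤ (Real.exp (-(1/4))) ^ M := pow_le_pow_left₀ (by norm_num) a1 _
        _ = Real.exp (M * (-(1/4))) := by rw [Real.exp_nat_mul]
        _ ≤ _ := Real.exp_le_exp.mpr (by linarith)
    have a3 : Real.exp (-(Real.log (100 * C) + 3 * Real.log q)) = 1 / (100 * C * q ^ 3) := by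
      rw [Real.exp_neg, Real.exp_add, Real.exp_log (by positivity),
        show 3 * Real.log q = Real.log ((q:ℝ)^3) by rw [Real.log_pow]; norm_num,
        Real.exp_log (by positivity), one_div]
    rw [a3] at a2
    calc C * q ^ 3 * (3/4 : ℝ) ^ M ≤ C * q ^ 3 * (1 / (100 * C * q ^ 3)) := by gcongr
      _ = 1 / 100 := by field_simp
  have hβp : 0 < 1 - β := by linarith
  have hx : (2 - β) ^ M ≤ E * (q:ℝ) ^ (12 * (1 - β)) := by
    calc (2 - β) ^ M ≤ (Real.exp (1 - β)) ^ M := by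
          apply pow_le_pow_left₀ (by linarith)
          have := Real.add_one_le_exp (1 - β); linarith
      _ = Real.exp (M * (1 - β)) := by rw [Real.exp_nat_mul]
      _ ≤ Real.exp ((4 * Real.log (100 * C) + 2) + Real.log q * (12 * (1 - β))) := by
          apply Real.exp_le_exp.mpr
          have : M * (1 - β) ≤ (4 * (Real.log (100 * C) + 3 * Real.log q) + 2) * (1 - β) := by gcongr
          nlinarith
      _ = _ := by rw [Real.exp_add, Real.rpow_def_of_pos hq0]
  have h3 : 1 / 100 ≤ ‖Hs ψ₁ ψ₂ 1‖ * (2 - β) ^ M / (1 - β) := by linarith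
  rw [le_div_iff₀ hβp] at h3
  have h4 : ‖Hs ψ₁ ψ₂ 1‖ * (2 - β) ^ M ≤ ‖Hs ψ₁ ψ₂ 1‖ * (E * (q:ℝ) ^ (12 * (1 - β))) := by gcongr
  have h5 : 1 / 100 * (1 - β) ≤ E * (‖Hs ψ₁ ψ₂ 1‖ * (q:ℝ) ^ (12 * (1 - β))) := by linarith
  rw [show 1 / (100 * E) * (1 - β) = (1 / 100 * (1 - β)) / E by field_simp, div_le_iff₀ hEp]
  linarith

lemma LFunction_one_upper {ε : ℝ} (h0 : 0 < ε) (h1 : ε ≤ 1) :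
    ∃ C : ℝ, 1 ≤ C ∧ ∀ (q : ℕ) [NeZero q] (χ : DirichletCharacter ℂ q), χ ≠ 1 →
      ‖χ.LFunction 1‖ ≤ C * (q:ℝ) ^ ε := by
  obtain ⟨C, hC, hb⟩ := LFunction_deriv_bound h0 h1
  refine ⟨C * 2 ^ ε, by have := Real.one_le_rpow (by norm_num : (1:ℝ) ≤ 2) h0.le; nlinarith, ?_⟩
  intro q _ χ hχ
  have := (hb q χ hχ 1 (by simp; positivity)).1
  simp only [one_im, abs_zero, zero_add] at this
  rw [Real.mul_rpow (by positivity) (by norm_num)] at this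
  linarith

lemma siegel_core {ε : ℝ} (h0 : 0 < ε) (h1 : ε ≤ 1) {q₁ : ℕ} [NeZero q₁]
    (χ₁ : DirichletCharacter ℂ q₁) (hq1 : χ₁ ^ 2 = 1) (hn1 : χ₁ ≠ 1) {β : ℝ} (hβ : 9 / 10 ≤ β)
    (hβ1 : β < 1) (hβε : 12 * (1 - β) ≤ ε / 4)
    (hP : ∀ (q₂ : ℕ) [NeZero q₂] (χ₂ : DirichletCharacter ℂ q₂), χ₂ ^ 2 = 1 → χ₂ ≠ 1 →
      DirichletCharacter.changeLevel (Nat.dvd_mul_right q₁ q₂) χ₁ *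
        DirichletCharacter.changeLevel (Nat.dvd_mul_left q₂ q₁) χ₂ ≠ 1 →
      (Gs (DirichletCharacter.changeLevel (Nat.dvd_mul_right q₁ q₂) χ₁)
        (DirichletCharacter.changeLevel (Nat.dvd_mul_left q₂ q₁) χ₂) β).re ≤ 0) :
    ∃ c : ℝ, 0 < c ∧ ∀ (q : ℕ) [NeZero q] (χ : DirichletCharacter ℂ q), χ ^ 2 = 1 → χ ≠ 1 →
      c ≤ ‖χ.LFunction 1‖ * (q:ℝ) ^ ε := by
  obtain ⟨c, hc, hm⟩ := siegel_main2
  obtain ⟨C, hC, hb⟩ := LFunction_one_upper (ε := ε / 4) (by positivity) (by linarith)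
  set K : ℝ := 2 / (ε / 4) + 1 with hK
  have hK1 : 1 ≤ K := by rw [hK]; have : 0 < 2 / (ε/4) := by positivity
                         linarith
  have hL1 : 0 < ‖χ₁.LFunction 1‖ :=
    norm_pos_iff.mpr (DirichletCharacter.LFunction_apply_one_ne_zero hn1)
  have hq1p : (1:ℝ) ≤ q₁ := by exact_mod_cast NeZero.one_le
  set Q1 : ℝ := (q₁:ℝ) ^ ε with hQ1
  have hQ1p : 0 < Q1 := by positivity
  refine ⟨min (c * (1 - β) / (C ^ 2 * K * Q1)) (‖χ₁.LFunction 1‖ / (K ^ 2 * Q1)), ?_, ?_⟩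
  · apply lt_min
    · have : 0 < 1 - β := by linarith
      positivity
    · positivity
  intro q₂ _ χ₂ hq2 hn2
  have hq2p : (1:ℝ) ≤ q₂ := by exact_mod_cast NeZero.one_le
  have hP' := hP q₂ χ₂ hq2 hn2
  have hcmp1 := changeLevel_compare (Nat.dvd_mul_right q₁ q₂) χ₁ hn1
  have hcmp2 := changeLevel_compare (Nat.dvd_mul_left q₂ q₁) χ₂ hn2
  set ψ₁ := DirichletCharacter.changeLevel (Nat.dvd_mul_right q₁ q₂) χ₁ with hψ₁
  set ψ₂ := DirichletCharacter.changeLevel (Nat.dvd_mul_left q₂ q₁) χ₂ with hψ₂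
  have s1 : ψ₁ ^ 2 = 1 := by rw [hψ₁, ← map_pow, hq1, map_one]
  have s2 : ψ₂ ^ 2 = 1 := by rw [hψ₂, ← map_pow, hq2, map_one]
  have m1 : ψ₁ ≠ 1 := fun h => hn1 ((DirichletCharacter.changeLevel_eq_one_iff _).mp h)
  have m2 : ψ₂ ≠ 1 := fun h => hn2 ((DirichletCharacter.changeLevel_eq_one_iff _).mp h)
  have hcard := card_primeFactors_bound (ε := ε / 4) (by positivity) (NeZero.ne (q₁ * q₂))
  rw [← hK] at hcard
  set X : ℝ := ((q₁ * q₂ : ℕ):ℝ) with hX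
  have hX1 : 1 ≤ X := by rw [hX]; push_cast; nlinarith
  set Y : ℝ := X ^ (ε / 4) with hY
  have hY1 : 1 ≤ Y := Real.one_le_rpow hX1 (by positivity)
  have hY4 : Y ^ 4 = Q1 * (q₂:ℝ) ^ ε := by
    rw [hY, ← Real.rpow_natCast, ← Real.rpow_mul (by linarith), hX]
    push_cast
    rw [show ε / 4 * 4 = ε by ring, Real.mul_rpow (by linarith) (by linarith)]
  have hL2 : ‖ψ₂.LFunction 1‖ ≤ (K * Y) * ‖χ₂.LFunction 1‖ :=
    hcmp2.1.trans (mul_le_mul_of_nonneg_right hcard (norm_nonneg _))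
  have hL2' : ‖χ₂.LFunction 1‖ * (q₂:ℝ) ^ ε = ‖χ₂.LFunction 1‖ * Y ^ 4 / Q1 := by
    rw [hY4]; field_simp
  rw [hL2']
  have hc2 := norm_nonneg (χ₂.LFunction 1)
  by_cases h3 : ψ₁ * ψ₂ = 1
  · refine (min_le_right _ _).trans ?_
    have he : ψ₁ = ψ₂ := by
      calc ψ₁ = ψ₁ * ψ₂ ^ 2 := by rw [s2, mul_one]
        _ = (ψ₁ * ψ₂) * ψ₂ := by rw [sq, mul_assoc]
        _ = ψ₂ := by rw [h3, one_mul]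
    have h4 : ‖χ₁.LFunction 1‖ ≤ (K * Y) * ‖ψ₂.LFunction 1‖ := by
      rw [← he]; exact hcmp1.2.trans (mul_le_mul_of_nonneg_right hcard (norm_nonneg _))
    have h5 : ‖χ₁.LFunction 1‖ ≤ (K * Y) * ((K * Y) * ‖χ₂.LFunction 1‖) :=
      h4.trans (mul_le_mul_of_nonneg_left hL2 (by positivity))
    rw [← div_div]
    apply div_le_div_of_nonneg_right _ hQ1p.le
    rw [div_le_iff₀ (by positivity)]
    have h6 : Y ^ 2 ≤ Y ^ 4 := pow_le_pow_right₀ hY1 (by norm_num)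
    calc ‖χ₁.LFunction 1‖ ≤ (‖χ₂.LFunction 1‖ * K ^ 2) * Y ^ 2 := by linarith
      _ ≤ (‖χ₂.LFunction 1‖ * K ^ 2) * Y ^ 4 := by gcongr
      _ = _ := by ring
  · refine (min_le_left _ _).trans ?_
    have hm' := hm (q₁ * q₂) ψ₁ ψ₂ s1 s2 m1 m2 h3 β hβ hβ1 (hP' h3)
    have b1 := hb (q₁ * q₂) ψ₁ m1
    have b3 := hb (q₁ * q₂) (ψ₁ * ψ₂) h3
    rw [← hX, ← hY] at b1 b3
    have hr : X ^ (12 * (1 - β)) ≤ Y := Real.rpow_le_rpow_of_exponent_le hX1 hβε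
    rw [Hs, norm_mul, norm_mul, ← hX] at hm'
    have h5 : c * (1 - β) ≤ ((C * Y) * ((K * Y * ‖χ₂.LFunction 1‖) * (C * Y))) * Y := by
      refine hm'.trans ?_
      gcongr
    rw [← div_div]
    apply div_le_div_of_nonneg_right _ hQ1p.le
    rw [div_le_iff₀ (by positivity)]
    linarith

lemma zeta_neg_near_one : ∃ δ : ℝ, 0 < δ ∧ ∀ β : ℝ, 1 - δ ≤ β → β < 1 → (riemannZeta β).re ≤ 0 := by
  have hc : ContinuousAt (fun x : ℝ => (Zf x).re) 1 :=
    (continuous_re.comp (Zf_differentiable.continuous.comp continuous_ofReal)).continuousAt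
  have hp : ∀ᶠ x : ℝ in 𝓝 1, 0 < (Zf x).re := by
    apply hc.eventually_const_lt
    simp [Zf_one]
  obtain ⟨δ, hδ, hd⟩ := Metric.eventually_nhds_iff.mp hp
  refine ⟨δ / 2, by positivity, ?_⟩
  intro β h1 h2
  have h3 := hd (y := β) (by rw [Real.dist_eq, abs_of_neg (by linarith)]; linarith)
  have hne : (β:ℂ) ≠ 1 := by exact_mod_cast h2.ne
  rw [Zf_of_ne hne, show (β:ℂ) - 1 = ((β - 1 : ℝ) : ℂ) by push_cast; ring, re_ofReal_mul] at h3
  by_contra h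
  push Not at h
  nlinarith

theorem siegel {ε : ℝ} (h0 : 0 < ε) (h1 : ε ≤ 1) :
    ∃ c : ℝ, 0 < c ∧ ∀ (q : ℕ) [NeZero q] (χ : DirichletCharacter ℂ q), χ ^ 2 = 1 → χ ≠ 1 →
      c ≤ ‖χ.LFunction 1‖ * (q:ℝ) ^ ε := by
  obtain ⟨δ₀, hδ₀, hz⟩ := zeta_neg_near_one
  set δ : ℝ := min δ₀ (ε / 48) with hδ
  have hδp : 0 < δ := lt_min hδ₀ (by positivity)
  have hδ2 : δ ≤ ε / 48 := min_le_right _ _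
  have hδ1 : δ ≤ δ₀ := min_le_left _ _
  by_cases hA : ∃ (q₁ : ℕ) (_ : NeZero q₁) (χ₁ : DirichletCharacter ℂ q₁) (β : ℝ),
      χ₁ ^ 2 = 1 ∧ χ₁ ≠ 1 ∧ 1 - δ ≤ β ∧ β < 1 ∧ χ₁.LFunction β = 0
  · obtain ⟨q₁, _, χ₁, β, hq1, hn1, hβ, hβ1, hL⟩ := hA
    refine siegel_core h0 h1 χ₁ hq1 hn1 (β := β) (by linarith) hβ1 (by linarith) ?_
    intro q₂ _ χ₂ _ _ _
    rw [Gs, DirichletCharacter.LFunction_changeLevel _ χ₁ (Or.inl hn1), hL]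
    simp
  · push Not at hA
    by_cases hB : ∃ (q₁ : ℕ) (_ : NeZero q₁) (χ₁ : DirichletCharacter ℂ q₁), χ₁ ^ 2 = 1 ∧ χ₁ ≠ 1
    · obtain ⟨q₁, _, χ₁, hq1, hn1⟩ := hB
      refine siegel_core h0 h1 χ₁ hq1 hn1 (β := 1 - δ) (by linarith) (by linarith) (by linarith) ?_
      intro q₂ _ χ₂ hq2 hn2 h3
      set ψ₁ := DirichletCharacter.changeLevel (Nat.dvd_mul_right q₁ q₂) χ₁ with hψ₁
      set ψ₂ := DirichletCharacter.changeLevel (Nat.dvd_mul_left q₂ q₁) χ₂ with hψ₂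
      have s1 : ψ₁ ^ 2 = 1 := by rw [hψ₁, ← map_pow, hq1, map_one]
      have s2 : ψ₂ ^ 2 = 1 := by rw [hψ₂, ← map_pow, hq2, map_one]
      have m1 : ψ₁ ≠ 1 := fun h => hn1 ((DirichletCharacter.changeLevel_eq_one_iff _).mp h)
      have m2 : ψ₂ ≠ 1 := fun h => hn2 ((DirichletCharacter.changeLevel_eq_one_iff _).mp h)
      have hpos : ∀ χ : DirichletCharacter ℂ (q₁ * q₂), χ ^ 2 = 1 → χ ≠ 1 →
          ∃ x : ℝ, 0 < x ∧ χ.LFunction ((1 - δ : ℝ):ℂ) = x := by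
        intro χ hs hn
        refine ⟨_, quad_LFunction_pos hs hn (β := 1 - δ) (by linarith) ?_,
          ofReal_re_of_im (quad_LFunction_im hs hn _)⟩
        intro x hx hx1
        exact hA (q₁ * q₂) inferInstance χ x hs hn hx hx1
      obtain ⟨x1, hx1, e1⟩ := hpos ψ₁ s1 m1
      obtain ⟨x2, hx2, e2⟩ := hpos ψ₂ s2 m2
      obtain ⟨x3, hx3, e3⟩ := hpos (ψ₁ * ψ₂) (quad_mul s1 s2) h3
      rw [Gs, e1, e2, e3, ← ofReal_mul, ← ofReal_mul, mul_comm, re_ofReal_mul]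
      apply mul_nonpos_of_nonneg_of_nonpos (by positivity)
      exact hz _ (by linarith) (by linarith)
    · push Not at hB
      refine ⟨1, one_pos, ?_⟩
      intro q _ χ hs hn
      exact absurd (hB q inferInstance χ hs) hn

end SW

namespace SW
open Complex Filter Asymptotics Topology

lemma triv_bound {ε : ℝ} (h0 : 0 < ε) (h1 : ε ≤ 1) :
    ∃ C : ℝ, 1 ≤ C ∧ ∀ (q : ℕ) [NeZero q] (s : ℂ), 1 ≤ s.re → s.re ≤ 2 → s ≠ 1 →
      ‖DirichletCharacter.LFunctionTrivChar q s‖ ≤ C * ((q:ℝ) * (|s.im| + 2)) ^ ε * (1 + 1 / ‖s - 1‖) := by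
  obtain ⟨C, hC, hz⟩ := zeta_bound' h0 h1
  have h2 : 0 < 2 / ε := by positivity
  refine ⟨(2 / ε + 1) * C, by nlinarith, fun q _ s hs hs2 hs1 => ?_⟩
  have hq : q ≠ 0 := NeZero.ne q
  rw [DirichletCharacter.LFunctionTrivChar_eq_mul_riemannZeta hs1, norm_mul]
  have e1 : ‖∏ p ∈ q.primeFactors, (1 - (p:ℂ) ^ (-s))‖ ≤ (2 / ε + 1) * (q:ℝ) ^ ε := by
    refine le_trans ?_ (card_primeFactors_bound h0 hq)
    refine le_trans ?_ (prod_one_add_upper _ (fun n hn => (Nat.prime_of_mem_primeFactors hn).two_le))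
    rw [norm_prod]
    refine prod_le_prod (fun _ _ => norm_nonneg _) (fun p hp => ?_)
    have hp0 : 0 < p := (Nat.prime_of_mem_primeFactors hp).pos
    refine (norm_sub_le _ _).trans ?_
    rw [norm_one, norm_natCast_cpow_of_pos hp0, neg_re, Real.rpow_neg (by positivity), one_div]
    have : (p:ℝ) ≤ (p:ℝ) ^ s.re := by
      conv_lhs => rw [← Real.rpow_one (p:ℝ)]
      exact Real.rpow_le_rpow_of_exponent_le (by exact_mod_cast hp0) hs
    gcongr
  have e2 := hz s hs hs2 hs1
  have e3 : (1:ℝ) ≤ (|s.im| + 2) ^ ε := Real.one_le_rpow (by linarith [abs_nonneg s.im]) h0.le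
  have e4 : (|s.im| + 2) ^ ε + 1 / ‖s - 1‖ ≤ (|s.im| + 2) ^ ε * (1 + 1 / ‖s - 1‖) := by
    have : 0 ≤ 1 / ‖s - 1‖ := by positivity
    nlinarith
  rw [Real.mul_rpow (by positivity) (by positivity)]
  calc _ ≤ ((2 / ε + 1) * (q:ℝ) ^ ε) * (C * ((|s.im| + 2) ^ ε * (1 + 1 / ‖s - 1‖))) := by
        refine mul_le_mul e1 (e2.trans ?_) (norm_nonneg _) (by positivity)
        gcongr
    _ = _ := by ring

lemma core341 {ε : ℝ} (h0 : 0 < ε) (h1 : ε ≤ 1) :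
    ∃ C : ℝ, 1 ≤ C ∧ ∀ (q : ℕ) [NeZero q] (χ : DirichletCharacter ℂ q) (t η₁ M D : ℝ),
      1 ≤ M → 1 ≤ D → 0 ≤ η₁ → (t ≠ 0 ∨ χ ≠ 1) →
      (∀ x ∈ Set.Icc (1:ℝ) 2, ‖deriv χ.LFunction (x + t * I)‖ ≤ D) →
      (∀ η : ℝ, 0 < η → η₁ ≤ η → η ≤ 1 → ‖(χ ^ 2).LFunction (1 + η + 2 * I * t)‖ ≤ M) →
      ∀ η : ℝ, η₁ ≤ η → η ≤ 1 →
        1 / (C * ((q:ℝ) * (|t| + 2)) ^ (3 * ε) * M * D ^ 3) ≤ ‖χ.LFunction ((1 + η : ℝ) + t * I)‖ := by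
  obtain ⟨C, hC, hz⟩ := triv_bound h0 h1
  refine ⟨16 * (2 * C) ^ 3, ?_, fun q _ χ t η₁ M D hM hD hη₁ hne hder hM2 => ?_⟩
  · have : (1:ℝ) ≤ (2 * C) ^ 3 := one_le_pow₀ (by linarith)
    linarith
  have hq : (1:ℝ) ≤ q := by exact_mod_cast NeZero.one_le
  set V := (q:ℝ) * (|t| + 2) with hV
  have hV1 : (q:ℝ) * 2 ≤ V := by rw [hV]; have := abs_nonneg t; gcongr; linarith
  have hV0 : 1 ≤ V := by linarith
  have hVe : 1 ≤ V ^ ε := Real.one_le_rpow hV0 h0.le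
  have hVe3 : V ^ (3 * ε) = (V ^ ε) ^ 3 := by
    rw [mul_comm, Real.rpow_mul (by linarith)]; norm_cast
  have hK : 1 ≤ (2 * C) ^ 3 * V ^ (3 * ε) * M := by
    rw [hVe3]
    have a1 : (1:ℝ) ≤ (2 * C) ^ 3 := one_le_pow₀ (by linarith)
    have a2 : (1:ℝ) ≤ (V ^ ε) ^ 3 := one_le_pow₀ hVe
    exact one_le_mul_of_one_le_of_one_le (one_le_mul_of_one_le_of_one_le a1 a2) hM
  have := lower_of_341 (h := fun x : ℝ => χ.LFunction (x + t * I))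
    (h' := fun x : ℝ => deriv χ.LFunction (x + t * I)) hD hK (η₁ := η₁) ?_ hder hη₁ ?_
  · intro η ha hb
    refine le_trans (le_of_eq ?_) (this η ha hb)
    congr 1; ring
  · intro x hx
    have hd : DifferentiableAt ℂ χ.LFunction (x + t * I) := by
      apply DirichletCharacter.differentiableAt_LFunction
      rcases hne with h | h
      · left; intro hh; apply h; simpa using congrArg Complex.im hh
      · right; exact h
    have h2 : HasDerivAt (fun z : ℂ => χ.LFunction (z + t * I)) (deriv χ.LFunction (x + t * I)) (x:ℂ) :=
      hd.hasDerivAt.comp_add_const (x:ℂ) (t * I)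
    exact h2.comp_ofReal
  · intro η hη hη2 hη3
    have g1 := χ.norm_LFunction_product_ge_one hη t
    rw [norm_mul, norm_mul, norm_pow, norm_pow] at g1
    have g2 := hz q (1 + η) (by simp; exact hη.le) (by simp; linarith) (by simp; exact_mod_cast hη.ne')
    simp only [add_im, one_im, ofReal_im, add_zero, abs_zero, zero_add, add_sub_cancel_left, norm_real, Real.norm_eq_abs, abs_of_pos hη] at g2
    have g3 : ‖DirichletCharacter.LFunctionTrivChar q (1 + η)‖ ≤ 2 * C * V ^ ε / η := by
      refine g2.trans ?_
      have : (1:ℝ) ≤ 1 / η := by rw [le_div_iff₀ hη]; linarith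
      calc C * ((q:ℝ) * 2) ^ ε * (1 + 1 / η) ≤ C * V ^ ε * (1 / η + 1 / η) := by gcongr
        _ = _ := by ring
    have g4 := hM2 η hη hη2 hη3
    have g5 : (↑(1 + η) + ↑t * I : ℂ) = 1 + η + I * t := by push_cast; ring
    simp only [g5]
    have g6 : 1 ≤ (2 * C * V ^ ε / η) ^ 3 * ‖χ.LFunction (1 + η + I * t)‖ ^ 4 * M := by
      refine le_trans g1 ?_
      gcongr
    rw [hVe3]
    have g7 : (2 * C * V ^ ε / η) ^ 3 = (2 * C) ^ 3 * (V ^ ε) ^ 3 / η ^ 3 := by ring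
    rw [g7, div_mul_eq_mul_div, div_mul_eq_mul_div, le_div_iff₀ (by positivity)] at g6
    linarith

end SW

namespace SW
open Complex Filter Asymptotics Topology

lemma zeta_lower {ε : ℝ} (h0 : 0 < ε) (h1 : ε ≤ 1) :
    ∃ c : ℝ, 0 < c ∧ ∀ (s : ℂ), 1 ≤ s.re → s.re ≤ 2 → 3 / 2 ≤ |s.im| →
      c * (|s.im| + 2) ^ (-(7 * ε)) ≤ ‖riemannZeta s‖ := by
  obtain ⟨C, hC, hcore⟩ := core341 h0 h1
  obtain ⟨C1, hC1, hz⟩ := zeta_deriv_bound h0 h1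
  refine ⟨1 / (C * (2 * C1) * C1 ^ 3), by positivity, fun s hs1 hs2 ht => ?_⟩
  set t := s.im with htd
  have ht0 : t ≠ 0 := by intro h; rw [h] at ht; norm_num at ht
  have hV0 : 1 ≤ |t| + 2 := by linarith
  have hVe : 1 ≤ (|t| + 2) ^ ε := Real.one_le_rpow hV0 h0.le
  have hpow : ∀ k : ℕ, (|t| + 2) ^ ((k:ℝ) * ε) = ((|t| + 2) ^ ε) ^ k := fun k => by
    rw [mul_comm, Real.rpow_mul (by linarith)]; norm_cast
  have key := hcore 1 1 t 0 (2 * C1 * (|t| + 2) ^ ε) (C1 * (|t| + 2) ^ ε) (by nlinarith) (by nlinarith) le_rfl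
    (Or.inl ht0) ?_ ?_ (s.re - 1) (by linarith) (by linarith)
  · rw [DirichletCharacter.LFunction_modOne_eq] at key
    have e1 : ((1 + (s.re - 1) : ℝ) : ℂ) + t * I = s := by
      rw [add_sub_cancel]; exact re_add_im s
    rw [e1] at key
    refine le_trans (le_of_eq ?_) key
    have h3 := hpow 3
    have h7 := hpow 7
    push_cast at h3 h7
    rw [Real.rpow_neg (by linarith), h7]
    simp only [Nat.cast_one, one_mul]
    rw [h3]
    field_simp
  · intro x hx
    rw [DirichletCharacter.LFunction_modOne_eq]
    have := (hz (x + t * I) (by simp; linarith [hx.1]) (by simpa using ht)).2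
    simpa using this
  · intro η hη _ hη1
    rw [DirichletCharacter.LFunction_modOne_eq]
    have e2 : ((1:ℂ) + η + 2 * I * t).im = 2 * t := by simp
    have := (hz (1 + η + 2 * I * t) (by simp; linarith) (by rw [e2, abs_mul, abs_two]; linarith)).1
    rw [e2, abs_mul, abs_two] at this
    refine this.trans ?_
    have : (2 * |t| + 2) ^ ε ≤ 2 * (|t| + 2) ^ ε := by
      calc (2 * |t| + 2) ^ ε ≤ (2 * (|t| + 2)) ^ ε := by
            apply Real.rpow_le_rpow (by positivity) (by linarith) h0.le
        _ = 2 ^ ε * (|t| + 2) ^ ε := Real.mul_rpow (by norm_num) (by positivity)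
        _ ≤ _ := by
          gcongr
          calc (2:ℝ) ^ ε ≤ 2 ^ (1:ℝ) := Real.rpow_le_rpow_of_exponent_le (by norm_num) h1
            _ = 2 := by norm_num
    nlinarith

lemma two_mul_V {ε : ℝ} (h0 : 0 < ε) (h1 : ε ≤ 1) (q t : ℝ) (hq : 0 ≤ q) :
    (q * (|2 * t| + 2)) ^ ε ≤ 2 * (q * (|t| + 2)) ^ ε := by
  rw [abs_mul, abs_two]
  calc (q * (2 * |t| + 2)) ^ ε ≤ (2 * (q * (|t| + 2))) ^ ε := by
        apply Real.rpow_le_rpow (by positivity) (by nlinarith) h0.le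
    _ = 2 ^ ε * (q * (|t| + 2)) ^ ε := Real.mul_rpow (by norm_num) (by positivity)
    _ ≤ _ := by
      gcongr
      calc (2:ℝ) ^ ε ≤ 2 ^ (1:ℝ) := Real.rpow_le_rpow_of_exponent_le (by norm_num) h1
        _ = 2 := by norm_num

lemma L_lower {ε : ℝ} (h0 : 0 < ε) (h1 : ε ≤ 1) :
    ∃ c : ℝ, 0 < c ∧ ∀ (q : ℕ) [NeZero q] (χ : DirichletCharacter ℂ q), χ ≠ 1 → ∀ (s : ℂ),
      1 ≤ s.re → s.re ≤ 2 →
      c * ((q:ℝ) * (|s.im| + 2)) ^ (-(9 * ε)) ≤ ‖χ.LFunction s‖ := by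
  obtain ⟨C, hC, hcore⟩ := core341 h0 h1
  obtain ⟨C1, hC1, hz⟩ := LFunction_deriv_bound h0 h1
  obtain ⟨C2, hC2, htriv⟩ := triv_bound h0 h1
  obtain ⟨c3, hc3, hsieg⟩ := siegel h0 h1
  set κ : ℝ := min 1 (c3 / (12 * C1)) with hκ
  have hκ0 : 0 < κ := lt_min one_pos (by positivity)
  have hκ1 : κ ≤ 1 := min_le_left _ _
  have hκ2 : κ * (12 * C1) ≤ c3 := by
    have : κ ≤ c3 / (12 * C1) := min_le_right _ _
    rwa [le_div_iff₀ (by positivity)] at this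
  set K : ℝ := (2 * C1 + 4 * C2 / κ) with hKd
  have hK : 1 ≤ K := by
    have : 0 ≤ 4 * C2 / κ := by positivity
    linarith
  set cA : ℝ := 1 / (C * K * C1 ^ 3) with hcA
  have hcA0 : 0 < cA := by positivity
  refine ⟨min cA (c3 / 2), lt_min hcA0 (by positivity), fun q _ χ hχ s hs1 hs2 => ?_⟩
  set t := s.im with htd
  have hq : (1:ℝ) ≤ q := by exact_mod_cast NeZero.one_le
  have hqV : (q:ℝ) ≤ (q:ℝ) * (|t| + 2) := by nlinarith [abs_nonneg t]
  have htwo := two_mul_V h0 h1 q t (by linarith)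
  set V := (q:ℝ) * (|t| + 2) with hV
  have hV0 : 1 ≤ V := by linarith
  have hVe : 1 ≤ V ^ ε := Real.one_le_rpow hV0 h0.le
  have hpow : ∀ k : ℕ, V ^ ((k:ℝ) * ε) = (V ^ ε) ^ k := fun k => by
    rw [mul_comm, Real.rpow_mul (by linarith)]; norm_cast
  have h3 := hpow 3
  have h9 := hpow 9
  push_cast at h3 h9
  have hmono : (q:ℝ) ^ ε ≤ V ^ ε := Real.rpow_le_rpow (by linarith) hqV h0.le
  have hqe : 1 ≤ (q:ℝ) ^ ε := Real.one_le_rpow hq h0.le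
  have e1 : ((1 + (s.re - 1) : ℝ) : ℂ) + t * I = s := by
    rw [add_sub_cancel]; exact re_add_im s
  have hder : ∀ x ∈ Set.Icc (1:ℝ) 2, ‖deriv χ.LFunction (x + t * I)‖ ≤ C1 * V ^ ε := fun x hx => by
    have := (hz q χ hχ (x + t * I) (by simp; linarith [hx.1])).2
    simpa using this
  -- main reduction
  have main : ∀ η₁ : ℝ, 0 ≤ η₁ → η₁ ≤ s.re - 1 →
      (∀ η : ℝ, 0 < η → η₁ ≤ η → η ≤ 1 → ‖(χ ^ 2).LFunction (1 + η + 2 * I * t)‖ ≤ K * (V ^ ε) ^ 3) →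
      min cA (c3 / 2) * V ^ (-(9 * ε)) ≤ ‖χ.LFunction s‖ := by
    intro η₁ a1 a2 a3
    have key := hcore q χ t η₁ (K * (V ^ ε) ^ 3) (C1 * V ^ ε)
      (one_le_mul_of_one_le_of_one_le hK (one_le_pow₀ hVe))
      (one_le_mul_of_one_le_of_one_le hC1 hVe) a1 (Or.inr hχ) hder a3 (s.re - 1) a2 (by linarith)
    rw [e1] at key
    refine le_trans ?_ key
    calc min cA (c3 / 2) * V ^ (-(9 * ε)) ≤ cA * V ^ (-(9 * ε)) := by
          gcongr; exact min_le_left _ _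
      _ = _ := by
        rw [Real.rpow_neg (by linarith), h9, h3, hcA]
        field_simp
  have him : ∀ η : ℝ, ((1:ℂ) + η + 2 * I * t).im = 2 * t := fun η => by simp
  have hre : ∀ η : ℝ, ((1:ℂ) + η + 2 * I * t).re = 1 + η := fun η => by simp
  by_cases hχ2 : χ ^ 2 = 1
  · -- quadratic
    set ρ : ℝ := κ / ((q:ℝ) ^ ε) ^ 2 with hρ
    have hρ0 : 0 < ρ := by positivity
    have hρ1 : ρ ≤ 1 := by
      rw [hρ, div_le_one (by positivity)]; exact hκ1.trans (one_le_pow₀ hqe)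
    have hM : ∀ η : ℝ, 0 < η → η ≤ 1 → ρ ≤ ‖(1:ℂ) + η + 2 * I * t - 1‖ →
        ‖(χ ^ 2).LFunction (1 + η + 2 * I * t)‖ ≤ K * (V ^ ε) ^ 3 := by
      intro η b1 b2 b3
      rw [hχ2]
      have := htriv q (1 + η + 2 * I * t) (by rw [hre]; linarith) (by rw [hre]; linarith)
        (by intro hh; rw [hh] at b3; simp at b3; linarith)
      rw [him] at this
      refine this.trans ?_
      have g1 : 1 / ‖(1:ℂ) + η + 2 * I * t - 1‖ ≤ 1 / ρ := by gcongr
      have g2 : 1 ≤ 1 / ρ := by rw [le_div_iff₀ hρ0]; linarith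
      have g3 : 1 / ρ ≤ (V ^ ε) ^ 2 / κ := by
        rw [hρ, one_div_div]; gcongr
      calc _ ≤ C2 * (2 * V ^ ε) * (2 * ((V ^ ε) ^ 2 / κ)) := by
            gcongr; linarith
        _ = (4 * C2 / κ) * (V ^ ε) ^ 3 := by ring
        _ ≤ K * (V ^ ε) ^ 3 := by gcongr; linarith
    by_cases c1 : ρ ≤ |t|
    · refine main 0 le_rfl (by linarith) (fun η b1 _ b3 => hM η b1 b3 ?_)
      refine le_trans ?_ (abs_im_le_norm _)
      rw [sub_im, him, one_im, sub_zero, abs_mul, abs_two]; linarith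
    by_cases c2 : ρ ≤ s.re - 1
    · refine main ρ hρ0.le c2 (fun η b1 b2 b3 => hM η b1 b3 ?_)
      refine le_trans ?_ (abs_re_le_norm _)
      rw [sub_re, hre, one_re]; exact le_trans (by linarith) (le_abs_self _)
    push Not at c1 c2
    have hL1 := hsieg q χ hχ2 hχ
    have hdist : ‖s - 1‖ ≤ 2 * ρ := by
      refine (norm_le_abs_re_add_abs_im _).trans ?_
      rw [sub_re, sub_im, one_re, one_im, sub_zero, abs_of_nonneg (by linarith)]
      linarith
    have hlip : ‖χ.LFunction s - χ.LFunction 1‖ ≤ (C1 * (3 * (q:ℝ) ^ ε)) * ‖s - 1‖ := by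
      have hconv : Convex ℝ {z : ℂ | 1 ≤ z.re ∧ |z.im| ≤ 1} := by
        have : {z : ℂ | 1 ≤ z.re ∧ |z.im| ≤ 1} = {z : ℂ | 1 ≤ z.re} ∩ ({z : ℂ | z.im ≤ 1} ∩ {z : ℂ | -1 ≤ z.im}) := by
          ext z; simp only [Set.mem_setOf_eq, Set.mem_inter_iff, abs_le]; tauto
        rw [this]
        exact (convex_halfSpace_re_ge 1).inter ((convex_halfSpace_im_le 1).inter (convex_halfSpace_im_ge (-1)))
      refine hconv.norm_image_sub_le_of_norm_deriv_le (𝕜 := ℂ)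
        (fun z _ => DirichletCharacter.differentiableAt_LFunction _ _ (Or.inr hχ)) ?_ ?_ ?_
      · intro z hz'
        refine (hz q χ hχ z (by linarith [hz'.1])).2.trans ?_
        gcongr
        calc ((q:ℝ) * (|z.im| + 2)) ^ ε ≤ ((q:ℝ) * 3) ^ ε := by
              gcongr; linarith [hz'.2]
          _ = (q:ℝ) ^ ε * 3 ^ ε := Real.mul_rpow (by positivity) (by norm_num)
          _ ≤ (q:ℝ) ^ ε * 3 := by
            gcongr
            calc (3:ℝ) ^ ε ≤ 3 ^ (1:ℝ) := Real.rpow_le_rpow_of_exponent_le (by norm_num) h1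
              _ = 3 := by norm_num
          _ = _ := by ring
      · simp
      · exact ⟨hs1, by linarith⟩
    have hfin : c3 / 2 / (q:ℝ) ^ ε ≤ ‖χ.LFunction s‖ := by
      have n1 : ‖χ.LFunction 1‖ - ‖χ.LFunction s‖ ≤ ‖χ.LFunction s - χ.LFunction 1‖ := by
        rw [norm_sub_rev]; exact norm_sub_norm_le _ _
      have n2 : (C1 * (3 * (q:ℝ) ^ ε)) * ‖s - 1‖ ≤ (c3 / 2) / (q:ℝ) ^ ε := by
        calc _ ≤ (C1 * (3 * (q:ℝ) ^ ε)) * (2 * ρ) := by gcongr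
          _ = (κ * (12 * C1)) / 2 / (q:ℝ) ^ ε := by rw [hρ]; field_simp; ring
          _ ≤ _ := by gcongr
      have n3 : c3 / (q:ℝ) ^ ε ≤ ‖χ.LFunction 1‖ := by rwa [div_le_iff₀ (by positivity)]
      have n4 : c3 / (q:ℝ) ^ ε = c3 / 2 / (q:ℝ) ^ ε + c3 / 2 / (q:ℝ) ^ ε := by ring
      linarith
    refine le_trans ?_ hfin
    rw [Real.rpow_neg (by linarith), h9, ← div_eq_mul_inv]
    have m1 : min cA (c3 / 2) ≤ c3 / 2 := min_le_right _ _
    have m2 : (q:ℝ) ^ ε ≤ (V ^ ε) ^ 9 := hmono.trans (by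
      calc V ^ ε = (V ^ ε) ^ 1 := (pow_one _).symm
        _ ≤ _ := pow_le_pow_right₀ hVe (by norm_num))
    gcongr
  · refine main 0 le_rfl (by linarith) (fun η b1 _ b3 => ?_)
    have := (hz q (χ ^ 2) hχ2 (1 + η + 2 * I * t) (by rw [hre]; linarith)).1
    rw [him] at this
    refine this.trans ?_
    have p3 : V ^ ε ≤ (V ^ ε) ^ 3 := by
      calc V ^ ε = (V ^ ε) ^ 1 := (pow_one _).symm
        _ ≤ _ := pow_le_pow_right₀ hVe (by norm_num)
    calc C1 * ((q:ℝ) * (|2 * t| + 2)) ^ ε ≤ C1 * (2 * V ^ ε) := by gcongr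
      _ = 2 * C1 * V ^ ε := by ring
      _ ≤ K * (V ^ ε) ^ 3 := by
        have : 0 ≤ 4 * C2 / κ := by positivity
        gcongr; linarith

end SW

namespace SW
open Complex Filter Asymptotics Topology

lemma logderiv_W (k : ℕ) {W C1 c r0 : ℝ} (hW : 1 ≤ W) (hC1 : 1 ≤ C1) (hc : 0 < c) (hc1 : c ≤ 1)
    (hr0 : 0 < r0) {g h : ℂ → ℂ} {U : Set ℂ} (hU : IsOpen U) (hg : DifferentiableOn ℂ g U)
    (hh : DifferentiableOn ℂ h U) {s : ℂ} (hs : Metric.closedBall s r0 ⊆ U)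
    (hd : ∀ z ∈ Metric.closedBall s r0, ‖deriv g z‖ ≤ 2 * C1 * W)
    (hhb : ∀ z ∈ Metric.closedBall s r0, ‖h z‖ ≤ 2 * C1 * W)
    (hl : c / W ^ 9 ≤ ‖g s‖) :
    ‖iteratedDeriv k (fun z => -(deriv g z / g z) - h z) s‖ ≤
      k.factorial * (6 * C1 / c) / (min r0 (c / (4 * C1))) ^ k * W ^ (10 * (k + 1)) := by
  set r1 := min r0 (c / (4 * C1)) with hr1
  have hr10 : 0 < r1 := lt_min hr0 (by positivity)
  set r := r1 / W ^ 10 with hr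
  have hrp : 0 < r := by positivity
  have hrr0 : r ≤ r0 := (div_le_self hr10.le (one_le_pow₀ hW)).trans (min_le_left _ _)
  have hsub : Metric.closedBall s r ⊆ Metric.closedBall s r0 := Metric.closedBall_subset_closedBall hrr0
  have hrc : 2 * C1 * W * r ≤ c / W ^ 9 / 2 := by
    have : r1 ≤ c / (4 * C1) := min_le_right _ _
    calc 2 * C1 * W * r ≤ 2 * C1 * W * ((c / (4 * C1)) / W ^ 10) := by rw [hr]; gcongr
      _ = _ := by field_simp; ring
  have hlow : ∀ z ∈ Metric.closedBall s r, c / W ^ 9 / 2 ≤ ‖g z‖ := by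
    intro z hz
    have h1 : ‖g z - g s‖ ≤ 2 * C1 * W * ‖z - s‖ :=
      (convex_closedBall s r).norm_image_sub_le_of_norm_deriv_le (𝕜 := ℂ)
        (fun x hx => (hg x (hs (hsub hx))).differentiableAt (hU.mem_nhds (hs (hsub hx))))
        (fun x hx => hd x (hsub hx)) (Metric.mem_closedBall_self hrp.le) hz
    have h2 : ‖z - s‖ ≤ r := by rwa [← dist_eq_norm]
    have h3 : 2 * C1 * W * ‖z - s‖ ≤ 2 * C1 * W * r := by gcongr
    have h4 : ‖g s‖ - ‖g z‖ ≤ ‖g z - g s‖ := by rw [norm_sub_rev]; exact norm_sub_norm_le _ _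
    linarith
  have hcW : 0 < c / W ^ 9 / 2 := by positivity
  have hne : ∀ z ∈ Metric.closedBall s r, g z ≠ 0 := fun z hz h0 => by
    have := hlow z hz
    rw [h0, norm_zero] at this; linarith
  have hdiff : DiffContOnCl ℂ (fun z => -(deriv g z / g z) - h z) (Metric.ball s r) := by
    apply DifferentiableOn.diffContOnCl
    rw [closure_ball s hrp.ne']
    refine DifferentiableOn.sub (DifferentiableOn.neg (DifferentiableOn.div ?_ ?_ hne)) ?_
    · exact (hg.deriv hU).mono (hsub.trans hs)
    · exact hg.mono (hsub.trans hs)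
    · exact hh.mono (hsub.trans hs)
  have hb := norm_iteratedDeriv_le_of_forall_mem_sphere_norm_le (C := 6 * C1 / c * W ^ 10) k hrp hdiff ?_
  · refine hb.trans (le_of_eq ?_)
    rw [hr, div_pow, ← pow_mul, show 10 * (k + 1) = 10 + 10 * k by ring, pow_add]
    field_simp
  · intro z hz
    have hz' : z ∈ Metric.closedBall s r := Metric.sphere_subset_closedBall hz
    refine (norm_sub_le _ _).trans ?_
    rw [norm_neg, norm_div]
    have a1 : ‖deriv g z‖ / ‖g z‖ ≤ (2 * C1 * W) / (c / W ^ 9 / 2) :=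
      div_le_div₀ (by positivity) (hd z (hsub hz')) hcW (hlow z hz')
    have a2 : (2 * C1 * W) / (c / W ^ 9 / 2) = 4 * C1 / c * W ^ 10 := by field_simp; ring
    have a3 : 2 * C1 * W ≤ 2 * C1 / c * W ^ 10 := by
      have b1 : W ≤ W ^ 10 := by
        calc W = W ^ 1 := (pow_one _).symm
          _ ≤ _ := pow_le_pow_right₀ hW (by norm_num)
      have b2 : 2 * C1 ≤ 2 * C1 / c := by rw [le_div_iff₀ hc]; nlinarith
      gcongr
    have a4 : 6 * C1 / c * W ^ 10 = 4 * C1 / c * W ^ 10 + 2 * C1 / c * W ^ 10 := by ring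
    linarith [hhb z (hsub hz')]

lemma rpow_V_aux {δ V : ℝ} (hV : 1 ≤ V) (k : ℕ) :
    (V ^ (δ / (10 * (k + 1)))) ^ (10 * (k + 1)) = V ^ δ := by
  rw [← Real.rpow_natCast, ← Real.rpow_mul (by linarith)]
  congr 1; push_cast; field_simp

lemma eps_aux {δ : ℝ} (h0 : 0 < δ) (h1 : δ ≤ 1) (k : ℕ) :
    0 < δ / (10 * ((k:ℝ) + 1)) ∧ δ / (10 * ((k:ℝ) + 1)) ≤ 1 := by
  have : (0:ℝ) ≤ k := Nat.cast_nonneg k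
  refine ⟨by positivity, ?_⟩
  rw [div_le_one (by positivity)]; linarith

lemma im_ball {s z : ℂ} {r : ℝ} (hz : z ∈ Metric.closedBall s r) :
    |z.re - s.re| ≤ r ∧ |z.im - s.im| ≤ r := by
  have h : ‖z - s‖ ≤ r := by rwa [← dist_eq_norm]
  exact ⟨by rw [← sub_re]; exact (abs_re_le_norm _).trans h, by rw [← sub_im]; exact (abs_im_le_norm _).trans h⟩

lemma rpow_two_mul {ε x y : ℝ} (h0 : 0 < ε) (h1 : ε ≤ 1) (hx : 0 ≤ x) (hxy : x ≤ 2 * y) :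
    x ^ ε ≤ 2 * y ^ ε := by
  have hy : 0 ≤ y := by linarith
  calc x ^ ε ≤ (2 * y) ^ ε := Real.rpow_le_rpow hx hxy h0.le
    _ = 2 ^ ε * y ^ ε := Real.mul_rpow (by norm_num) hy
    _ ≤ _ := by
      gcongr
      calc (2:ℝ) ^ ε ≤ 2 ^ (1:ℝ) := Real.rpow_le_rpow_of_exponent_le (by norm_num) h1
        _ = 2 := by norm_num

lemma L_logderiv_iter (k : ℕ) {δ : ℝ} (h0 : 0 < δ) (h1 : δ ≤ 1) :
    ∃ C : ℝ, 0 < C ∧ ∀ (q : ℕ) [NeZero q] (χ : DirichletCharacter ℂ q), χ ≠ 1 → ∀ (s : ℂ),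
      1 ≤ s.re → s.re ≤ 2 →
      ‖iteratedDeriv k (fun z => -(deriv χ.LFunction z / χ.LFunction z)) s‖
        ≤ C * ((q:ℝ) * (|s.im| + 2)) ^ δ := by
  obtain ⟨he0, he1⟩ := eps_aux h0 h1 k
  set ε := δ / (10 * ((k:ℝ) + 1)) with hε
  obtain ⟨c, hc, hlow⟩ := L_lower he0 he1
  obtain ⟨C1, hC1, hz⟩ := LFunction_deriv_bound he0 he1
  refine ⟨k.factorial * (6 * C1 / (min c 1)) / (min (ε / 4) ((min c 1) / (4 * C1))) ^ k, by positivity,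
    fun q _ χ hχ s hs1 hs2 => ?_⟩
  have hq : (1:ℝ) ≤ q := by exact_mod_cast NeZero.one_le
  have hV0 : 1 ≤ (q:ℝ) * (|s.im| + 2) := by nlinarith [abs_nonneg s.im]
  set V := (q:ℝ) * (|s.im| + 2) with hV
  have hW : 1 ≤ V ^ ε := Real.one_le_rpow hV0 he0.le
  have key := logderiv_W k (W := V ^ ε) (C1 := C1) (c := min c 1) (r0 := ε / 4) (g := χ.LFunction) (h := fun _ => 0)
    (U := Set.univ) (s := s) hW hC1 (by positivity) (min_le_right _ _) (by positivity) isOpen_univ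
    (fun z _ => (DirichletCharacter.differentiableAt_LFunction _ _ (Or.inr hχ)).differentiableWithinAt)
    (differentiableOn_const _) (Set.subset_univ _) ?_ ?_ ?_
  · simp only [sub_zero] at key
    refine key.trans (le_of_eq ?_)
    rw [hε, rpow_V_aux hV0 k]
  · intro z hzb
    obtain ⟨i1, i2⟩ := im_ball hzb
    rw [abs_le] at i1
    refine (hz q χ hχ z (by linarith)).2.trans ?_
    have j1 : |z.im| ≤ |s.im| + 1 := by
      have := abs_sub_abs_le_abs_sub z.im s.im
      linarith
    have j2 : ((q:ℝ) * (|z.im| + 2)) ^ ε ≤ 2 * V ^ ε := by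
      refine rpow_two_mul he0 he1 (by positivity) ?_
      rw [hV]; nlinarith [abs_nonneg s.im]
    calc _ ≤ C1 * (2 * V ^ ε) := by gcongr
      _ = _ := by ring
  · intro z _; simp; positivity
  · refine le_trans ?_ (hlow q χ hχ s hs1 hs2)
    rw [Real.rpow_neg (by linarith), div_eq_mul_inv]
    have : V ^ (9 * ε) = (V ^ ε) ^ 9 := by
      rw [mul_comm, Real.rpow_mul (by linarith)]; norm_cast
    rw [this]
    gcongr
    exact min_le_left _ _

lemma zeta_logderiv_high (k : ℕ) {δ : ℝ} (h0 : 0 < δ) (h1 : δ ≤ 1) :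
    ∃ C : ℝ, 0 < C ∧ ∀ (s : ℂ), 1 ≤ s.re → s.re ≤ 2 → 2 ≤ |s.im| →
      ‖iteratedDeriv k (fun z => -(deriv riemannZeta z / riemannZeta z) - riemannZeta z) s‖
        ≤ C * (|s.im| + 2) ^ δ := by
  obtain ⟨he0, he1⟩ := eps_aux h0 h1 k
  set ε := δ / (10 * ((k:ℝ) + 1)) with hε
  obtain ⟨c, hc, hlow⟩ := zeta_lower he0 he1
  obtain ⟨C1, hC1, hz⟩ := zeta_deriv_bound he0 he1
  refine ⟨k.factorial * (6 * C1 / (min c 1)) / (min (ε / 4) ((min c 1) / (4 * C1))) ^ k, by positivity,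
    fun s hs1 hs2 ht => ?_⟩
  have hV0 : 1 ≤ |s.im| + 2 := by linarith
  set V := |s.im| + 2 with hV
  have hW : 1 ≤ V ^ ε := Real.one_le_rpow hV0 he0.le
  have hball : ∀ z ∈ Metric.closedBall s (ε / 4), 1 - ε / 4 ≤ z.re ∧ 3 / 2 ≤ |z.im| ∧
      (|z.im| + 2) ^ ε ≤ 2 * V ^ ε := by
    intro z hzb
    obtain ⟨i1, i2⟩ := im_ball hzb
    rw [abs_le] at i1
    have j1 := abs_sub_abs_le_abs_sub z.im s.im
    have j2 := abs_sub_abs_le_abs_sub s.im z.im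
    rw [abs_sub_comm] at j2
    refine ⟨by linarith, by linarith, rpow_two_mul he0 he1 (by positivity) ?_⟩
    linarith
  have hdz : DifferentiableOn ℂ riemannZeta {1}ᶜ := fun z hz' =>
    (differentiableAt_riemannZeta hz').differentiableWithinAt
  have key := logderiv_W k (W := V ^ ε) (C1 := C1) (c := min c 1) (r0 := ε / 4) (g := riemannZeta) (h := riemannZeta)
    (U := {1}ᶜ) (s := s) hW hC1 (by positivity) (min_le_right _ _) (by positivity) isOpen_compl_singleton
    hdz hdz ?_ ?_ ?_ ?_
  · refine key.trans (le_of_eq ?_)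
    rw [hε, rpow_V_aux hV0 k]
  · intro z hzb h1
    have := (hball z hzb).2.1
    rw [h1] at this
    norm_num at this
  · intro z hzb
    obtain ⟨a1, a2, a3⟩ := hball z hzb
    refine (hz z a1 a2).2.trans ?_
    calc _ ≤ C1 * (2 * V ^ ε) := by gcongr
      _ = _ := by ring
  · intro z hzb
    obtain ⟨a1, a2, a3⟩ := hball z hzb
    refine (hz z a1 a2).1.trans ?_
    calc _ ≤ C1 * (2 * V ^ ε) := by gcongr
      _ = _ := by ring
  · refine le_trans ?_ (hlow s hs1 hs2 (by linarith))
    rw [Real.rpow_neg (by linarith), div_eq_mul_inv]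
    have : (V ^ ε) ^ 9 = V ^ (9 * ε) := by
      rw [mul_comm, Real.rpow_mul (by linarith)]; norm_cast
    rw [this]
    have h79 : V ^ (7 * ε) ≤ V ^ (9 * ε) := Real.rpow_le_rpow_of_exponent_le hV0 (by linarith)
    have : (0:ℝ) < V ^ (7 * ε) := by positivity
    gcongr
    exact min_le_left _ _

lemma zeta_logderiv_iter (k : ℕ) {δ : ℝ} (h0 : 0 < δ) (h1 : δ ≤ 1) :
    ∃ C : ℝ, 0 < C ∧ ∀ (s : ℂ), 1 < s.re → s.re ≤ 2 →
      ‖iteratedDeriv k (fun z => -(deriv riemannZeta z / riemannZeta z) - riemannZeta z) s‖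
        ≤ C * (|s.im| + 2) ^ δ := by
  obtain ⟨C, hC, hhigh⟩ := zeta_logderiv_high k h0 h1
  set G : ℂ → ℂ := fun z => -(deriv Zf z / Zf z) - dslope Zf 1 z with hG
  set U : Set ℂ := {z | Zf z ≠ 0} with hU
  have hUo : IsOpen U := isOpen_ne_fun Zf_differentiable.continuous continuous_const
  have hGd : DifferentiableOn ℂ G U := by
    refine DifferentiableOn.sub (DifferentiableOn.neg (DifferentiableOn.div ?_ ?_ fun z hz => hz)) ?_
    · exact (Zf_differentiable.differentiableOn.deriv isOpen_univ).mono (Set.subset_univ _)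
    · exact Zf_differentiable.differentiableOn
    · exact ((differentiableOn_dslope (c := 1) (s := Set.univ) univ_mem).2 Zf_differentiable.differentiableOn).mono
        (Set.subset_univ _)
  have hGan : AnalyticOnNhd ℂ G U := hGd.analyticOnNhd hUo
  obtain ⟨C2, hC2, hb⟩ := exists_bound_rect (g := iteratedDeriv k G) 1 2 (-2) 2 (by
    intro z hz
    have := (hGan z (Zf_ne_zero hz.1.1)).iterated_deriv k
    rw [← iteratedDeriv_eq_iterate] at this
    exact this.continuousAt.continuousWithinAt)
  refine ⟨max C C2, by positivity, fun s hs1 hs2 => ?_⟩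
  have hV : 1 ≤ (|s.im| + 2) ^ δ := Real.one_le_rpow (by linarith [abs_nonneg s.im]) h0.le
  rcases le_total 2 |s.im| with ht | ht
  · refine (hhigh s hs1.le hs2 ht).trans ?_
    gcongr; exact le_max_left _ _
  · have heq : (fun z => -(deriv riemannZeta z / riemannZeta z) - riemannZeta z) =ᶠ[𝓝 s] G := by
      have ho : IsOpen {z : ℂ | 1 < z.re} := isOpen_lt continuous_const continuous_re
      filter_upwards [ho.mem_nhds hs1] with z hz
      have hz : 1 < z.re := hz
      have hz1 : z ≠ 1 := by intro h; rw [h] at hz; simp at hz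
      have hz2 : z - 1 ≠ 0 := sub_ne_zero.2 hz1
      have hzz : riemannZeta z ≠ 0 := riemannZeta_ne_zero_of_one_le_re hz.le
      have hZd : deriv Zf z = riemannZeta z + (z - 1) * deriv riemannZeta z := by
        have e1 : Zf =ᶠ[𝓝 z] fun w => (w - 1) * riemannZeta w := by
          filter_upwards [isOpen_compl_singleton.mem_nhds hz1] with w hw using Zf_of_ne hw
        rw [e1.deriv_eq]
        have := (((hasDerivAt_id z).sub_const 1).mul (differentiableAt_riemannZeta hz1).hasDerivAt).deriv
        have e2 : ((id - fun _ => (1:ℂ)) * riemannZeta : ℂ → ℂ) = fun w => (w - 1) * riemannZeta w := rfl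
        refine Eq.trans ?_ (this.trans ?_)
        · rfl
        · simp
      simp only [hG]
      rw [dslope_of_ne _ hz1, slope_def_field, Zf_one, hZd, Zf_of_ne hz1]
      field_simp
      ring
    rw [heq.iteratedDeriv_eq]
    rw [abs_le] at ht
    refine (hb s ⟨hs1.le, hs2⟩ ht).trans ?_
    have : C2 ≤ max C C2 := le_max_right _ _
    nlinarith

end SW

namespace SW
open Complex Filter Asymptotics Topology

lemma hasMellin_cesaro {s : ℂ} (hs : 0 < s.re) :
    HasMellin (fun t : ℝ => (Set.indicator (Set.Ioc 0 1) (fun _ => 1 : ℝ → ℂ)) t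
      - (Set.indicator (Set.Ioc 0 1) (fun t => ↑t ^ (1:ℂ) : ℝ → ℂ)) t) s (s * (s + 1))⁻¹ := by
  have h1 := hasMellin_one_Ioc hs
  have h2 := hasMellin_cpow_Ioc 1 (s := s) (by simp; linarith)
  have h3 := hasMellin_sub h1.1 h2.1
  rw [h1.2, h2.2] at h3
  have e1 : s ≠ 0 := by intro h; rw [h] at hs; simp at hs
  have e2 : s + 1 ≠ 0 := by
    intro h; have := congrArg Complex.re h; simp at this; linarith
  have e3 : (s * (s + 1))⁻¹ = 1 / s - 1 / (s + 1) := by field_simp; ring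
  rw [e3]
  exact h3

lemma kern_norm {c : ℝ} (hc : 1 ≤ c) (t : ℝ) :
    ‖(((c:ℂ) + t * I) * ((c:ℂ) + t * I + 1))⁻¹‖ ≤ (1 + t ^ 2)⁻¹ := by
  rw [norm_inv, norm_mul]
  apply inv_anti₀ (by positivity)
  have e : ∀ d : ℝ, 1 ≤ d → Real.sqrt (1 + t ^ 2) ≤ ‖(d:ℂ) + t * I‖ := fun d hd => by
    rw [norm_add_mul_I]
    apply Real.sqrt_le_sqrt
    nlinarith
  have h1 := e c hc
  have h2 := e (c + 1) (by linarith)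
  have h3 : (((c + 1 : ℝ) : ℂ) + t * I) = (c:ℂ) + t * I + 1 := by push_cast; ring
  rw [h3] at h2
  calc 1 + t ^ 2 = Real.sqrt (1 + t ^ 2) * Real.sqrt (1 + t ^ 2) := (Real.mul_self_sqrt (by positivity)).symm
    _ ≤ _ := by gcongr

lemma kern_ne {c : ℝ} (hc : 1 ≤ c) (t : ℝ) : ((c:ℂ) + t * I) * ((c:ℂ) + t * I + 1) ≠ 0 := by
  have e : ∀ d : ℝ, 1 ≤ d → (d:ℂ) + t * I ≠ 0 := fun d hd h => by
    have := congrArg Complex.re h; simp at this; linarith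
  have h3 : (((c + 1 : ℝ) : ℂ) + t * I) = (c:ℂ) + t * I + 1 := by push_cast; ring
  exact mul_ne_zero (e c hc) (h3 ▸ e (c + 1) (by linarith))

lemma kern_cont {c : ℝ} (hc : 1 ≤ c) :
    Continuous (fun t : ℝ => (((c:ℂ) + t * I) * ((c:ℂ) + t * I + 1))⁻¹) := by
  apply Continuous.inv₀ (by fun_prop) (kern_ne hc)

lemma kern_int {c : ℝ} (hc : 1 ≤ c) :
    Integrable (fun t : ℝ => (((c:ℂ) + t * I) * ((c:ℂ) + t * I + 1))⁻¹) :=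
  integrable_inv_one_add_sq.mono' (kern_cont hc).aestronglyMeasurable
    (Eventually.of_forall (kern_norm hc))

lemma kern_perron {c : ℝ} (hc : 1 ≤ c) {y : ℝ} (hy : 0 < y) :
    (1 / (2 * Real.pi) : ℂ) * ∫ t : ℝ, (y:ℂ) ^ (-((c:ℂ) + t * I)) * (((c:ℂ) + t * I) * ((c:ℂ) + t * I + 1))⁻¹
      = ((max 0 (1 - y) : ℝ) : ℂ) := by
  set g : ℝ → ℂ := fun t : ℝ => (Set.indicator (Set.Ioc 0 1) (fun _ => 1 : ℝ → ℂ)) t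
      - (Set.indicator (Set.Ioc 0 1) (fun t => ↑t ^ (1:ℂ) : ℝ → ℂ)) t with hg
  have hgv : ∀ t : ℝ, 0 < t → g t = ((max 0 (1 - t) : ℝ) : ℂ) := by
    intro t ht
    simp only [hg, cpow_one]
    by_cases h : t ≤ 1
    · have hm : t ∈ Set.Ioc (0:ℝ) 1 := ⟨ht, h⟩
      rw [Set.indicator_of_mem hm, Set.indicator_of_mem hm, max_eq_right (by linarith)]
      push_cast; ring
    · have hm : t ∉ Set.Ioc (0:ℝ) 1 := fun hh => h hh.2
      rw [Set.indicator_of_notMem hm, Set.indicator_of_notMem hm,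
        max_eq_left (by linarith)]
      simp
  have hm : ∀ t : ℝ, mellin g ((c:ℂ) + t * I) = (((c:ℂ) + t * I) * ((c:ℂ) + t * I + 1))⁻¹ := fun t =>
    (hasMellin_cesaro (s := (c:ℂ) + t * I) (by simp; linarith)).2
  have h1 := mellinInv_mellin_eq c g hy ?_ ?_ ?_
  · rw [hgv y hy, mellinInv] at h1
    rw [← h1]
    simp only [hm, smul_eq_mul, real_smul]
    congr 1
    push_cast; rfl
  · exact (hasMellin_cesaro (s := (c:ℂ)) (by simp; linarith)).1
  · simp only [VerticalIntegrable, hm]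
    exact kern_int hc
  · have : ContinuousAt (fun t : ℝ => ((max 0 (1 - t) : ℝ) : ℂ)) y := by fun_prop
    refine this.congr ?_
    filter_upwards [lt_mem_nhds hy] with t ht using (hgv t ht).symm

lemma perron_cesaro (b : ℕ → ℂ) {c x : ℝ} (hc : 1 ≤ c) (hx : 0 < x) (hs : LSeriesSummable b c) :
    ∑ n ∈ Finset.Ioc 0 ⌊x⌋₊, b n * ((1 - n / x : ℝ) : ℂ) =
      (1 / (2 * Real.pi) : ℂ) * ∫ t : ℝ, (x:ℂ) ^ ((c:ℂ) + t * I) * (((c:ℂ) + t * I) * ((c:ℂ) + t * I + 1))⁻¹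
        * LSeries b ((c:ℂ) + t * I) := by
  set k : ℝ → ℂ := fun t : ℝ => (((c:ℂ) + t * I) * ((c:ℂ) + t * I + 1))⁻¹ with hk
  set F : ℕ → ℝ → ℂ := fun n t => (x:ℂ) ^ ((c:ℂ) + t * I) * k t * LSeries.term b ((c:ℂ) + t * I) n with hF
  have hxc : (x:ℂ) ≠ 0 := by exact_mod_cast hx.ne'
  have hnormF : ∀ n t, ‖F n t‖ = x ^ c * ‖LSeries.term b c n‖ * ‖k t‖ := by
    intro n t
    simp only [hF, norm_mul]
    rw [norm_cpow_eq_rpow_re_of_pos hx, LSeries.norm_term_eq, LSeries.norm_term_eq]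
    simp only [add_re, ofReal_re, mul_re, I_re, mul_zero, ofReal_im, I_im, mul_one, sub_self, add_zero]
    ring
  have hcontF : ∀ n, Continuous (F n) := by
    intro n
    simp only [hF]
    refine Continuous.mul (Continuous.mul ?_ (kern_cont hc)) ?_
    · exact Continuous.const_cpow (by fun_prop) (Or.inl hxc)
    · rcases eq_or_ne n 0 with h | h
      · simp only [h, LSeries.term_zero]; fun_prop
      · simp only [LSeries.term_of_ne_zero h]
        have hn : (n:ℂ) ≠ 0 := by exact_mod_cast h
        refine Continuous.div continuous_const (Continuous.const_cpow (by fun_prop) (Or.inl hn)) ?_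
        intro t; rw [Ne, cpow_eq_zero_iff]; tauto
  have hFint : ∀ n, Integrable (F n) := by
    intro n
    refine Integrable.mono' (((kern_int hc).norm).const_mul (x ^ c * ‖LSeries.term b c n‖))
      (hcontF n).aestronglyMeasurable (Eventually.of_forall fun t => (hnormF n t).le)
  have hFsum : Summable fun n => ∫ t, ‖F n t‖ := by
    simp only [hnormF]
    simp_rw [integral_const_mul]
    exact (Summable.mul_left _ (Summable.norm hs)).mul_right _
  have hsum := hasSum_integral_of_summable_integral_norm hFint hFsum
  have hval : ∀ n : ℕ, (1 / (2 * Real.pi) : ℂ) * ∫ t, F n t =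
      if n = 0 then 0 else b n * ((max 0 (1 - n / x) : ℝ) : ℂ) := by
    intro n
    rcases eq_or_ne n 0 with h | h
    · simp [hF, h, LSeries.term_zero]
    · rw [if_neg h, ← kern_perron hc (y := n / x) (by positivity)]
      rw [mul_left_comm, ← integral_const_mul (b n)]
      congr 1
      refine integral_congr_ae (Eventually.of_forall fun t => ?_)
      simp only [hF, LSeries.term_of_ne_zero h]
      have e1 : (((n / x : ℝ) : ℂ)) ^ (-((c:ℂ) + t * I)) = (x:ℂ) ^ ((c:ℂ) + t * I) / (n:ℂ) ^ ((c:ℂ) + t * I) := by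
        have : (n / x : ℝ) = (x / n)⁻¹ := by rw [inv_div]
        rw [this, ofReal_inv, cpow_neg, inv_cpow, inv_inv]
        · rw [div_eq_mul_inv, ofReal_mul, mul_cpow_ofReal_nonneg hx.le (by positivity), ofReal_inv, inv_cpow]
          · rfl
          · rw [ofReal_natCast, natCast_arg]; exact Real.pi_pos.ne
        · rw [arg_ofReal_of_nonneg (by positivity)]; exact Real.pi_pos.ne
      rw [e1]; ring
  have h2 := (hsum.mul_left (1 / (2 * Real.pi) : ℂ))
  simp only [hval] at h2
  have h3 : ∀ t, ∑' n, F n t = (x:ℂ) ^ ((c:ℂ) + t * I) * k t * LSeries b ((c:ℂ) + t * I) := fun t => by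
    simp only [hF]; rw [tsum_mul_left]; rfl
  simp only [h3] at h2
  rw [← h2.tsum_eq, tsum_eq_sum (s := Finset.Ioc 0 ⌊x⌋₊)]
  · refine Finset.sum_congr rfl fun n hn => ?_
    rw [Finset.mem_Ioc] at hn
    rw [if_neg (by omega), max_eq_right]
    have : (n:ℝ) ≤ x := (Nat.le_floor_iff hx.le).1 hn.2
    rw [sub_nonneg, div_le_one hx]; exact this
  · intro n hn
    split_ifs with h
    · rfl
    · rw [Finset.mem_Ioc, not_and_or] at hn
      have h4 : x < n := by
        by_contra hh
        push Not at hh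
        have := (Nat.le_floor_iff hx.le).2 hh
        omega
      rw [max_eq_left]; · simp
      rw [sub_nonpos, le_div_iff₀ hx]; linarith

lemma cesaro_bound : ∃ C : ℝ, 0 < C ∧ ∀ (b : ℕ → ℂ) (M : ℝ), 0 ≤ M →
    (∀ s : ℂ, 1 < s.re → LSeriesSummable b s) →
    (∀ s : ℂ, 1 < s.re → s.re ≤ 2 → ‖LSeries b s‖ ≤ M * (|s.im| + 2) ^ (1 / 2 : ℝ)) →
    ∀ x : ℝ, 3 ≤ x → ‖∑ n ∈ Finset.Ioc 0 ⌊x⌋₊, b n * ((1 - n / x : ℝ) : ℂ)‖ ≤ C * M * x := by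
  have hIntg : Integrable fun t : ℝ => ((1:ℝ) + ‖t‖ ^ 2) ^ (-(3 / 2 : ℝ) / 2) :=
    integrable_rpow_neg_one_add_norm_sq (by simp; norm_num)
  set J := ∫ t : ℝ, ((1:ℝ) + ‖t‖ ^ 2) ^ (-(3 / 2 : ℝ) / 2) with hJ
  have hJ0 : 0 ≤ J := integral_nonneg fun t => by positivity
  refine ⟨2 * Real.exp 1 * (J + 1), by positivity, fun b M hM hs hb x hx => ?_⟩
  have hlog : 1 < Real.log x := by
    rw [Real.lt_log_iff_exp_lt (by linarith)]
    linarith [Real.exp_one_lt_d9]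
  set c := 1 + 1 / Real.log x with hcd
  have hc1 : 1 < c := by have : 0 < 1 / Real.log x := by positivity
                         linarith
  have hc2 : c ≤ 2 := by
    have : 1 / Real.log x ≤ 1 := by rw [div_le_one (by linarith)]; linarith
    linarith
  have hxc : x ^ c = Real.exp 1 * x := by
    rw [hcd, Real.rpow_add (by linarith), Real.rpow_one, Real.rpow_def_of_pos (by linarith), mul_one_div,
      div_self (by linarith)]
    ring
  rw [perron_cesaro b hc1.le (by linarith) (hs c (by simpa using hc1)), norm_mul]
  have e1 : ‖(1 / (2 * Real.pi) : ℂ)‖ ≤ 1 := by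
    rw [norm_div, norm_mul, norm_one, norm_real, Real.norm_eq_abs, abs_of_pos Real.pi_pos]
    simp only [Complex.norm_ofNat]
    rw [div_le_one (by positivity)]
    linarith [Real.pi_gt_three]
  have e2 : ‖∫ t : ℝ, (x:ℂ) ^ ((c:ℂ) + t * I) * (((c:ℂ) + t * I) * ((c:ℂ) + t * I + 1))⁻¹
        * LSeries b ((c:ℂ) + t * I)‖ ≤ ∫ t : ℝ, (2 * M * (Real.exp 1 * x)) * ((1:ℝ) + ‖t‖ ^ 2) ^ (-(3 / 2 : ℝ) / 2) := by
    refine norm_integral_le_of_norm_le (hIntg.const_mul _) (Eventually.of_forall fun t => ?_)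
    rw [norm_mul, norm_mul, norm_cpow_eq_rpow_re_of_pos (by linarith)]
    have r1 : ((c:ℂ) + t * I).re = c := by simp
    have r2 : ((c:ℂ) + t * I).im = t := by simp
    have k1 := kern_norm hc1.le t
    have k2 := hb ((c:ℂ) + t * I) (by rw [r1]; exact hc1) (by rw [r1]; exact hc2)
    rw [r2] at k2
    rw [r1, hxc]
    have k3 : (|t| + 2) ^ (1 / 2 : ℝ) ≤ 2 * (1 + t ^ 2) ^ (1 / 4 : ℝ) := by
      have : |t| + 2 ≤ 4 * (1 + t ^ 2) ^ (1 / 2 : ℝ) := by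
        rw [← Real.sqrt_eq_rpow]
        have s0 := Real.sqrt_nonneg (1 + t ^ 2)
        have s1 : |t| ≤ Real.sqrt (1 + t ^ 2) := by
          rw [← Real.sqrt_sq_eq_abs]; exact Real.sqrt_le_sqrt (by linarith)
        have s2 : 1 ≤ Real.sqrt (1 + t ^ 2) := by
          rw [Real.one_le_sqrt]; nlinarith
        linarith
      calc (|t| + 2) ^ (1 / 2 : ℝ) ≤ (4 * (1 + t ^ 2) ^ (1 / 2 : ℝ)) ^ (1 / 2 : ℝ) := by
            gcongr
        _ = 4 ^ (1 / 2 : ℝ) * ((1 + t ^ 2) ^ (1 / 2 : ℝ)) ^ (1 / 2 : ℝ) := Real.mul_rpow (by norm_num) (by positivity)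
        _ = _ := by
          rw [← Real.rpow_mul (by positivity)]
          congr 1
          · rw [show (4:ℝ) = 2 ^ (2:ℝ) by norm_num, ← Real.rpow_mul (by norm_num)]; norm_num
          · norm_num
    have k4 : (1 + t ^ 2)⁻¹ * (1 + t ^ 2) ^ (1 / 4 : ℝ) = ((1:ℝ) + ‖t‖ ^ 2) ^ (-(3 / 2 : ℝ) / 2) := by
      rw [Real.norm_eq_abs, sq_abs, ← Real.rpow_neg_one, ← Real.rpow_add (by positivity)]
      norm_num
    calc Real.exp 1 * x * ‖(((c:ℂ) + t * I) * ((c:ℂ) + t * I + 1))⁻¹‖ * ‖LSeries b ((c:ℂ) + t * I)‖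
        ≤ Real.exp 1 * x * (1 + t ^ 2)⁻¹ * (M * (2 * (1 + t ^ 2) ^ (1 / 4 : ℝ))) := by
          refine mul_le_mul ?_ (k2.trans ?_) (norm_nonneg _) (by positivity)
          · gcongr
          · gcongr
      _ = (2 * M * (Real.exp 1 * x)) * ((1 + t ^ 2)⁻¹ * (1 + t ^ 2) ^ (1 / 4 : ℝ)) := by ring
      _ = _ := by rw [k4]
  rw [integral_const_mul] at e2
  calc _ ≤ 1 * ((2 * M * (Real.exp 1 * x)) * J) := mul_le_mul e1 e2 (norm_nonneg _) zero_le_one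
    _ = 2 * Real.exp 1 * J * M * x := by ring
    _ ≤ _ := by gcongr; linarith

end SW

namespace SW
open Complex Filter Asymptotics Topology

lemma abel_bound (b : ℕ → ℂ) (w : ℕ → ℝ) (m N : ℕ) (E : ℝ) (hE : 0 ≤ E)
    (hw : ∀ n, m < n → n < N → w (n + 1) ≤ w n) (hw0 : ∀ n, m < n → 0 ≤ w n)
    (hD : ∀ j, m ≤ j → j ≤ N → ‖∑ n ∈ Finset.Ioc m j, b n‖ ≤ E) :
    ‖∑ n ∈ Finset.Ioc m N, b n * (w n : ℂ)‖ ≤ E * w (m + 1) := by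
  rcases le_or_gt N m with h | h
  · rw [Finset.Ioc_eq_empty (by omega)]
    simp; exact mul_nonneg hE (hw0 _ (by omega))
  have key : ∀ j, m + 1 ≤ j → j ≤ N →
      ‖∑ n ∈ Finset.Ioc m j, b n * (w n : ℂ) - w j * ∑ n ∈ Finset.Ioc m j, b n‖ ≤ E * (w (m + 1) - w j) := by
    intro j hj
    induction j, hj using Nat.le_induction with
    | base => intro _; simp [mul_comm]
    | succ j hj ih =>
      intro hjN
      have ih := ih (by omega)
      rw [Finset.sum_Ioc_succ_top (by omega), Finset.sum_Ioc_succ_top (by omega)]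
      have e1 : ∑ n ∈ Finset.Ioc m j, b n * (w n : ℂ) + b (j + 1) * (w (j + 1) : ℂ)
          - w (j + 1) * (∑ n ∈ Finset.Ioc m j, b n + b (j + 1)) =
          (∑ n ∈ Finset.Ioc m j, b n * (w n : ℂ) - w j * ∑ n ∈ Finset.Ioc m j, b n)
          + ((w j - w (j + 1) : ℝ) : ℂ) * ∑ n ∈ Finset.Ioc m j, b n := by push_cast; ring
      rw [e1]
      refine (norm_add_le _ _).trans ?_
      rw [norm_mul, norm_real, Real.norm_eq_abs, abs_of_nonneg (by linarith [hw j (by omega) (by omega)])]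
      have := mul_le_mul_of_nonneg_left (hD j (by omega) (by omega))
        (by linarith [hw j (by omega) (by omega)] : 0 ≤ w j - w (j + 1))
      linarith
  have h1 := key N h le_rfl
  have h2 := hD N h.le le_rfl
  have h3 : ‖(w N : ℂ) * ∑ n ∈ Finset.Ioc m N, b n‖ ≤ w N * E := by
    rw [norm_mul, norm_real, Real.norm_eq_abs, abs_of_nonneg (hw0 N h)]
    exact mul_le_mul_of_nonneg_left h2 (hw0 N h)
  calc _ = ‖(∑ n ∈ Finset.Ioc m N, b n * (w n : ℂ) - w N * ∑ n ∈ Finset.Ioc m N, b n)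
        + w N * ∑ n ∈ Finset.Ioc m N, b n‖ := by rw [sub_add_cancel]
    _ ≤ _ := norm_add_le _ _
    _ ≤ _ := by linarith

lemma unsmooth (b : ℕ → ℂ) {K Bm x h : ℝ} (hK : 0 ≤ K) (hB : 0 ≤ Bm) (hx : 3 ≤ x) (h1 : 1 ≤ h) (h2 : h ≤ x)
    (hb : ∀ n : ℕ, 0 < n → (n:ℝ) ≤ 2 * x → ‖b n‖ ≤ Bm)
    (hces : ∀ y : ℝ, 3 ≤ y → ‖∑ n ∈ Finset.Ioc 0 ⌊y⌋₊, b n * ((1 - n / y : ℝ) : ℂ)‖ ≤ K * y) :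
    ‖∑ n ∈ Finset.Ioc 0 ⌊x⌋₊, b n‖ ≤ 5 * K * x ^ 2 / h + 2 * h * Bm := by
  have hT : ∀ y : ℝ, 3 ≤ y → ‖∑ n ∈ Finset.Ioc 0 ⌊y⌋₊, b n * ((y - n : ℝ) : ℂ)‖ ≤ K * y ^ 2 := by
    intro y hy
    have e : ∑ n ∈ Finset.Ioc 0 ⌊y⌋₊, b n * ((y - n : ℝ) : ℂ) =
        y * ∑ n ∈ Finset.Ioc 0 ⌊y⌋₊, b n * ((1 - n / y : ℝ) : ℂ) := by
      rw [Finset.mul_sum]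
      refine Finset.sum_congr rfl fun n _ => ?_
      have : (y - n : ℝ) = y * (1 - n / y) := by field_simp
      rw [this]; push_cast; ring
    rw [e, norm_mul, norm_real, Real.norm_eq_abs, abs_of_pos (by linarith)]
    nlinarith [hces y hy]
  have hfl : ⌊x⌋₊ ≤ ⌊x + h⌋₊ := Nat.floor_mono (by linarith)
  have hsplit : (h:ℂ) * ∑ n ∈ Finset.Ioc 0 ⌊x⌋₊, b n =
      ∑ n ∈ Finset.Ioc 0 ⌊x + h⌋₊, b n * ((x + h - n : ℝ) : ℂ) - ∑ n ∈ Finset.Ioc 0 ⌊x⌋₊, b n * ((x - n : ℝ) : ℂ)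
      - ∑ n ∈ Finset.Ioc ⌊x⌋₊ ⌊x + h⌋₊, b n * ((x + h - n : ℝ) : ℂ) := by
    rw [← Finset.sum_Ioc_consecutive _ (Nat.zero_le _) hfl, add_sub_right_comm, add_sub_cancel_right,
      ← Finset.sum_sub_distrib, Finset.mul_sum]
    refine Finset.sum_congr rfl fun n _ => ?_
    push_cast; ring
  have h3 : ‖∑ n ∈ Finset.Ioc ⌊x⌋₊ ⌊x + h⌋₊, b n * ((x + h - n : ℝ) : ℂ)‖ ≤ 2 * h * (Bm * h) := by
    refine (norm_sum_le_of_le (f := fun n => b n * ((x + h - n : ℝ) : ℂ)) _ (n := fun _ => Bm * h) fun n hn => ?_).trans ?_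
    · rw [Finset.mem_Ioc] at hn
      have g1 : (n:ℝ) ≤ x + h := (Nat.le_floor_iff (by linarith)).1 hn.2
      have g2 : x < n := (Nat.floor_lt (by linarith)).1 hn.1
      rw [norm_mul, norm_real, Real.norm_eq_abs, abs_of_nonneg (by linarith)]
      exact mul_le_mul (hb n (by omega) (by linarith)) (by linarith) (by linarith) hB
    · rw [Finset.sum_const, Nat.card_Ioc, nsmul_eq_mul, Nat.cast_sub hfl]
      have g1 : (⌊x + h⌋₊ : ℝ) ≤ x + h := Nat.floor_le (by linarith)
      have g2 : x < ⌊x⌋₊ + 1 := Nat.lt_floor_add_one x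
      have : 0 ≤ Bm * h := by positivity
      nlinarith
  have h4 : h * ‖∑ n ∈ Finset.Ioc 0 ⌊x⌋₊, b n‖ ≤ 5 * K * x ^ 2 + 2 * h * (Bm * h) := by
    have : h * ‖∑ n ∈ Finset.Ioc 0 ⌊x⌋₊, b n‖ = ‖(h:ℂ) * ∑ n ∈ Finset.Ioc 0 ⌊x⌋₊, b n‖ := by
      rw [norm_mul, norm_real, Real.norm_eq_abs, abs_of_pos (by linarith)]
    rw [this, hsplit]
    refine (norm_sub_le _ _).trans ?_
    refine (add_le_add (norm_sub_le _ _) h3).trans ?_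
    have t1 := hT (x + h) (by linarith)
    have t2 := hT x hx
    have : K * (x + h) ^ 2 ≤ K * (4 * x ^ 2) := by
      apply mul_le_mul_of_nonneg_left _ hK; nlinarith
    linarith
  have h0 : 0 < h := by linarith
  have : 5 * K * x ^ 2 / h + 2 * h * Bm = (5 * K * x ^ 2 + 2 * h * (Bm * h)) / h := by field_simp
  rw [this, le_div_iff₀ h0]
  linarith

end SW

namespace SW
open Complex Filter Asymptotics Topology

lemma logMul_iter (a : ℕ → ℂ) (k n : ℕ) : LSeries.logMul^[k] a n = a n * ((Real.log n ^ k : ℝ) : ℂ) := by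
  induction k with
  | zero => simp
  | succ k ih =>
    rw [Function.iterate_succ_apply', LSeries.logMul, ih, ← ofReal_natCast, ← ofReal_log (Nat.cast_nonneg _)]
    push_cast; ring

lemma absc_le_one {a : ℕ → ℂ} (hs : ∀ s : ℂ, 1 < s.re → LSeriesSummable a s) {s : ℂ} (h : 1 < s.re) :
    LSeries.abscissaOfAbsConv a < s.re := by
  refine lt_of_le_of_lt (LSeries.abscissaOfAbsConv_le_of_forall_lt_LSeriesSummable (x := 1) fun y hy => hs y (by simpa using hy)) ?_
  exact_mod_cast h

lemma iter_summable {a : ℕ → ℂ} (hs : ∀ s : ℂ, 1 < s.re → LSeriesSummable a s) (k : ℕ) :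
    ∀ s : ℂ, 1 < s.re → LSeriesSummable (LSeries.logMul^[k] a) s := by
  induction k with
  | zero => simpa using hs
  | succ k ih =>
    intro s h
    rw [Function.iterate_succ_apply']
    exact LSeriesSummable_logMul_of_lt_re (absc_le_one ih h)

theorem tauber (A B : ℕ) : ∃ C : ℝ, 0 < C ∧ ∃ x0 : ℝ, 9 ≤ x0 ∧ ∀ (a : ℕ → ℂ) (F : ℂ → ℂ) (M : ℝ), 0 ≤ M →
    (∀ n : ℕ, 0 < n → ‖a n‖ ≤ 1 + Real.log n) →
    (∀ s : ℂ, 1 < s.re → LSeriesSummable a s) →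
    (∀ s : ℂ, 1 < s.re → LSeries a s = F s) →
    (∀ s : ℂ, 1 < s.re → s.re ≤ 2 → ‖iteratedDeriv (2 * A + B + 1) F s‖ ≤ M * (|s.im| + 2) ^ (1 / 2 : ℝ)) →
    ∀ x : ℝ, x0 ≤ x → ‖∑ n ∈ Finset.Ioc 0 ⌊x⌋₊, a n‖ ≤ C * (1 + M / Real.log x ^ B) * x / Real.log x ^ A := by
  obtain ⟨C3, hC3, hces⟩ := cesaro_bound
  have hev : ∀ᶠ x : ℝ in atTop, Real.log x ^ (2 * A + 4) ≤ x := by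
    have := (Real.isLittleO_pow_log_id_atTop (n := 2 * A + 4)).bound (c := 1) one_pos
    filter_upwards [this, eventually_ge_atTop 1] with x hx h1
    have hl := Real.log_nonneg h1
    simp only [Real.norm_eq_abs, id, one_mul] at hx
    rwa [abs_of_nonneg (by positivity), abs_of_nonneg (by linarith)] at hx
  obtain ⟨x1, hx1⟩ := eventually_atTop.1 hev
  set y0 := max x1 9 with hy0
  set k := 2 * A + B + 1 with hk
  have hlog2 : ∀ x : ℝ, 9 ≤ x → 2 ≤ Real.log x := fun x hx => by
    rw [Real.le_log_iff_exp_le (by linarith)]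
    have h1 := Real.exp_one_lt_d9
    have h2 : Real.exp 2 = Real.exp 1 * Real.exp 1 := by rw [← Real.exp_add]; norm_num
    rw [h2]; nlinarith [Real.exp_pos 1]
  refine ⟨2 ^ (k + 2) * (5 * C3 + 2 * 3 ^ (k + 1)) + 1, by positivity, y0 ^ 2, ?_, ?_⟩
  · have : 9 ≤ y0 := le_max_right _ _
    nlinarith
  intro a F M hM ha hs hF hd x hx
  set b : ℕ → ℂ := LSeries.logMul^[k] a with hb
  have hbs : ∀ s : ℂ, 1 < s.re → s.re ≤ 2 → ‖LSeries b s‖ ≤ M * (|s.im| + 2) ^ (1 / 2 : ℝ) := by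
    intro s h1 h2
    have e1 : iteratedDeriv k F s = (-1) ^ k * LSeries b s := by
      rw [← LSeries_iteratedDeriv k (absc_le_one hs h1)]
      refine (Filter.EventuallyEq.iteratedDeriv_eq k ?_).symm
      have ho : IsOpen {z : ℂ | 1 < z.re} := isOpen_lt continuous_const continuous_re
      filter_upwards [ho.mem_nhds h1] with z hz using hF z hz
    have := hd s h1 h2
    rw [e1, norm_mul, norm_pow, norm_neg, norm_one, one_pow, one_mul] at this
    exact this
  have hC := hces b M hM (iter_summable hs k) hbs
  -- bounds for the partial sums of `b`
  have hS : ∀ z : ℝ, y0 ≤ z → ‖∑ n ∈ Finset.Ioc 0 ⌊z⌋₊, b n‖ ≤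
      z * (5 * C3 * M * Real.log z ^ (A + 1) + 2 * 3 ^ (k + 1) * Real.log z ^ (A + B + 1)) := by
    intro z hz
    have hz9 : 9 ≤ z := (le_max_right _ _).trans hz
    have hl := hlog2 z hz9
    set l := Real.log z with hld
    have hlz : l ^ (A + 1) ≤ z := by
      refine le_trans (pow_le_pow_right₀ (by linarith) (by omega)) (hx1 z ((le_max_left _ _).trans hz))
    have hlp : 0 < l ^ (A + 1) := by positivity
    have := unsmooth b (K := C3 * M) (Bm := (3 * l) ^ (k + 1)) (x := z) (h := z / l ^ (A + 1)) (by positivity)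
      (by positivity) (by linarith) (by rwa [le_div_iff₀ hlp, one_mul])
      (div_le_self (by linarith) (one_le_pow₀ (by linarith))) ?_ hC
    · refine this.trans (le_of_eq ?_)
      have e2 : l ^ (k + 1) = l ^ (A + 1) * l ^ (A + B + 1) := by rw [← pow_add, hk]; congr 1; ring
      rw [mul_pow, e2]
      field_simp
    · intro n hn hn2
      have hn1 : (1:ℝ) ≤ n := by exact_mod_cast hn
      have hn0 : 0 ≤ Real.log n := Real.log_nonneg hn1
      have hn3 : Real.log n ≤ l + 1 := by
        have : Real.log n ≤ Real.log (2 * z) := Real.log_le_log (by linarith) hn2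
        rw [Real.log_mul (by norm_num) (by linarith)] at this
        linarith [Real.log_two_lt_d9]
      rw [hb, logMul_iter, norm_mul, norm_real, Real.norm_eq_abs, abs_of_nonneg (by positivity), mul_comm, pow_succ (3 * l) k]
      refine mul_le_mul ?_ ((ha n hn).trans (by linarith)) (norm_nonneg _) (by positivity)
      gcongr; linarith
  have hy9 : 9 ≤ y0 := le_max_right _ _
  have hx9 : 9 ≤ x := by nlinarith
  have hL := hlog2 x hx9
  have hsq : y0 ≤ Real.sqrt x := Real.le_sqrt_of_sq_le hx
  have hsqx : Real.sqrt x ≤ x := by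
    rw [Real.sqrt_le_left (by linarith)]; nlinarith
  have hlogsq : Real.log (Real.sqrt x) = Real.log x / 2 := Real.log_sqrt (by linarith)
  set L := Real.log x with hLd
  set m := ⌊Real.sqrt x⌋₊ with hm
  set E := x * (5 * C3 * M * L ^ (A + 1) + 2 * 3 ^ (k + 1) * L ^ (A + B + 1)) with hE
  have hE0 : 0 ≤ E := by positivity
  have hS2 : ∀ z : ℝ, y0 ≤ z → z ≤ x → ‖∑ n ∈ Finset.Ioc 0 ⌊z⌋₊, b n‖ ≤ E := by
    intro z h1 h2
    refine (hS z h1).trans ?_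
    have h3 : Real.log z ≤ L := Real.log_le_log (by linarith) h2
    have h4 : 0 ≤ Real.log z := Real.log_nonneg (by linarith)
    have h5 : 0 ≤ z := by linarith
    rw [hE]
    gcongr
  have hmx : m ≤ ⌊x⌋₊ := Nat.floor_mono hsqx
  have hm1 : Real.sqrt x < m + 1 := Nat.lt_floor_add_one _
  have hlogn : ∀ n : ℕ, m < n → L / 2 ≤ Real.log n := fun n hn => by
    rw [← hlogsq]
    have h1 : (m:ℝ) + 1 ≤ n := by exact_mod_cast hn
    exact Real.log_le_log (by linarith) (by linarith)
  have hbig := abel_bound b (fun n => 1 / Real.log n ^ k) m ⌊x⌋₊ (2 * E) (by linarith) ?_ ?_ ?_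
  rotate_left
  · intro n h1 _
    have h2 := hlogn n h1
    have h3 : Real.log n ≤ Real.log ((n + 1 : ℕ) : ℝ) := by
      apply Real.log_le_log
      · exact_mod_cast (by omega : 0 < n)
      · push_cast; linarith
    have h4 : 0 < Real.log n := by linarith
    gcongr
  · intro n hn
    have h2 := hlogn n hn
    have h4 : 0 < Real.log n := by linarith
    positivity
  · intro j h1 h2
    rcases eq_or_lt_of_le h1 with h | h
    · rw [← h]; simp; exact hE0
    have e1 := Finset.sum_Ioc_consecutive b (Nat.zero_le m) h1
    have e2 : ∑ n ∈ Finset.Ioc m j, b n = ∑ n ∈ Finset.Ioc 0 j, b n - ∑ n ∈ Finset.Ioc 0 m, b n := by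
      rw [← e1]; ring
    rw [e2]
    refine (norm_sub_le _ _).trans ?_
    have f1 := hS2 (Real.sqrt x) hsq hsqx
    have hj1 : (m:ℝ) + 1 ≤ j := by exact_mod_cast h
    have f2 := hS2 j (by linarith) ((Nat.le_floor_iff (by linarith)).1 h2)
    rw [Nat.floor_natCast] at f2
    linarith
  have hba : ∑ n ∈ Finset.Ioc m ⌊x⌋₊, b n * ((1 / Real.log n ^ k : ℝ) : ℂ) = ∑ n ∈ Finset.Ioc m ⌊x⌋₊, a n := by
    refine Finset.sum_congr rfl fun n hn => ?_
    rw [Finset.mem_Ioc] at hn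
    have h2 := hlogn n hn.1
    have h4 : Real.log n ^ k ≠ 0 := by
      have : 0 < Real.log n := by linarith
      positivity
    rw [hb, logMul_iter, mul_assoc, ← ofReal_mul, mul_one_div, div_self h4]; simp
  rw [hba] at hbig
  have hLk : 1 / Real.log ((m + 1 : ℕ) : ℝ) ^ k ≤ 2 ^ k / L ^ k := by
    have h2 := hlogn (m + 1) (by omega)
    have : (2:ℝ) ^ k / L ^ k = 1 / (L / 2) ^ k := by rw [div_pow]; field_simp
    rw [this]
    have : 0 < L / 2 := by linarith
    gcongr
  have hbig2 : ‖∑ n ∈ Finset.Ioc m ⌊x⌋₊, a n‖ ≤ 2 ^ (k + 1) * (5 * C3 * (M / L ^ B) + 2 * 3 ^ (k + 1)) * (x / L ^ A) := by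
    refine hbig.trans ?_
    calc 2 * E * (1 / Real.log ((m + 1 : ℕ) : ℝ) ^ k) ≤ 2 * E * (2 ^ k / L ^ k) := by gcongr
      _ = _ := by
        have e3 : L ^ k = L ^ (A + 1) * L ^ A * L ^ B := by rw [← pow_add, ← pow_add, hk]; congr 1; ring
        have e4 : L ^ (A + B + 1) = L ^ (A + 1) * L ^ B := by rw [← pow_add]; congr 1; ring
        rw [hE, e3, e4]
        field_simp
        ring
  have hsmall : ‖∑ n ∈ Finset.Ioc 0 m, a n‖ ≤ x / L ^ A := by
    have s1 : ‖∑ n ∈ Finset.Ioc 0 m, a n‖ ≤ ∑ n ∈ Finset.Ioc 0 m, (1 + L) := by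
      refine norm_sum_le_of_le _ fun n hn => ?_
      rw [Finset.mem_Ioc] at hn
      refine (ha n hn.1).trans ?_
      have : (n:ℝ) ≤ Real.sqrt x := (Nat.le_floor_iff (by positivity)).1 hn.2
      have : Real.log n ≤ L := Real.log_le_log (by exact_mod_cast hn.1) (by linarith)
      linarith
    refine s1.trans ?_
    rw [Finset.sum_const, Nat.card_Ioc, nsmul_eq_mul, Nat.sub_zero]
    have s2 : (m:ℝ) ≤ Real.sqrt x := Nat.floor_le (by positivity)
    have s3 : L ^ (2 * A + 4) ≤ x := hx1 x (by
      have : x1 ≤ y0 := le_max_left _ _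
      linarith)
    have s4 : L ^ (A + 2) ≤ Real.sqrt x := by
      apply Real.le_sqrt_of_sq_le
      rw [← pow_mul]; convert s3 using 2; ring
    rw [le_div_iff₀ (by positivity)]
    have s5 : (1 + L) * L ^ A ≤ L ^ (A + 2) := by
      have : L ^ (A + 2) = L ^ 2 * L ^ A := by ring
      rw [this]; gcongr; nlinarith
    calc (m:ℝ) * (1 + L) * L ^ A = m * ((1 + L) * L ^ A) := by ring
      _ ≤ Real.sqrt x * Real.sqrt x := by
        apply mul_le_mul s2 (s5.trans s4) (by positivity) (by positivity)
      _ = x := Real.mul_self_sqrt (by linarith)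
  rw [← Finset.sum_Ioc_consecutive a (Nat.zero_le m) hmx]
  refine (norm_add_le _ _).trans ((add_le_add hsmall hbig2).trans ?_)
  have hMB : 0 ≤ M / L ^ B := by positivity
  have hxA : 0 ≤ x / L ^ A := by positivity
  have : 1 + 2 ^ (k + 1) * (5 * C3 * (M / L ^ B) + 2 * 3 ^ (k + 1)) ≤
      (2 ^ (k + 2) * (5 * C3 + 2 * 3 ^ (k + 1)) + 1) * (1 + M / L ^ B) := by
    have p2 : (2:ℝ) ^ (k + 2) = 2 * 2 ^ (k + 1) := by ring
    rw [p2]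
    set P2 : ℝ := 2 ^ (k + 1)
    set P3 : ℝ := 3 ^ (k + 1)
    have q1 : 0 < P2 := by positivity
    have q2 : 0 < P3 := by positivity
    have r1 : 0 ≤ P2 * C3 := by positivity
    have r2 : 0 ≤ P2 * P3 := by positivity
    have r3 : 0 ≤ P2 * C3 * (M / L ^ B) := by positivity
    have r4 : 0 ≤ P2 * P3 * (M / L ^ B) := by positivity
    nlinarith
  calc x / L ^ A + 2 ^ (k + 1) * (5 * C3 * (M / L ^ B) + 2 * 3 ^ (k + 1)) * (x / L ^ A)
      = (1 + 2 ^ (k + 1) * (5 * C3 * (M / L ^ B) + 2 * 3 ^ (k + 1))) * (x / L ^ A) := by ring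
    _ ≤ (2 ^ (k + 2) * (5 * C3 + 2 * 3 ^ (k + 1)) + 1) * (1 + M / L ^ B) * (x / L ^ A) := by gcongr
    _ = _ := by ring

end SW

namespace SW
open Complex Filter Asymptotics Topology

lemma psi_char (A B : ℕ) : ∃ C, 0 < C ∧ ∃ x0 : ℝ, 9 ≤ x0 ∧ ∀ (q : ℕ) [NeZero q] (χ : DirichletCharacter ℂ q), χ ≠ 1 →
    ∀ x : ℝ, x0 ≤ x → (q:ℝ) ≤ Real.log x ^ B →
    ‖∑ n ∈ Finset.Ioc 0 ⌊x⌋₊, χ n * (ArithmeticFunction.vonMangoldt n : ℂ)‖ ≤ C * x / Real.log x ^ A := by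
  obtain ⟨C, hC, x0, hx0, H⟩ := tauber A B
  obtain ⟨C', hC', H'⟩ := L_logderiv_iter (2*A+B+1) (δ := 1/2) (by norm_num) (by norm_num)
  refine ⟨C * (1 + C'), by positivity, x0, hx0, ?_⟩
  intro q _ χ hχ x hx hq
  have hq1 : (1:ℝ) ≤ q := by exact_mod_cast NeZero.one_le
  have hlog : 0 < Real.log x := Real.log_pos (by linarith)
  have hs : (q:ℝ)^(1/2:ℝ) ≤ q := by
    calc (q:ℝ)^(1/2:ℝ) ≤ (q:ℝ)^(1:ℝ) := Real.rpow_le_rpow_of_exponent_le hq1 (by norm_num)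
      _ = q := Real.rpow_one _
  have h := H ((fun n:ℕ => χ n) * fun n => (ArithmeticFunction.vonMangoldt n : ℂ))
    (fun z => -(deriv χ.LFunction z / χ.LFunction z)) (C' * (q:ℝ)^(1/2:ℝ)) (by positivity)
    (by
      intro n hn
      simp only [Pi.mul_apply, norm_mul]
      have h1 : ‖χ n‖ ≤ 1 := χ.norm_le_one n
      have h2 : ‖(ArithmeticFunction.vonMangoldt n : ℂ)‖ ≤ Real.log n := by
        rw [Complex.norm_real, Real.norm_of_nonneg ArithmeticFunction.vonMangoldt_nonneg]
        exact ArithmeticFunction.vonMangoldt_le_log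
      have h3 : 0 ≤ ‖(ArithmeticFunction.vonMangoldt n : ℂ)‖ := norm_nonneg _
      nlinarith [norm_nonneg (χ n)])
    (fun s hs => DirichletCharacter.LSeriesSummable_twist_vonMangoldt χ hs)
    (fun s hs => twist_eq χ hs)
    (by
      intro s h1 h2
      refine (H' q χ hχ s h1.le h2).trans (le_of_eq ?_)
      rw [Real.mul_rpow (by positivity) (by positivity)]; ring)
    x hx
  refine h.trans ?_
  have hM : C' * (q:ℝ)^(1/2:ℝ) / Real.log x ^ B ≤ C' := by
    rw [div_le_iff₀ (by positivity)]
    have := hs.trans hq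
    gcongr
  have hx' : 0 ≤ x := by linarith
  gcongr

lemma psi_zeta (A : ℕ) : ∃ C, 0 < C ∧ ∃ x0 : ℝ, 9 ≤ x0 ∧ 
    ∀ x : ℝ, x0 ≤ x → 
    |∑ n ∈ Finset.Ioc 0 ⌊x⌋₊, (ArithmeticFunction.vonMangoldt n - 1)| ≤ C * x / Real.log x ^ A := by
  obtain ⟨C, hC, x0, hx0, H⟩ := tauber A 0
  obtain ⟨C', hC', H'⟩ := zeta_logderiv_iter (2*A+0+1) (δ := 1/2) (by norm_num) (by norm_num)
  refine ⟨C * (1 + C'), by positivity, x0, hx0, ?_⟩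
  intro x hx
  have hlog : 0 < Real.log x := Real.log_pos (by linarith)
  have h := H ((fun n => (ArithmeticFunction.vonMangoldt n : ℂ)) - 1)
    (fun z => -(deriv riemannZeta z / riemannZeta z) - riemannZeta z) C' hC'.le
    (by
      intro n hn
      simp only [Pi.sub_apply, Pi.one_apply]
      refine (norm_sub_le _ _).trans ?_
      rw [Complex.norm_real, Real.norm_of_nonneg ArithmeticFunction.vonMangoldt_nonneg, norm_one]
      have := ArithmeticFunction.vonMangoldt_le_log (n := n)
      linarith)
    (fun s hs => (ArithmeticFunction.LSeriesSummable_vonMangoldt hs).sub (LSeriesSummable_one_iff.mpr hs))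
    (fun s hs => by
      rw [LSeries_sub (ArithmeticFunction.LSeriesSummable_vonMangoldt hs) (LSeriesSummable_one_iff.mpr hs),
        ArithmeticFunction.LSeries_vonMangoldt_eq_deriv_riemannZeta_div hs, LSeries_one_eq_riemannZeta hs, neg_div])
    (fun s h1 h2 => H' s h1 h2)
    x hx
  simp only [pow_zero, div_one, Pi.sub_apply, Pi.one_apply] at h
  refine le_trans (le_of_eq ?_) h
  rw [← Real.norm_eq_abs, ← Complex.norm_real]
  push_cast
  rfl
end SW

namespace SW
open Complex Filter Asymptotics Topology

lemma ev_log_pow (K : ℕ) {c δ : ℝ} (hc : 0 < c) (hδ : 0 < δ) :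
    ∀ᶠ x : ℝ in atTop, c * Real.log x ^ K ≤ x ^ δ := by
  have h := (isLittleO_log_rpow_rpow_atTop (K:ℝ) hδ).bound (inv_pos.mpr hc)
  filter_upwards [h, eventually_ge_atTop 1] with x hx h1
  have hl := Real.log_nonneg h1
  rw [Real.rpow_natCast, Real.norm_of_nonneg (by positivity), Real.norm_of_nonneg (by positivity)] at hx
  calc c * Real.log x ^ K ≤ c * (c⁻¹ * x ^ δ) := by gcongr
    _ = x ^ δ := by field_simp

lemma ev_err1 (A : ℕ) : ∀ᶠ x : ℝ in atTop, 2 * √x * Real.log x ≤ x / Real.log x ^ A := by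
  filter_upwards [ev_log_pow (A+1) (c := 2) (δ := 1/2) (by norm_num) (by norm_num), eventually_gt_atTop 1] with x hx h1
  have hl := Real.log_pos h1
  rw [le_div_iff₀ (by positivity)]
  have h2 : √x * √x = x := Real.mul_self_sqrt (by linarith)
  rw [← Real.sqrt_eq_rpow] at hx
  calc 2 * √x * Real.log x * Real.log x ^ A = √x * (2 * Real.log x ^ (A+1)) := by ring
    _ ≤ √x * √x := by gcongr
    _ = x := h2

lemma ev_err2 (A K : ℕ) : ∀ᶠ x : ℝ in atTop, Real.log x ^ K ≤ x / Real.log x ^ A := by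
  filter_upwards [ev_log_pow (A+K) (c := 1) (δ := 1) (by norm_num) (by norm_num), eventually_gt_atTop 1] with x hx h1
  have hl := Real.log_pos h1
  rw [le_div_iff₀ (by positivity)]
  rw [Real.rpow_one] at hx
  calc Real.log x ^ K * Real.log x ^ A = 1 * Real.log x ^ (A+K) := by ring
    _ ≤ x := hx

lemma theta_char (A B : ℕ) : ∃ C : ℝ, 0 < C ∧ ∀ᶠ x : ℝ in atTop, ∀ (q : ℕ) [NeZero q] (χ : DirichletCharacter ℂ q), χ ≠ 1 →
    (q:ℝ) ≤ Real.log x ^ B →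
    ‖∑ p ∈ (Finset.Ioc 0 ⌊x⌋₊).filter Nat.Prime, χ p * (Real.log p : ℂ)‖ ≤ C * (x / Real.log x ^ A) := by
  obtain ⟨C, hC, x0, hx0, H⟩ := psi_char A B
  refine ⟨C + 1, by positivity, ?_⟩
  filter_upwards [ev_err1 A, eventually_ge_atTop x0] with x h1 h2 q _ χ hχ hq
  have h := H q χ hχ x h2 hq
  rw [← Finset.sum_filter_add_sum_filter_not _ Nat.Prime] at h
  have e1 : ∑ p ∈ (Finset.Ioc 0 ⌊x⌋₊).filter Nat.Prime, χ p * (ArithmeticFunction.vonMangoldt p : ℂ) =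
      ∑ p ∈ (Finset.Ioc 0 ⌊x⌋₊).filter Nat.Prime, χ p * (Real.log p : ℂ) := by
    refine Finset.sum_congr rfl fun p hp => ?_
    rw [ArithmeticFunction.vonMangoldt_apply_prime (Finset.mem_filter.mp hp).2]
  have e2 : ‖∑ p ∈ (Finset.Ioc 0 ⌊x⌋₊).filter (fun p => ¬ Nat.Prime p), χ p * (ArithmeticFunction.vonMangoldt p : ℂ)‖ ≤
      x / Real.log x ^ A := by
    refine le_trans ?_ ((Chebyshev.psi_sub_theta_le (by linarith)).trans h1)
    rw [Chebyshev.psi_sub_theta_eq_sum_not_prime]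
    refine norm_sum_le_of_le _ fun p _ => ?_
    rw [norm_mul, Complex.norm_real, Real.norm_of_nonneg ArithmeticFunction.vonMangoldt_nonneg]
    exact mul_le_of_le_one_left ArithmeticFunction.vonMangoldt_nonneg (χ.norm_le_one _)
  rw [e1] at h
  have := norm_le_norm_add_norm_sub' (∑ p ∈ (Finset.Ioc 0 ⌊x⌋₊).filter Nat.Prime, χ p * (Real.log p : ℂ))
    (∑ p ∈ (Finset.Ioc 0 ⌊x⌋₊).filter Nat.Prime, χ p * (Real.log p : ℂ) + ∑ p ∈ (Finset.Ioc 0 ⌊x⌋₊).filter (fun p => ¬ Nat.Prime p), χ p * (ArithmeticFunction.vonMangoldt p : ℂ))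
  rw [sub_add_cancel_left, norm_neg] at this
  rw [mul_div_assoc] at h
  linarith

lemma theta_zeta (A : ℕ) : ∃ C : ℝ, 0 < C ∧ ∀ᶠ x : ℝ in atTop,
    |∑ p ∈ (Finset.Ioc 0 ⌊x⌋₊).filter Nat.Prime, Real.log p - x| ≤ C * (x / Real.log x ^ A) := by
  obtain ⟨C, hC, x0, hx0, H⟩ := psi_zeta A
  refine ⟨C + 2, by positivity, ?_⟩
  filter_upwards [ev_err1 A, ev_err2 A 0, eventually_ge_atTop x0] with x h1 h0 h2
  have h := H x h2
  rw [Finset.sum_sub_distrib] at h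
  have e1 := Chebyshev.psi_sub_theta_le (x := x) (by linarith)
  have e0 := Chebyshev.theta_le_psi x
  have e2 : Chebyshev.psi x = ∑ n ∈ Finset.Ioc 0 ⌊x⌋₊, ArithmeticFunction.vonMangoldt n := rfl
  have e3 : Chebyshev.theta x = ∑ p ∈ (Finset.Ioc 0 ⌊x⌋₊).filter Nat.Prime, Real.log p := rfl
  rw [← e2] at h
  rw [← e3]
  simp only [Finset.sum_const, Nat.card_Ioc, Nat.sub_zero, nsmul_eq_mul, mul_one] at h
  have e4 := Nat.floor_le (a := x) (by linarith)
  have e5 := Nat.lt_floor_add_one x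
  rw [pow_zero] at h0
  rw [mul_div_assoc, abs_le] at h
  rw [abs_le]
  constructor <;> linarith [h.1, h.2]

lemma bad_primes {q : ℕ} [NeZero q] {x : ℝ} (hx : 1 ≤ x) :
    ∑ p ∈ ((Finset.Ioc 0 ⌊x⌋₊).filter Nat.Prime).filter (fun p => ¬ Nat.Coprime p q), Real.log p ≤ q * Real.log x := by
  have hcard : (((Finset.Ioc 0 ⌊x⌋₊).filter Nat.Prime).filter (fun p => ¬ Nat.Coprime p q)).card ≤ q := by
    calc _ ≤ (Finset.Ioc 0 q).card := by
          refine Finset.card_le_card fun p hp => ?_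
          simp only [Finset.mem_filter, Finset.mem_Ioc] at hp ⊢
          refine ⟨hp.1.1.1, Nat.le_of_dvd (Nat.pos_of_neZero q) ?_⟩
          have h2 := hp.2
          rwa [hp.1.2.coprime_iff_not_dvd, not_not] at h2
      _ = q := by simp
  calc _ ≤ ∑ p ∈ ((Finset.Ioc 0 ⌊x⌋₊).filter Nat.Prime).filter (fun p => ¬ Nat.Coprime p q), Real.log x := by
        refine Finset.sum_le_sum fun p hp => ?_
        simp only [Finset.mem_filter, Finset.mem_Ioc] at hp
        refine Real.log_le_log (by exact_mod_cast hp.1.1.1) ?_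
        exact (Nat.le_floor_iff (by linarith)).mp hp.1.1.2
    _ ≤ _ := by
      rw [Finset.sum_const, nsmul_eq_mul]
      have := Real.log_nonneg hx
      gcongr

lemma theta_triv (A B : ℕ) : ∃ C : ℝ, 0 < C ∧ ∀ᶠ x : ℝ in atTop, ∀ (q : ℕ) [NeZero q],
    (q:ℝ) ≤ Real.log x ^ B →
    ‖∑ p ∈ (Finset.Ioc 0 ⌊x⌋₊).filter Nat.Prime, (1 : DirichletCharacter ℂ q) p * (Real.log p : ℂ) - x‖ ≤ C * (x / Real.log x ^ A) := by
  obtain ⟨C, hC, H⟩ := theta_zeta A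
  refine ⟨C + 1, by positivity, ?_⟩
  filter_upwards [H, ev_err2 A (B+1), eventually_gt_atTop 1] with x h1 h2 h3 q _ hq
  have hl := Real.log_pos h3
  have hb := bad_primes (q := q) h3.le
  have hb' : (q:ℝ) * Real.log x ≤ x / Real.log x ^ A := by
    refine le_trans ?_ h2
    rw [pow_succ]; gcongr
  have e1 : ∑ p ∈ (Finset.Ioc 0 ⌊x⌋₊).filter Nat.Prime, (1 : DirichletCharacter ℂ q) p * (Real.log p : ℂ) =
      ((∑ p ∈ ((Finset.Ioc 0 ⌊x⌋₊).filter Nat.Prime).filter (fun p => Nat.Coprime p q), Real.log p : ℝ) : ℂ) := by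
    rw [Finset.sum_filter (p := fun p => Nat.Coprime p q)]
    rw [ofReal_sum]
    refine Finset.sum_congr rfl fun p _ => ?_
    split_ifs with h
    · rw [MulChar.one_apply ((ZMod.isUnit_iff_coprime p q).mpr h), one_mul]
    · rw [MulChar.map_nonunit _ (fun h' => h ((ZMod.isUnit_iff_coprime p q).mp h'))]; simp
  rw [e1, ← ofReal_sub, Complex.norm_real, Real.norm_eq_abs]
  rw [← Finset.sum_filter_add_sum_filter_not _ (fun p => Nat.Coprime p q)] at h1
  have h0 : 0 ≤ ∑ p ∈ ((Finset.Ioc 0 ⌊x⌋₊).filter Nat.Prime).filter (fun p => ¬ Nat.Coprime p q), Real.log p :=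
    Finset.sum_nonneg fun p _ => Real.log_natCast_nonneg p
  rw [abs_le] at h1 ⊢
  constructor <;> linarith [h1.1, h1.2]

theorem sw (A B : ℕ) : ∃ C : ℝ, 0 < C ∧ ∀ᶠ x : ℝ in atTop, ∀ (q : ℕ) [NeZero q],
    (q:ℝ) ≤ Real.log x ^ B → ∀ b : ZMod q, IsUnit b →
    |∑ p ∈ ((Finset.Ioc 0 ⌊x⌋₊).filter Nat.Prime).filter (fun p : ℕ => (p : ZMod q) = b), Real.log p - x / q.totient|
      ≤ C * (x / Real.log x ^ A) := by
  obtain ⟨C1, hC1, H1⟩ := theta_triv A B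
  obtain ⟨C2, hC2, H2⟩ := theta_char A B
  refine ⟨C1 + C2, by positivity, ?_⟩
  filter_upwards [H1, H2, eventually_gt_atTop 1] with x h1 h2 h3 q _ hq b hb
  have hl := Real.log_pos h3
  set D := x / Real.log x ^ A with hD
  have hD0 : 0 < D := by positivity
  have hφ : (0:ℝ) < q.totient := by exact_mod_cast Nat.totient_pos.mpr (Nat.pos_of_neZero q)
  have key : ((q.totient : ℂ)) * ((∑ p ∈ ((Finset.Ioc 0 ⌊x⌋₊).filter Nat.Prime).filter (fun p : ℕ => (p : ZMod q) = b), Real.log p : ℝ) : ℂ)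
      - x = ∑ χ : DirichletCharacter ℂ q, χ b⁻¹ * (∑ p ∈ (Finset.Ioc 0 ⌊x⌋₊).filter Nat.Prime, χ p * (Real.log p : ℂ)
        - if χ = 1 then (x:ℂ) else 0) := by
    simp_rw [mul_sub, Finset.sum_sub_distrib]
    congr 1
    · simp_rw [Finset.mul_sum]
      rw [Finset.sum_comm]
      rw [Finset.sum_filter (p := fun p : ℕ => (p : ZMod q) = b)]
      push_cast
      rw [Finset.mul_sum]
      refine Finset.sum_congr rfl fun p _ => ?_
      simp_rw [← mul_assoc]
      rw [← Finset.sum_mul, DirichletCharacter.sum_char_inv_mul_char_eq ℂ hb]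
      by_cases h : (p : ZMod q) = b
      · simp [h]
      · simp [h, Ne.symm h]
    · have hbi : IsUnit b⁻¹ := by
        obtain ⟨u, rfl⟩ := hb
        rw [ZMod.inv_coe_unit]; exact u⁻¹.isUnit
      simp [MulChar.one_apply hbi]
  have hn : ‖∑ χ : DirichletCharacter ℂ q, χ b⁻¹ * (∑ p ∈ (Finset.Ioc 0 ⌊x⌋₊).filter Nat.Prime, χ p * (Real.log p : ℂ)
        - if χ = 1 then (x:ℂ) else 0)‖ ≤ q.totient * ((C1 + C2) * D) := by
    have : ∀ χ ∈ (Finset.univ : Finset (DirichletCharacter ℂ q)), ‖χ b⁻¹ * (∑ p ∈ (Finset.Ioc 0 ⌊x⌋₊).filter Nat.Prime, χ p * (Real.log p : ℂ)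
        - if χ = 1 then (x:ℂ) else 0)‖ ≤ (C1 + C2) * D := by
      intro χ _
      rw [norm_mul]
      refine (mul_le_of_le_one_left (norm_nonneg _) (χ.norm_le_one _)).trans ?_
      split_ifs with h
      · subst h
        refine (h1 q hq).trans ?_
        gcongr; linarith
      · rw [sub_zero]
        refine (h2 q χ h hq).trans ?_
        gcongr; linarith
    refine (norm_sum_le_of_le _ this).trans (le_of_eq ?_)
    rw [Finset.sum_const, nsmul_eq_mul, Finset.card_univ, ← Nat.card_eq_fintype_card,
      DirichletCharacter.card_eq_totient_of_hasEnoughRootsOfUnity]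
  rw [← key, ← ofReal_natCast, ← ofReal_mul, ← ofReal_sub, Complex.norm_real, Real.norm_eq_abs] at hn
  set T := ∑ p ∈ ((Finset.Ioc 0 ⌊x⌋₊).filter Nat.Prime).filter (fun p : ℕ => (p : ZMod q) = b), Real.log p
  have e : (q.totient : ℝ) * T - x = q.totient * (T - x / q.totient) := by field_simp
  rw [e, abs_mul, abs_of_pos hφ] at hn
  exact le_of_mul_le_mul_left hn hφ
end SW

namespace SW
open Complex Filter Asymptotics Topology

lemma e_norm (t : ℝ) : ‖e t‖ = 1 := by
  have : e t = Complex.exp ((2 * Real.pi * t : ℝ) * Complex.I) := by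
    unfold e; congr 1; push_cast; ring
  rw [this, Complex.norm_exp_ofReal_mul_I]

lemma e_sub (s t : ℝ) : ‖e s - e t‖ ≤ 2 * Real.pi * |s - t| := by
  have h1 : e s = e t * Complex.exp (Complex.I * (2 * Real.pi * (s - t) : ℝ)) := by
    unfold e; rw [← Complex.exp_add]; congr 1; push_cast; ring
  have h2 : e s - e t = e t * (Complex.exp (Complex.I * (2 * Real.pi * (s - t) : ℝ)) - 1) := by
    rw [h1]; ring
  rw [h2, norm_mul, e_norm, one_mul]
  refine (Real.norm_exp_I_mul_ofReal_sub_one_le).trans (le_of_eq ?_)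
  rw [Real.norm_eq_abs, abs_mul, abs_of_pos (by positivity)]

lemma e_periodic (t : ℝ) (k : ℤ) : e (t + k) = e t := by
  unfold e
  refine Eq.trans ?_ (Complex.exp_periodic.int_mul k (2 * Real.pi * Complex.I * t))
  congr 1; push_cast; ring

lemma e_modEq {q a m m' : ℕ} (hq : 0 < q) (h : m ≡ m' [MOD q]) :
    e ((a:ℝ) * (m:ℝ)^5 / q) = e ((a:ℝ) * (m':ℝ)^5 / q) := by
  have h5 : (a * m^5 : ℕ) ≡ a * m'^5 [MOD q] := (h.pow 5).mul_left a
  obtain ⟨k, hk⟩ := (Nat.modEq_iff_dvd.mp h5)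
  have hk' : (a:ℝ) * (m':ℝ)^5 - a * (m:ℝ)^5 = q * k := by exact_mod_cast hk
  have hq' : (q:ℝ) ≠ 0 := by positivity
  rw [← e_periodic ((a:ℝ) * (m:ℝ)^5 / q) k]
  congr 1
  field_simp
  linarith

lemma residue_split (q a : ℕ) [NeZero q] (s : Finset ℕ) (hs : ∀ p ∈ s, 0 < p) :
    ∑ p ∈ s.filter (fun p => Nat.Coprime p q), e ((a:ℝ) * (p:ℝ)^5 / q) * (Real.log p : ℂ) =
    ∑ y ∈ (Finset.Icc 1 q).filter (fun y => Nat.gcd y q = 1), e ((a:ℝ) * (y:ℝ)^5 / q) *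
      ((∑ p ∈ s.filter (fun p : ℕ => (p : ZMod q) = (y:ZMod q)), Real.log p : ℝ) : ℂ) := by
  have hq : 0 < q := Nat.pos_of_neZero q
  have hg : ∀ p, 0 < p → (p - 1) % q + 1 ≡ p [MOD q] := by
    intro p hp
    have h : (p-1) % q + 1 ≡ (p - 1) + 1 [MOD q] := (Nat.mod_modEq _ _).add_right 1
    rwa [Nat.sub_add_cancel hp] at h
  have hco : ∀ m m' : ℕ, m ≡ m' [MOD q] → Nat.gcd m q = Nat.gcd m' q := fun m m' h => h.gcd_eq
  rw [← Finset.sum_fiberwise_of_maps_to (g := fun p => (p - 1) % q + 1)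
    (t := (Finset.Icc 1 q).filter (fun y => Nat.gcd y q = 1))]
  · refine Finset.sum_congr rfl fun y hy => ?_
    simp only [Finset.mem_filter, Finset.mem_Icc] at hy
    rw [ofReal_sum, Finset.mul_sum]
    refine Finset.sum_congr ?_ ?_
    · ext p
      simp only [Finset.mem_filter, ZMod.natCast_eq_natCast_iff]
      constructor
      · rintro ⟨⟨h1, h2⟩, h3⟩
        exact ⟨h1, h3 ▸ (hg p (hs p h1)).symm⟩
      · rintro ⟨h1, h2⟩
        refine ⟨⟨h1, ?_⟩, ?_⟩
        · rw [Nat.Coprime, hco _ _ h2, hy.2]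
        · have h3 : p - 1 ≡ y - 1 [MOD q] := by
            refine Nat.ModEq.add_right_cancel' 1 ?_
            rwa [Nat.sub_add_cancel (hs p h1), Nat.sub_add_cancel hy.1.1]
          have h4 : (p - 1) % q = (y - 1) % q := h3
          rw [h4, Nat.mod_eq_of_lt (by omega)]; omega
    · intro p hp
      simp only [Finset.mem_filter, ZMod.natCast_eq_natCast_iff] at hp
      rw [e_modEq hq hp.2]
  · intro p hp
    simp only [Finset.mem_filter, Finset.mem_Icc] at hp ⊢
    refine ⟨⟨by omega, Nat.mod_lt _ hq⟩, ?_⟩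
    rw [hco _ _ (hg p (hs p hp.1))]; exact hp.2

lemma exp_sum (A B : ℕ) : ∃ C : ℝ, 0 < C ∧ ∀ᶠ x : ℝ in atTop, ∀ (q : ℕ) [NeZero q],
    (q:ℝ) ≤ Real.log x ^ B → ∀ a : ℕ,
    ‖∑ p ∈ (Finset.Ioc 0 ⌊x⌋₊).filter Nat.Prime, e ((a:ℝ) * (p:ℝ)^5 / q) * (Real.log p : ℂ)
      - S 5 q a / (Nat.totient q : ℂ) * (x:ℂ)‖ ≤ C * (q * (x / Real.log x ^ A)) := by
  obtain ⟨C, hC, H⟩ := sw A B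
  refine ⟨C + 1, by positivity, ?_⟩
  filter_upwards [H, ev_err2 A 1, eventually_gt_atTop 1] with x h1 h2 h3 q _ hq a
  have hl := Real.log_pos h3
  rw [pow_one] at h2
  set D := x / Real.log x ^ A with hD
  have hD0 : 0 < D := by positivity
  set s := (Finset.Ioc 0 ⌊x⌋₊).filter Nat.Prime with hs
  rw [← Finset.sum_filter_add_sum_filter_not s (fun p => Nat.Coprime p q)]
  rw [residue_split q a s (fun p hp => (Finset.mem_Ioc.mp (Finset.mem_filter.mp hp).1).1)]
  have hb : ‖∑ p ∈ s.filter (fun p => ¬ Nat.Coprime p q), e ((a:ℝ) * (p:ℝ)^5 / q) * (Real.log p : ℂ)‖ ≤ q * D := by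
    refine le_trans ?_ ((bad_primes (q := q) h3.le).trans (mul_le_mul_of_nonneg_left h2 (Nat.cast_nonneg _)))
    refine norm_sum_le_of_le _ fun p _ => ?_
    rw [norm_mul, e_norm, one_mul, Complex.norm_real, Real.norm_of_nonneg (Real.log_natCast_nonneg p)]
  have hm : ‖∑ y ∈ (Finset.Icc 1 q).filter (fun y => Nat.gcd y q = 1), e ((a:ℝ) * (y:ℝ)^5 / q) *
      ((∑ p ∈ s.filter (fun p : ℕ => (p : ZMod q) = (y:ZMod q)), Real.log p : ℝ) : ℂ)
      - S 5 q a / (Nat.totient q : ℂ) * (x:ℂ)‖ ≤ q * (C * D) := by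
    have e1 : S 5 q a / (Nat.totient q : ℂ) * (x:ℂ) = ∑ y ∈ (Finset.Icc 1 q).filter (fun y => Nat.gcd y q = 1),
        e ((a:ℝ) * (y:ℝ)^5 / q) * ((x / q.totient : ℝ) : ℂ) := by
      unfold S
      rw [← Finset.sum_mul]; push_cast; ring
    rw [e1, ← Finset.sum_sub_distrib]
    have : ∀ y ∈ (Finset.Icc 1 q).filter (fun y => Nat.gcd y q = 1), ‖e ((a:ℝ) * (y:ℝ)^5 / q) *
      ((∑ p ∈ s.filter (fun p : ℕ => (p : ZMod q) = (y:ZMod q)), Real.log p : ℝ) : ℂ) -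
      e ((a:ℝ) * (y:ℝ)^5 / q) * ((x / q.totient : ℝ) : ℂ)‖ ≤ C * D := by
      intro y hy
      rw [← mul_sub, norm_mul, e_norm, one_mul, ← ofReal_sub, Complex.norm_real]
      exact h1 q hq y ((ZMod.isUnit_iff_coprime y q).mpr (Finset.mem_filter.mp hy).2)
    refine (norm_sum_le_of_le _ this).trans ?_
    rw [Finset.sum_const, nsmul_eq_mul]
    gcongr
    exact (Finset.card_filter_le _ _).trans (by simp)
  rw [add_sub_right_comm]
  refine (norm_add_le _ _).trans ?_
  linarith

end SW

namespace SW
open Complex Filter Asymptotics Topology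

lemma theta_bounds (c : ℕ) : 0 < θ c ∧ θ c < 1 := by
  unfold θ; split_ifs <;> norm_num

theorem main (B : ℝ) (hB : 1 ≤ B) (c : ℕ) :
    ∃ C : ℝ, 0 < C ∧ ∃ N : ℕ, ∀ n : ℕ, N ≤ n →
      ∀ a q : ℕ, a ≤ q → 1 ≤ q → (q : ℝ) ≤ Real.log n ^ B → Nat.gcd a q = 1 →
        ∀ α : ℝ, |α - (a : ℝ) / q| ≤ Real.log n ^ B / n →
          ‖f5 n c α - S 5 q a / (Nat.totient q : ℂ) * (P n 5 ^ θ c : ℝ)‖ ≤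
            C * P n 5 ^ θ c * Real.log n ^ (-(4 * B)) := by
  obtain ⟨hθ0, hθ1⟩ := theta_bounds c
  set t := θ c with ht
  set κ : ℝ := t / 5 with hκ
  have hκ0 : 0 < κ := by positivity
  have hκ1 : κ ≤ 1 := by rw [hκ]; linarith
  set B' := ⌈B⌉₊ + 1 with hB'
  set A := ⌈5 * B⌉₊ with hA
  obtain ⟨C, hC, H⟩ := exp_sum A B'
  refine ⟨C / κ ^ A + 2 * Real.pi, by positivity, ?_⟩
  have hX : Tendsto (fun n : ℕ => (n:ℝ) ^ κ) atTop atTop :=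
    (tendsto_rpow_atTop hκ0).comp tendsto_natCast_atTop_atTop
  have hL : Tendsto (fun n : ℕ => Real.log n) atTop atTop :=
    Real.tendsto_log_atTop.comp tendsto_natCast_atTop_atTop
  have hLO := (tendsto_natCast_atTop_atTop (R := ℝ)).eventually
    ((isLittleO_log_rpow_rpow_atTop (5 * B + 1) (sub_pos.mpr hθ1)).bound one_pos)
  rw [← eventually_atTop]
  filter_upwards [hX.eventually H, hX.eventually_ge_atTop 1, hL.eventually_ge_atTop ((κ ^ B')⁻¹), hL.eventually_ge_atTop 1, hLO,
    eventually_ge_atTop 1] with n h1 hX1 h2 hL1 h3 hn1 a q haq hq1 hq hg α hα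
  haveI : NeZero q := ⟨by omega⟩
  have hnpos : (0:ℝ) < n := by exact_mod_cast hn1
  have hn1' : (1:ℝ) ≤ n := by exact_mod_cast hn1
  have hPX : P n 5 ^ t = (n:ℝ) ^ κ := by
    unfold P
    rw [← Real.rpow_mul hnpos.le]; congr 1; rw [hκ]; push_cast; ring
  have hX5 : ((n:ℝ) ^ κ) ^ 5 = (n:ℝ) ^ t := by
    rw [← Real.rpow_natCast, ← Real.rpow_mul hnpos.le]; congr 1; rw [hκ]; push_cast; ring
  have hlogX : Real.log ((n:ℝ) ^ κ) = κ * Real.log n := Real.log_rpow hnpos κ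
  have hXn : (n:ℝ) ^ κ ≤ n := by
    calc (n:ℝ) ^ κ ≤ (n:ℝ) ^ (1:ℝ) := Real.rpow_le_rpow_of_exponent_le hn1' hκ1
      _ = n := Real.rpow_one _
  rw [hPX]
  have hset : (Finset.range (n+1)).filter (fun p : ℕ => p.Prime ∧ 1 < (p:ℝ) ∧ (p:ℝ) ≤ (n:ℝ) ^ κ) =
      (Finset.Ioc 0 ⌊(n:ℝ) ^ κ⌋₊).filter Nat.Prime := by
    ext p
    simp only [Finset.mem_filter, Finset.mem_range, Finset.mem_Ioc]
    constructor
    · rintro ⟨_, hp, _, h⟩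
      exact ⟨⟨hp.pos, Nat.le_floor h⟩, hp⟩
    · rintro ⟨⟨_, h⟩, hp⟩
      have h' : (p:ℝ) ≤ (n:ℝ) ^ κ := (Nat.le_floor_iff (by linarith)).mp h
      refine ⟨?_, hp, by exact_mod_cast hp.one_lt, h'⟩
      have : (p:ℝ) ≤ n := h'.trans hXn
      have : p ≤ n := by exact_mod_cast this
      omega
  have hf : f5 n c α = ∑ p ∈ (Finset.Ioc 0 ⌊(n:ℝ) ^ κ⌋₊).filter Nat.Prime, e (α * (p:ℝ)^5) * (Real.log p : ℂ) := by
    unfold f5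
    rw [← ht, hPX, hset]
  set X := (n:ℝ) ^ κ with hXdef
  set L := Real.log n with hLdef
  have hL0 : 0 < L := by linarith
  have hX0 : 0 < X := by linarith
  have hqX : (q:ℝ) ≤ Real.log X ^ B' := by
    rw [hlogX]
    calc (q:ℝ) ≤ L ^ B := hq
      _ ≤ L ^ ((⌈B⌉₊ : ℕ) : ℝ) := Real.rpow_le_rpow_of_exponent_le hL1 (Nat.le_ceil B)
      _ = L ^ ⌈B⌉₊ := Real.rpow_natCast _ _
      _ = (κ ^ B' * (κ ^ B')⁻¹) * L ^ ⌈B⌉₊ := by rw [mul_inv_cancel₀ (by positivity), one_mul]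
      _ ≤ (κ ^ B' * L) * L ^ ⌈B⌉₊ := by gcongr
      _ = (κ * L) ^ B' := by rw [mul_pow, hB', pow_succ L]; ring
  have hmain := h1 q hqX a
  have e1 : q * (X / Real.log X ^ A) ≤ X * L ^ (-(4 * B)) / κ ^ A := by
    rw [hlogX, mul_pow]
    have hLA : L ^ (5 * B) ≤ L ^ A := by
      rw [← Real.rpow_natCast]
      exact Real.rpow_le_rpow_of_exponent_le hL1 (Nat.le_ceil _)
    have hLe : L ^ (-(4*B)) = L ^ B / L ^ (5 * B) := by
      rw [← Real.rpow_sub hL0]; congr 1; ring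
    rw [hLe]
    calc q * (X / (κ ^ A * L ^ A)) ≤ L ^ B * (X / (κ ^ A * L ^ (5 * B))) := by gcongr
      _ = X * (L ^ B / L ^ (5 * B)) / κ ^ A := by field_simp
  have e2 : ‖f5 n c α - ∑ p ∈ (Finset.Ioc 0 ⌊X⌋₊).filter Nat.Prime, e ((a:ℝ) * (p:ℝ)^5 / q) * (Real.log p : ℂ)‖
      ≤ 2 * Real.pi * (X * L ^ (-(4 * B))) := by
    rw [hf, ← Finset.sum_sub_distrib]
    have hterm : ∀ p ∈ (Finset.Ioc 0 ⌊X⌋₊).filter Nat.Prime, ‖e (α * (p:ℝ)^5) * (Real.log p : ℂ) - e ((a:ℝ) * (p:ℝ)^5 / q) * (Real.log p : ℂ)‖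
        ≤ 2 * Real.pi * (L ^ B / n * (n:ℝ) ^ t) * L := by
      intro p hp
      simp only [Finset.mem_filter, Finset.mem_Ioc] at hp
      have hpX : (p:ℝ) ≤ X := (Nat.le_floor_iff hX0.le).mp hp.1.2
      have hp0 : (0:ℝ) < p := by exact_mod_cast hp.1.1
      rw [← sub_mul, norm_mul, Complex.norm_real, Real.norm_of_nonneg (Real.log_natCast_nonneg p)]
      have hlp : Real.log p ≤ L := Real.log_le_log hp0 (hpX.trans hXn)
      have hd : |α * (p:ℝ)^5 - (a:ℝ) * (p:ℝ)^5 / q| ≤ L ^ B / n * (n:ℝ) ^ t := by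
        have : α * (p:ℝ)^5 - (a:ℝ) * (p:ℝ)^5 / q = (α - a / q) * (p:ℝ)^5 := by ring
        rw [this, abs_mul, abs_of_pos (show (0:ℝ) < (p:ℝ)^5 by positivity), ← hX5]
        gcongr
      have := e_sub (α * (p:ℝ)^5) ((a:ℝ) * (p:ℝ)^5 / q)
      have h0 := Real.log_natCast_nonneg p
      refine mul_le_mul (this.trans ?_) hlp h0 (by positivity)
      gcongr
    refine (norm_sum_le_of_le _ hterm).trans ?_
    rw [Finset.sum_const, nsmul_eq_mul]
    have hcard : ((((Finset.Ioc 0 ⌊X⌋₊).filter Nat.Prime).card : ℕ) : ℝ) ≤ X := by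
      calc ((((Finset.Ioc 0 ⌊X⌋₊).filter Nat.Prime).card : ℕ) : ℝ) ≤ (⌊X⌋₊ : ℝ) := by
            exact_mod_cast (Finset.card_filter_le _ _).trans (by simp)
        _ ≤ X := Nat.floor_le hX0.le
    rw [Real.norm_of_nonneg (by positivity), Real.norm_of_nonneg (by positivity), one_mul] at h3
    have hk : L ^ B / n * (n:ℝ) ^ t * L ≤ L ^ (-(4 * B)) := by
      have hnt : (n:ℝ) ^ t = n / (n:ℝ) ^ (1 - t) := by
        rw [Real.rpow_sub hnpos, Real.rpow_one]; field_simp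
      have hLL : L ^ (5 * B + 1) = L ^ B * L / L ^ (-(4*B)) := by
        rw [← Real.rpow_add_one hL0.ne', ← Real.rpow_sub hL0]; congr 1; ring
      have hpos : 0 < (n:ℝ) ^ (1 - t) := by positivity
      have hpos2 : 0 < L ^ (-(4*B)) := by positivity
      have : L ^ B / n * (n:ℝ) ^ t * L = L ^ B * L / (n:ℝ) ^ (1 - t) := by
        rw [hnt]; field_simp
      rw [this, div_le_iff₀ hpos]
      rw [hLL, div_le_iff₀ hpos2] at h3
      linarith
    calc _ ≤ X * (2 * Real.pi * (L ^ B / n * (n:ℝ) ^ t) * L) := by gcongr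
      _ = 2 * Real.pi * (X * (L ^ B / n * (n:ℝ) ^ t * L)) := by ring
      _ ≤ _ := by gcongr
  calc ‖f5 n c α - S 5 q a / (Nat.totient q : ℂ) * (X:ℂ)‖ ≤ _ := norm_sub_le_norm_sub_add_norm_sub _ (∑ p ∈ (Finset.Ioc 0 ⌊X⌋₊).filter Nat.Prime, e ((a:ℝ) * (p:ℝ)^5 / q) * (Real.log p : ℂ)) _
    _ ≤ 2 * Real.pi * (X * L ^ (-(4 * B))) + C * (X * L ^ (-(4 * B)) / κ ^ A) :=
      add_le_add e2 (hmain.trans (by gcongr))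
    _ = _ := by ring
end SW

/-- Major-arc approximation of `f_{5,c}(α)` (equation (3.3) of the paper). -/
theorem f5_major_arc_approx (B : ℝ) (hB : 1 ≤ B) (c : ℕ) (hc : c = 6 ∨ c = 7) :
    ∃ C : ℝ, 0 < C ∧ ∃ N : ℕ, ∀ n : ℕ, N ≤ n →
      ∀ a q : ℕ, a ≤ q → 1 ≤ q → (q : ℝ) ≤ Real.log n ^ B → Nat.gcd a q = 1 →
        ∀ α : ℝ, |α - (a : ℝ) / q| ≤ Real.log n ^ B / n →
          ‖f5 n c α - S 5 q a / (Nat.totient q : ℂ) * (P n 5 ^ θ c : ℝ)‖ ≤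
            C * P n 5 ^ θ c * Real.log n ^ (-(4 * B)) := by
  exact SW.main B hB c
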